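/- Uniqueness of minimal total-variation solutions: Let Ω ⊂ ℝ^d be the closure of a bounded convex domain, v : X_Ω → ℝ^d, g : X_Ω → ℝ measurable functions, and A ⊂ Ω a measurable set. Assume (Hyp): for each x ∈ A the solution of the characteristic system γ'(t) = v(t,γ(t)) a.e. on {h>0}, h'(t) = g(t,γ(t))h(t) a.e. on (0,1), with initial value (γ(0),h(0)) = (x,1), and with the regularity h_i,√h_i ∈ AC²[0,1], √h_i γ_i ∈ AC²([0,1];ℝ^d), is unique on [0,τ) for every τ ∈ (0,1) with [0,τ) ⊂ {h>0}. Then for any initial datum ρ₀ ∈ M⁺(Ω) concentrated on A, the continuity equation ∂_t ρ_t + div(v ρ_t) = g ρ_t admits at most one solution ρ ∈ D_{v,g} with initial datum ρ₀ such that ‖ρ‖_{M(X_Ω)} ≤ ‖ρ̃‖_{M(X_Ω)} for every ρ̃ ∈ D_{v,g} with ρ̃₀ = ρ₀. -/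

import Mathlib

open MeasureTheory Set Filter Topology
open scoped ENNReal NNReal

noncomputable section

namespace Paper

abbrev Euc (d : ℕ) : Type := EuclideanSpace ℝ (Fin d)

abbrev XX (d : ℕ) : Type := ℝ × Euc d

variable {d : ℕ}

/-- `Ω` is the closure of a bounded domain (a nonempty bounded open connected set). -/
def IsClosureOfBoundedDomain (Ω : Set (Euc d)) : Prop :=
  ∃ U : Set (Euc d), IsOpen U ∧ U.Nonempty ∧ IsConnected U ∧
    Bornology.IsBounded U ∧ Ω = closure U

/-- `Ω` is the closure of a bounded convex domain. -/
def IsClosureOfBoundedConvexDomain (Ω : Set (Euc d)) : Prop :=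
  ∃ U : Set (Euc d), IsOpen U ∧ U.Nonempty ∧ Convex ℝ U ∧
    Bornology.IsBounded U ∧ Ω = closure U

/-- clamping of `ℝ` onto `[0,1]`. -/
def clamp (t : ℝ) : ℝ := max 0 (min 1 t)

/-- `t ↦ ρ t` is a narrowly continuous curve (on `[0,1]`) of finite positive
measures concentrated on `Ω`, i.e. an element of `C_w([0,1]; M⁺(Ω))`. -/
def NarrowCurve (Ω : Set (Euc d)) (ρ : ℝ → Measure (Euc d)) : Prop :=
  (∀ t ∈ Icc (0:ℝ) 1, ρ t Ωᶜ = 0 ∧ ρ t Set.univ ≠ ⊤) ∧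
  (∀ φ : Euc d → ℝ, Continuous φ →
      ContinuousOn (fun t => ∫ x, φ x ∂(ρ t)) (Icc (0:ℝ) 1))

/-- Test functions for the continuity equation on `X_Ω = (0,1) × Ω` (no-flux form:
compact support in time, free at the spatial boundary). -/
def IsTest (φ : XX d → ℝ) : Prop :=
  ContDiff ℝ (⊤ : ℕ∞) φ ∧ HasCompactSupport φ ∧
    tsupport φ ⊆ Ioo (0:ℝ) 1 ×ˢ (Set.univ : Set (Euc d))

/-- Distributional solution of `∂ₜ ρ + div (v ρ) = g ρ`. -/
def SolvesCE (ρ : ℝ → Measure (Euc d)) (v : XX d → Euc d) (g : XX d → ℝ) : Prop :=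
  ∀ φ : XX d → ℝ, IsTest φ →
    (∫ t in Ioo (0:ℝ) 1,
      ∫ x, (fderiv ℝ φ (t, x) (1, v (t, x)) + φ (t, x) * g (t, x)) ∂(ρ t)) = 0

/-- The Hellinger–Kantorovich energy `∫₀¹ ∫ (|v|² + g²) dρ_t dt`. -/
def EnergyVG (ρ : ℝ → Measure (Euc d)) (v : XX d → Euc d) (g : XX d → ℝ) : ℝ≥0∞ :=
  ∫⁻ t in Ioo (0:ℝ) 1, ∫⁻ x, ENNReal.ofReal (‖v (t, x)‖ ^ 2 + g (t, x) ^ 2) ∂(ρ t)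

/-- The class `D_{v,g}` of finite-energy narrowly continuous solutions. -/
def Dvg (Ω : Set (Euc d)) (v : XX d → Euc d) (g : XX d → ℝ)
    (ρ : ℝ → Measure (Euc d)) : Prop :=
  NarrowCurve Ω ρ ∧ SolvesCE ρ v g ∧ EnergyVG ρ v g < ⊤

/-- total variation `‖ρ‖_{M(X_Ω)}` of `ρ = dt ⊗ ρ_t`. -/
def TVcurve (ρ : ℝ → Measure (Euc d)) : ℝ≥0∞ :=
  ∫⁻ t in Ioo (0:ℝ) 1, ρ t Set.univ

/-- The cone `𝒞_V = {h δ_γ : h ≥ 0, γ ∈ V}` of weighted Dirac masses. -/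
def coneSet (V : Set (Euc d)) : Set (Measure (Euc d)) :=
  {μ | ∃ (a : ℝ) (x : Euc d), 0 ≤ a ∧ x ∈ V ∧ μ = ENNReal.ofReal a • Measure.dirac x}

/-- The space `𝒮_V` of narrowly continuous curves `[0,1] → 𝒞_V`
(extended to `ℝ` by clamping). -/
structure SCurve (V : Set (Euc d)) where
  toFun : ℝ → Measure (Euc d)
  clamped : ∀ t, toFun t = toFun (clamp t)
  cone : ∀ t, toFun t ∈ coneSet V
  narrow : ∀ φ : Euc d → ℝ, Continuous φ → Continuous fun t => ∫ x, φ x ∂(toFun t)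

/-- The flat distance `D_F` between measures. -/
def flatDist (μ ν : Measure (Euc d)) : ℝ :=
  sSup {r : ℝ | ∃ φ : Euc d → ℝ, Continuous φ ∧ (∀ x, |φ x| ≤ 1) ∧ LipschitzWith 1 φ ∧
        r = (∫ x, φ x ∂μ) - ∫ x, φ x ∂ν}

/-- The supremum distance `D` on `𝒮_V`. -/
def Ddist {V : Set (Euc d)} (η₁ η₂ : SCurve V) : ℝ :=
  sSup {r : ℝ | ∃ t ∈ Icc (0:ℝ) 1, r = flatDist (η₁.toFun t) (η₂.toFun t)}

/-- The topology of `(𝒮_V, D)`, generated by the open `D`-balls. -/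
def Stop (V : Set (Euc d)) : TopologicalSpace (SCurve V) :=
  TopologicalSpace.generateFrom
    {s | ∃ (η₀ : SCurve V) (ε : ℝ), 0 < ε ∧ s = {η | Ddist η₀ η < ε}}

/-- The Borel σ-algebra of `(𝒮_V, D)`. -/
def Sborel (V : Set (Euc d)) : MeasurableSpace (SCurve V) := @borel _ (Stop V)

instance (V : Set (Euc d)) : MeasurableSpace (SCurve V) := Sborel V

/-- `‖h‖_∞` for a curve `ρ_t = h(t) δ_{γ(t)} ∈ 𝒮_V`. -/
def supMass {V : Set (Euc d)} (η : SCurve V) : ℝ≥0∞ :=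
  ⨆ t ∈ Icc (0:ℝ) 1, η.toFun t Set.univ

/-- `AC²[0,1]`: absolutely continuous on `[0,1]` with a.e. derivative in `L²`. -/
def AC2 {F : Type*} [NormedAddCommGroup F] [NormedSpace ℝ F] (f : ℝ → F) : Prop :=
  ∃ f' : ℝ → F, IntegrableOn f' (Icc (0:ℝ) 1) ∧
    IntegrableOn (fun t => ‖f' t‖ ^ 2) (Icc (0:ℝ) 1) ∧
    ∀ t ∈ Icc (0:ℝ) 1, f t = f 0 + ∫ s in (0:ℝ)..t, f' s

/-- `(γ, h)` represents the curve `η ∈ 𝒮_V`, i.e. `η_t = h(t) δ_{γ(t)}` on `[0,1]`. -/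
def Represents {V : Set (Euc d)} (η : SCurve V) (γ : ℝ → Euc d) (h : ℝ → ℝ) : Prop :=
  ∀ t ∈ Icc (0:ℝ) 1, 0 ≤ h t ∧ γ t ∈ V ∧
    η.toFun t = ENNReal.ofReal (h t) • Measure.dirac (γ t)

/-- The set `H_V ⊆ 𝒮_V` of curves `h(t)δ_{γ(t)}` with `h, √h ∈ AC²[0,1]`,
`√h γ ∈ AC²([0,1];ℝ^d)`. -/
def MemH (V : Set (Euc d)) (η : SCurve V) : Prop :=
  ∃ (γ : ℝ → Euc d) (h : ℝ → ℝ), Represents η γ h ∧ AC2 h ∧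
    AC2 (fun t => Real.sqrt (h t)) ∧ AC2 (fun t => Real.sqrt (h t) • γ t)

/-- The set `H_V^{v,g}`: curves in `H_V` solving the characteristic system
`γ' = v(t,γ)` a.e. on `{h>0}` and `h' = g(t,γ) h` a.e. on `(0,1)`. -/
def MemHvg (V : Set (Euc d)) (v : XX d → Euc d) (g : XX d → ℝ) (η : SCurve V) : Prop :=
  ∃ (γ : ℝ → Euc d) (h : ℝ → ℝ), Represents η γ h ∧ AC2 h ∧
    AC2 (fun t => Real.sqrt (h t)) ∧ AC2 (fun t => Real.sqrt (h t) • γ t) ∧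
    (∀ᵐ t ∂(volume.restrict {t | t ∈ Ioo (0:ℝ) 1 ∧ 0 < h t}),
        HasDerivAt γ (v (t, γ t)) t) ∧
    (∀ᵐ t ∂(volume.restrict (Ioo (0:ℝ) 1)),
        HasDerivAt h (g (t, γ t) * h t) t)

/-- The set `𝒮*_V` of curves whose positivity set `{h > 0}` is `[0,1] ∩ (-∞, τ)`. -/
def MemSstar {V : Set (Euc d)} (η : SCurve V) : Prop :=
  ∃ τ : ℝ, {t | t ∈ Icc (0:ℝ) 1 ∧ η.toFun t Set.univ ≠ 0} = Icc (0:ℝ) 1 ∩ Iio τ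

/-- The vanishing time `τ(γ,h) = min { t ∈ [0,1] : h(t) = 0 }` (`∞` if none). -/
def tauS {V : Set (Euc d)} (η : SCurve V) : ℝ≥0∞ :=
  sInf {c : ℝ≥0∞ | ∃ t ∈ Icc (0:ℝ) 1, η.toFun t Set.univ = 0 ∧ c = ENNReal.ofReal t}


open Classical in
/-- The integrand `Ψ_δ(t,x,y)`. -/
def Psi (δ : ℝ) (t : ℝ) (x : Euc d) (y : ℝ) : ℝ≥0∞ :=
  if 0 < t then ENNReal.ofReal ((‖x‖ ^ 2 + δ ^ 2 * y ^ 2) / (2 * t))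
  else if t = 0 ∧ x = 0 ∧ y = 0 then 0 else ⊤

/-- `u` is a density of the signed measure `σ` with respect to `lam`. -/
def IsDensityS (σ : SignedMeasure (XX d)) (lam : Measure (XX d)) (u : XX d → ℝ) : Prop :=
  ∀ s : Set (XX d), MeasurableSet s → σ s = ∫ x in s, u x ∂lam

/-- `w` is a density of the vector measure `m` with respect to `lam`. -/
def IsDensityV (m : VectorMeasure (XX d) (Euc d)) (lam : Measure (XX d))
    (w : XX d → Euc d) : Prop :=
  ∀ s : Set (XX d), MeasurableSet s → m s = ∫ x in s, w x ∂lam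

/-- `r` is a density of the positive measure `P` with respect to `lam`. -/
def IsDensityP (P : Measure (XX d)) (lam : Measure (XX d)) (r : XX d → ℝ) : Prop :=
  ∀ s : Set (XX d), MeasurableSet s → P s = ∫⁻ x in s, ENNReal.ofReal (r x) ∂lam

/-- `(P, m, μ)` is a measure solution of `∂ₜ ρ + div m = μ` (with `P` positive). -/
def SolvesCEMeas (P : Measure (XX d)) (m : VectorMeasure (XX d) (Euc d))
    (μ : SignedMeasure (XX d)) : Prop :=
  ∀ (lam : Measure (XX d)), IsFiniteMeasure lam →
    ∀ (w : XX d → Euc d) (u : XX d → ℝ), Measurable w → Measurable u →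
      IsDensityV m lam w → IsDensityS μ lam u →
      ∀ φ : XX d → ℝ, IsTest φ →
        ((∫ x, fderiv ℝ φ x ((1:ℝ), (0 : Euc d)) ∂P) +
          (∫ x, fderiv ℝ φ x ((0:ℝ), w x) ∂lam) + ∫ x, φ x * u x ∂lam) = 0

/-- The Wasserstein–Fisher–Rao energy `B_δ(ρ,m,μ)` for a positive `ρ`. -/
def BdeltaMeas (δ : ℝ) (P : Measure (XX d)) (m : VectorMeasure (XX d) (Euc d))
    (μ : SignedMeasure (XX d)) : ℝ≥0∞ :=
  sInf {c : ℝ≥0∞ | ∃ lam : Measure (XX d), IsFiniteMeasure lam ∧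
    ∃ (r : XX d → ℝ) (w : XX d → Euc d) (u : XX d → ℝ),
      Measurable r ∧ Measurable w ∧ Measurable u ∧ (∀ x, 0 ≤ r x) ∧
      IsDensityP P lam r ∧ IsDensityV m lam w ∧ IsDensityS μ lam u ∧
      c = ∫⁻ x, Psi δ (r x) (w x) (u x) ∂lam}

open Classical in
/-- The coercive energy `J_{α,β,δ}(ρ,m,μ)` for a positive `ρ`. -/
def JMeas (α β δ : ℝ) (P : Measure (XX d)) (m : VectorMeasure (XX d) (Euc d))
    (μ : SignedMeasure (XX d)) : ℝ≥0∞ :=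
  if SolvesCEMeas P m μ then
    ENNReal.ofReal β * BdeltaMeas δ P m μ + ENNReal.ofReal α * P Set.univ
  else ⊤

/-- `(ρ, m, μ)` is a measure solution of `∂ₜ ρ + div m = μ` (signed case). -/
def SolvesCESigned (ρ : SignedMeasure (XX d)) (m : VectorMeasure (XX d) (Euc d))
    (μ : SignedMeasure (XX d)) : Prop :=
  ∀ (lam : Measure (XX d)), IsFiniteMeasure lam →
    ∀ (r : XX d → ℝ) (w : XX d → Euc d) (u : XX d → ℝ),
      Measurable r → Measurable w → Measurable u →
      IsDensityS ρ lam r → IsDensityV m lam w → IsDensityS μ lam u →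
      ∀ φ : XX d → ℝ, IsTest φ →
        (∫ x, (fderiv ℝ φ x ((1:ℝ), (0 : Euc d)) * r x
          + fderiv ℝ φ x ((0:ℝ), w x) + φ x * u x) ∂lam) = 0

/-- The Wasserstein–Fisher–Rao energy `B_δ(ρ,m,μ)`, signed case. -/
def BdeltaSigned (δ : ℝ) (ρ : SignedMeasure (XX d)) (m : VectorMeasure (XX d) (Euc d))
    (μ : SignedMeasure (XX d)) : ℝ≥0∞ :=
  sInf {c : ℝ≥0∞ | ∃ lam : Measure (XX d), IsFiniteMeasure lam ∧
    ∃ (r : XX d → ℝ) (w : XX d → Euc d) (u : XX d → ℝ),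
      Measurable r ∧ Measurable w ∧ Measurable u ∧
      IsDensityS ρ lam r ∧ IsDensityV m lam w ∧ IsDensityS μ lam u ∧
      c = ∫⁻ x, Psi δ (r x) (w x) (u x) ∂lam}

open Classical in
/-- The coercive energy `J_{α,β,δ}(ρ,m,μ)`, signed case. -/
def JSigned (α β δ : ℝ) (ρ : SignedMeasure (XX d)) (m : VectorMeasure (XX d) (Euc d))
    (μ : SignedMeasure (XX d)) : ℝ≥0∞ :=
  if SolvesCESigned ρ m μ then
    ENNReal.ofReal β * BdeltaSigned δ ρ m μ
      + ENNReal.ofReal α * ρ.totalVariation Set.univ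
  else ⊤

/-- A signed measure on `X = ℝ × ℝ^d` is concentrated on `X_Ω = (0,1) × Ω`. -/
def ConcS (Ω : Set (Euc d)) (ρ : SignedMeasure (XX d)) : Prop :=
  ∀ s : Set (XX d), MeasurableSet s → s ⊆ (Ioo (0:ℝ) 1 ×ˢ Ω)ᶜ → ρ s = 0

/-- A vector measure on `X = ℝ × ℝ^d` is concentrated on `X_Ω = (0,1) × Ω`. -/
def ConcV (Ω : Set (Euc d)) (m : VectorMeasure (XX d) (Euc d)) : Prop :=
  ∀ s : Set (XX d), MeasurableSet s → s ⊆ (Ioo (0:ℝ) 1 ×ˢ Ω)ᶜ → m s = 0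

/-- Integral of `φ` against a signed measure. -/
def sInt {α : Type*} [MeasurableSpace α] (σ : SignedMeasure α) (φ : α → ℝ) : ℝ :=
  (∫ x, φ x ∂σ.toJordanDecomposition.posPart) -
    ∫ x, φ x ∂σ.toJordanDecomposition.negPart

/-- Triples `(ρ, m, μ) ∈ M(X_Ω) × M(X_Ω; ℝ^d) × M(X_Ω)`. -/
abbrev Mtriple (d : ℕ) : Type :=
  SignedMeasure (XX d) × VectorMeasure (XX d) (Euc d) × SignedMeasure (XX d)

/-- `P` is the measure `dt ⊗ ρ_t` associated with the curve `η ∈ 𝒮_V`. -/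
def CurveMeasure {V : Set (Euc d)} (η : SCurve V) (P : Measure (XX d)) : Prop :=
  ∀ s : Set (XX d), MeasurableSet s →
    P s = ∫⁻ t in Ioo (0:ℝ) 1, η.toFun t {x | (t, x) ∈ s}

/-- `h'` and `γ'` are the a.e. derivatives of `h` on `(0,1)` and of `γ` on `{h>0}`. -/
def HasAEDerivs (γ : ℝ → Euc d) (h : ℝ → ℝ) (γ' : ℝ → Euc d) (h' : ℝ → ℝ) : Prop :=
  (∀ᵐ t ∂(volume.restrict (Ioo (0:ℝ) 1)), HasDerivAt h (h' t) t) ∧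
  (∀ᵐ t ∂(volume.restrict {t | t ∈ Ioo (0:ℝ) 1 ∧ 0 < h t}), HasDerivAt γ (γ' t) t)

/-- The triple `p = (ρ, m, μ)` is of characteristic form
`ρ = h dt ⊗ δ_γ`, `m = γ' ρ`, `μ = h' dt ⊗ δ_γ` with the regularity of `H_Ω`. -/
def CharRepr (Ω : Set (Euc d)) (γ : ℝ → Euc d) (h : ℝ → ℝ) (γ' : ℝ → Euc d)
    (h' : ℝ → ℝ) (p : Mtriple d) : Prop :=
  (∀ t ∈ Icc (0:ℝ) 1, 0 ≤ h t ∧ γ t ∈ Ω) ∧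
  AC2 h ∧ AC2 (fun t => Real.sqrt (h t)) ∧ AC2 (fun t => Real.sqrt (h t) • γ t) ∧
  (∀ φ : Euc d → ℝ, Continuous φ →
      ContinuousOn (fun t => h t * φ (γ t)) (Icc (0:ℝ) 1)) ∧
  HasAEDerivs γ h γ' h' ∧
  (∀ s : Set (XX d), MeasurableSet s →
      p.1 s = ∫ t in Ioo (0:ℝ) 1, Set.indicator {u : ℝ | (u, γ u) ∈ s} h t) ∧
  (∀ s : Set (XX d), MeasurableSet s →
      p.2.1 s = ∫ t in Ioo (0:ℝ) 1,
        Set.indicator {u : ℝ | (u, γ u) ∈ s} (fun u => h u • γ' u) t) ∧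
  (∀ s : Set (XX d), MeasurableSet s →
      p.2.2 s = ∫ t in Ioo (0:ℝ) 1, Set.indicator {u : ℝ | (u, γ u) ∈ s} h' t)

/-- The set `𝒞` of extremal characteristic triples. -/
def MemC (α β δ : ℝ) (Ω : Set (Euc d)) (p : Mtriple d) : Prop :=
  ∃ (γ : ℝ → Euc d) (h : ℝ → ℝ) (γ' : ℝ → Euc d) (h' : ℝ → ℝ),
    CharRepr Ω γ h γ' h' p ∧
    IsPreconnected {t | t ∈ Icc (0:ℝ) 1 ∧ 0 < h t} ∧
    JSigned α β δ p.1 p.2.1 p.2.2 = 1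


/-- Curves in `C_w([0,1]; M(Ω))`: narrowly continuous curves of signed measures
concentrated on `Ω`, extended to `ℝ` by clamping. -/
def IsCwCurve (Ω : Set (Euc d)) (f : ℝ → SignedMeasure (Euc d)) : Prop :=
  (∀ t, f t = f (clamp t)) ∧
  (∀ t, ∀ s : Set (Euc d), MeasurableSet s → s ⊆ Ωᶜ → f t s = 0) ∧
  (∀ φ : Euc d → ℝ, Continuous φ → Continuous fun t => sInt (f t) φ)

/-- `r` is a density with respect to `lam` of the measure `dt ⊗ f_t` on `X`. -/
def CwDensity (f : ℝ → SignedMeasure (Euc d)) (lam : Measure (XX d))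
    (r : XX d → ℝ) : Prop :=
  ∀ s : Set (XX d), MeasurableSet s →
    (∫ t in Ioo (0:ℝ) 1,
        sInt (f t) ({x : Euc d | (t, x) ∈ s}.indicator fun _ => (1:ℝ)))
      = ∫ x in s, r x ∂lam

/-- `(f, m, μ)` is a measure solution of `∂ₜ ρ + div m = μ`, `f` a curve. -/
def SolvesCECw (f : ℝ → SignedMeasure (Euc d)) (m : VectorMeasure (XX d) (Euc d))
    (μ : SignedMeasure (XX d)) : Prop :=
  ∀ (lam : Measure (XX d)), IsFiniteMeasure lam →
    ∀ (w : XX d → Euc d) (u : XX d → ℝ), Measurable w → Measurable u →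
      IsDensityV m lam w → IsDensityS μ lam u →
      ∀ φ : XX d → ℝ, IsTest φ →
        ((∫ t in Ioo (0:ℝ) 1, sInt (f t) fun x => fderiv ℝ φ (t, x) ((1:ℝ), (0 : Euc d)))
          + (∫ x, fderiv ℝ φ x ((0:ℝ), w x) ∂lam) + ∫ x, φ x * u x ∂lam) = 0

/-- `B_δ(dt ⊗ f_t, m, μ)`. -/
def BdeltaCw (δ : ℝ) (f : ℝ → SignedMeasure (Euc d)) (m : VectorMeasure (XX d) (Euc d))
    (μ : SignedMeasure (XX d)) : ℝ≥0∞ :=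
  sInf {c : ℝ≥0∞ | ∃ lam : Measure (XX d), IsFiniteMeasure lam ∧
    ∃ (r : XX d → ℝ) (w : XX d → Euc d) (u : XX d → ℝ),
      Measurable r ∧ Measurable w ∧ Measurable u ∧
      CwDensity f lam r ∧ IsDensityV m lam w ∧ IsDensityS μ lam u ∧
      c = ∫⁻ x, Psi δ (r x) (w x) (u x) ∂lam}

/-- `‖dt ⊗ f_t‖_{M(X_Ω)}`. -/
def TVCw (f : ℝ → SignedMeasure (Euc d)) : ℝ≥0∞ :=
  ∫⁻ t in Ioo (0:ℝ) 1, (f t).totalVariation Set.univ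

open Classical in
/-- `J_{α,β,δ}(dt ⊗ f_t, m, μ)`. -/
def JCw (α β δ : ℝ) (f : ℝ → SignedMeasure (Euc d)) (m : VectorMeasure (XX d) (Euc d))
    (μ : SignedMeasure (XX d)) : ℝ≥0∞ :=
  if SolvesCECw f m μ then
    ENNReal.ofReal β * BdeltaCw δ f m μ + ENNReal.ofReal α * TVCw f
  else ⊤

/-- The set `𝒞` in curve form: `(f, m, μ)` with `f_t = h(t) δ_{γ(t)}`,
`m = h γ' dt ⊗ δ_γ`, `μ = h' dt ⊗ δ_γ`, with `H_Ω`-regularity, connected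
positivity set and unit energy. -/
def MemCCw (α β δ : ℝ) (Ω : Set (Euc d)) (f : ℝ → SignedMeasure (Euc d))
    (m : VectorMeasure (XX d) (Euc d)) (μ : SignedMeasure (XX d)) : Prop :=
  ∃ (γ : ℝ → Euc d) (h : ℝ → ℝ) (γ' : ℝ → Euc d) (h' : ℝ → ℝ),
    (∀ t ∈ Icc (0:ℝ) 1, 0 ≤ h t ∧ γ t ∈ Ω) ∧
    AC2 h ∧ AC2 (fun t => Real.sqrt (h t)) ∧ AC2 (fun t => Real.sqrt (h t) • γ t) ∧
    (∀ φ : Euc d → ℝ, Continuous φ →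
        ContinuousOn (fun t => h t * φ (γ t)) (Icc (0:ℝ) 1)) ∧
    HasAEDerivs γ h γ' h' ∧
    (∀ t, f t = h (clamp t) • (Measure.dirac (γ (clamp t))).toSignedMeasure) ∧
    (∀ s : Set (XX d), MeasurableSet s →
        m s = ∫ t in Ioo (0:ℝ) 1,
          Set.indicator {u : ℝ | (u, γ u) ∈ s} (fun u => h u • γ' u) t) ∧
    (∀ s : Set (XX d), MeasurableSet s →
        μ s = ∫ t in Ioo (0:ℝ) 1, Set.indicator {u : ℝ | (u, γ u) ∈ s} h' t) ∧
    IsPreconnected {t | t ∈ Icc (0:ℝ) 1 ∧ 0 < h t} ∧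
    JCw α β δ f m μ = 1

/-- The mollified density `ρ_t ∗ ξ_ε + ε χ_V`. -/
def mollDens (V : Set (Euc d)) (ρ : ℝ → Measure (Euc d)) (ξ : Euc d → ℝ) (ε : ℝ)
    (t : ℝ) (x : Euc d) : ℝ :=
  (∫ y, (ε ^ d)⁻¹ * ξ (ε⁻¹ • (x - y)) ∂(ρ t)) + ε * V.indicator (fun _ => (1:ℝ)) x

/-- The mollified measure `ρ_t^ε = (ρ_t ∗ ξ_ε + ε χ_V) dx`. -/
def mollRho (V : Set (Euc d)) (ρ : ℝ → Measure (Euc d)) (ξ : Euc d → ℝ) (ε : ℝ) :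
    ℝ → Measure (Euc d) :=
  fun t => volume.withDensity fun x => ENNReal.ofReal (mollDens V ρ ξ ε t x)

open Classical in
/-- The mollified velocity field `v^ε = ((v ρ_t) ∗ ξ_ε) / ρ_t^ε`. -/
def mollV (V : Set (Euc d)) (ρ : ℝ → Measure (Euc d)) (v : XX d → Euc d)
    (ξ : Euc d → ℝ) (ε : ℝ) : XX d → Euc d :=
  fun p => if mollDens V ρ ξ ε p.1 p.2 = 0 then 0 else
    (mollDens V ρ ξ ε p.1 p.2)⁻¹ •
      ∫ y, ((ε ^ d)⁻¹ * ξ (ε⁻¹ • (p.2 - y))) • v (p.1, y) ∂(ρ p.1)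

open Classical in
/-- The mollified growth field `g^ε = ((g ρ_t) ∗ ξ_ε) / ρ_t^ε`. -/
def mollG (V : Set (Euc d)) (ρ : ℝ → Measure (Euc d)) (g : XX d → ℝ)
    (ξ : Euc d → ℝ) (ε : ℝ) : XX d → ℝ :=
  fun p => if mollDens V ρ ξ ε p.1 p.2 = 0 then 0 else
    (mollDens V ρ ξ ε p.1 p.2)⁻¹ *
      ∫ y, ((ε ^ d)⁻¹ * ξ (ε⁻¹ • (p.2 - y))) * g (p.1, y) ∂(ρ p.1)

section
theorem trace_bound (n : ℕ) : ∃ C : ℝ, 0 ≤ C ∧ ∀ T : Euc n →L[ℝ] Euc n,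
    |LinearMap.trace ℝ _ (T : Euc n →ₗ[ℝ] Euc n)| ≤ C * ‖T‖ := by
  let L : (Euc n →L[ℝ] Euc n) →ₗ[ℝ] ℝ :=
    (LinearMap.trace ℝ (Euc n)) ∘ₗ (ContinuousLinearMap.coeLM ℝ)
  let L' := LinearMap.toContinuousLinearMap L
  exact ⟨‖L'‖, L'.opNorm_nonneg, fun T => L'.le_opNorm T⟩

theorem det_contDiff (n : ℕ) :
    ContDiff ℝ 2 (fun T : Euc n →L[ℝ] Euc n => (ContinuousLinearMap.id ℝ (Euc n) + T).det) := by
  let b := (EuclideanSpace.basisFun (Fin n) ℝ).toBasis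
  have h : (fun T : Euc n →L[ℝ] Euc n => (ContinuousLinearMap.id ℝ (Euc n) + T).det) =
      fun T => Matrix.det (LinearMap.toMatrix b b
        ((ContinuousLinearMap.id ℝ (Euc n) + T : Euc n →L[ℝ] Euc n) : Euc n →ₗ[ℝ] Euc n)) := by
    funext T
    rw [LinearMap.det_toMatrix]
  rw [h]
  simp only [Matrix.det_apply]
  refine ContDiff.sum fun σ _ => ?_
  refine ContDiff.const_smul _ ?_
  refine contDiff_prod fun i _ => ?_
  let L : (Euc n →L[ℝ] Euc n) →ₗ[ℝ] ℝ :=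
    { toFun := fun T => LinearMap.toMatrix b b (T : Euc n →ₗ[ℝ] Euc n) (σ i) i
      map_add' := by intro x y; simp
      map_smul' := by intro x y; simp }
  let L' := LinearMap.toContinuousLinearMap L
  exact L'.contDiff.comp (contDiff_const.add contDiff_id)

theorem det_bound (n : ℕ) : ∃ C : ℝ, 0 ≤ C ∧ ∀ T : Euc n →L[ℝ] Euc n, ‖T‖ ≤ 1 →
    1 + LinearMap.trace ℝ _ (T : Euc n →ₗ[ℝ] Euc n) - C * ‖T‖ ^ 2 ≤
      (ContinuousLinearMap.id ℝ (Euc n) + T).det := by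
  set f := fun T : Euc n →L[ℝ] Euc n => (ContinuousLinearMap.id ℝ (Euc n) + T).det with hf
  have hfc : ContDiff ℝ 2 f := det_contDiff n
  have hd1 : ContDiff ℝ 1 (fderiv ℝ f) := hfc.fderiv_right (by norm_num)
  obtain ⟨K, hK⟩ := (hd1.locallyLipschitz.locallyLipschitzOn (s := Metric.closedBall 0 1)).exists_lipschitzOnWith_of_compact (isCompact_closedBall _ _)
  have hder : ∀ T, fderiv ℝ f 0 T = LinearMap.trace ℝ _ (T : Euc n →ₗ[ℝ] Euc n) := by
    intro T
    let b := (EuclideanSpace.basisFun (Fin n) ℝ).toBasis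
    have h1 : HasDerivAt (fun t : ℝ => f (t • T)) (fderiv ℝ f 0 T) 0 := by
      have h0 : HasFDerivAt f (fderiv ℝ f 0) ((0:ℝ) • T) := by
        have e : (0:ℝ) • T = 0 := by ext; simp
        rw [e]; exact (hfc.differentiable (by norm_num)).differentiableAt.hasFDerivAt
      have h2 : HasDerivAt (fun t : ℝ => t • T) T 0 := by
        simpa using (hasDerivAt_id (0:ℝ)).smul_const T
      exact h0.comp_hasDerivAt _ h2
    have h3 : (fun t : ℝ => f (t • T)) = fun t : ℝ => Matrix.det (1 + t • LinearMap.toMatrix b b (T : Euc n →ₗ[ℝ] Euc n)) := by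
      funext t
      simp only [hf]
      rw [ContinuousLinearMap.det, ← LinearMap.det_toMatrix b]
      congr 1
      simp
    rw [h3] at h1
    have h4 : HasDerivAt (fun t : ℝ => Matrix.det (1 + t • LinearMap.toMatrix b b (T : Euc n →ₗ[ℝ] Euc n)))
       (Matrix.trace (LinearMap.toMatrix b b (T : Euc n →ₗ[ℝ] Euc n))) 0 := by
      have := (((hasDerivAt_id (0:ℝ)).const_mul (Matrix.trace (LinearMap.toMatrix b b (T : Euc n →ₗ[ℝ] Euc n)))).const_add 1).add (((Polynomial.divX (Polynomial.divX (Matrix.det (1 + (Polynomial.X : Polynomial ℝ) • (LinearMap.toMatrix b b (T : Euc n →ₗ[ℝ] Euc n)).map Polynomial.C)))).hasDerivAt 0).mul ((hasDerivAt_id (0:ℝ)).pow 2))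
      refine (this.congr_of_eventuallyEq (Eventually.of_forall fun t => ?_)).congr_deriv ?_
      · rw [Matrix.det_one_add_smul]; simp
      · simp
    rw [h1.unique h4, LinearMap.trace_eq_matrix_trace ℝ b]
  refine ⟨K, K.2, fun T hT => ?_⟩
  have hmv := (convex_closedBall (0 : Euc n →L[ℝ] Euc n) ‖T‖).norm_image_sub_le_of_norm_hasFDerivWithin_le' (f := f) (f' := fderiv ℝ f) (φ := fderiv ℝ f 0) (C := K * ‖T‖) (x := 0) (y := T)
    (fun x _ => (hfc.differentiable (by norm_num)).differentiableAt.hasFDerivAt.hasFDerivWithinAt)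
    (fun x hx => by
      have hx' : ‖x‖ ≤ ‖T‖ := by simpa using hx
      have := hK.dist_le_mul x (by simpa using hx'.trans hT) 0 (by simp)
      rw [dist_eq_norm, dist_zero_right] at this
      exact this.trans (by gcongr))
    (by simp) (by simp)
  rw [sub_zero, hder] at hmv
  have h0 : f 0 = 1 := by simp [hf, ContinuousLinearMap.det]
  rw [h0, Real.norm_eq_abs] at hmv
  have := (abs_le.1 hmv).1
  have e : (K:ℝ) * ‖T‖ ^ 2 = K * ‖T‖ * ‖T‖ := by ring
  rw [e]
  show _ ≤ f T
  linarith
end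

section
theorem num_step (K : ℝ) (hK : 0 ≤ K) : ∃ C α0 : ℝ, 0 ≤ C ∧ 0 < α0 ∧ ∀ α, 0 ≤ α → α ≤ α0 →
    ∀ u T b D V : ℝ, 0 < u → |T| ≤ K * α → |b| ≤ K * α →
      u * (1 - T + 2 * b - K * α ^ 2) ≤ V → 1 + T - K * α ^ 2 ≤ D →
      0 ≤ V ∧ (1 + b) ^ 2 * u ≤ (1 + C * α ^ 2) * (D * V) := by
  refine ⟨2 * (3 * K + 3 * K ^ 2 + K ^ 2), 1 / (24 * (1 + K) ^ 2), by positivity, by positivity, ?_⟩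
  intro α hα hα0 u T b D V hu hT hb hV hD
  have h1 : (1 + K) ^ 2 * α ≤ 1 / 24 := by
    rw [le_div_iff₀ (by positivity)] at hα0
    linarith
  have hKα : K * α ≤ 1 / 24 := by
    refine le_trans ?_ h1
    have : K ≤ (1 + K) ^ 2 := by nlinarith
    gcongr
  have hα1 : α ≤ 1 := by
    have : 1 * α ≤ (1 + K) ^ 2 * α := by
      gcongr
      nlinarith
    linarith
  have hα2 : α ^ 2 ≤ α := by nlinarith
  have hκ : K * α ^ 2 ≤ 1 / 24 := le_trans (by gcongr) hKα
  have hC5 : (3 * K + 3 * K ^ 2) * α ^ 2 ≤ 1 / 8 := by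
    have : (3 * K + 3 * K ^ 2) * α ^ 2 ≤ (3 * (1 + K) ^ 2) * α := by
      gcongr
      nlinarith
    linarith
  set κ := K * α ^ 2 with hκd
  have hκ0 : 0 ≤ κ := by positivity
  set e := K * α with he
  have he0 : 0 ≤ e := by positivity
  have hT' := abs_le.1 hT
  have hb' := abs_le.1 hb
  have hF : 0 ≤ 1 - T + 2 * b - κ := by linarith [hT'.2, hb'.1]
  have hV0 : 0 ≤ V := le_trans (by positivity) hV
  refine ⟨hV0, ?_⟩
  have hDV : (1 + T - κ) * (u * (1 - T + 2 * b - κ)) ≤ D * V := by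
    apply mul_le_mul hD hV (by positivity)
    linarith [hT'.1]
  have hTT : T ^ 2 ≤ e ^ 2 := by rw [← sq_abs T]; gcongr
  have hbb : b ^ 2 ≤ e ^ 2 := by rw [← sq_abs b]; gcongr
  have hbT : -(e * e) ≤ b * T := by
    have : |b * T| ≤ e * e := by rw [abs_mul]; gcongr
    exact (abs_le.1 this).1
  have hbκ : b * κ ≤ κ := by nlinarith [hb'.2]
  have hX : 1 + 2 * b - (3 * K + 3 * K ^ 2) * α ^ 2 - κ / 100 * 0 ≤ (1 + T - κ) * (1 - T + 2 * b - κ) := by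
    have e1 : (3 * K + 3 * K ^ 2) * α ^ 2 = 3 * κ + 3 * e ^ 2 := by rw [hκd, he]; ring
    rw [e1]
    have hbκ2 : 2 * (b * κ) ≤ κ := by nlinarith [hb'.2]
    nlinarith [sq_nonneg κ]
  set X := 1 + 2 * b - (3 * K + 3 * K ^ 2) * α ^ 2 with hXd
  have hX2 : 1 / 2 ≤ X := by linarith [hb'.1]
  have hmain : (1 + b) ^ 2 ≤ (1 + 2 * (3 * K + 3 * K ^ 2 + K ^ 2) * α ^ 2) * X := by
    have e2 : K ^ 2 * α ^ 2 = e ^ 2 := by rw [he]; ring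
    have h5 : (2 * (3 * K + 3 * K ^ 2 + K ^ 2) * α ^ 2) * (1 / 2) ≤ (2 * (3 * K + 3 * K ^ 2 + K ^ 2) * α ^ 2) * X := by
      gcongr
    nlinarith
  calc (1 + b) ^ 2 * u ≤ ((1 + 2 * (3 * K + 3 * K ^ 2 + K ^ 2) * α ^ 2) * X) * u := by gcongr
    _ = (1 + 2 * (3 * K + 3 * K ^ 2 + K ^ 2) * α ^ 2) * (X * u) := by ring
    _ ≤ (1 + 2 * (3 * K + 3 * K ^ 2 + K ^ 2) * α ^ 2) * (D * V) := by
      refine mul_le_mul_of_nonneg_left (le_trans ?_ hDV) (by positivity)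
      have : X * u ≤ ((1 + T - κ) * (1 - T + 2 * b - κ)) * u := by gcongr; linarith
      linarith

/-- hypotheses of the one step lemma -/
structure StepHyp (c ε α : ℝ) (U : Euc d → ℝ) (DU : Euc d → Euc d →L[ℝ] ℝ)
    (A : Euc d → Euc d) (DA : Euc d → Euc d →L[ℝ] Euc d) (B : Euc d → ℝ) : Prop where
  hU : ∀ x, HasFDerivAt U (DU x) x
  hA : ∀ x, HasFDerivAt A (DA x) x
  hUε : ∀ x, ε ≤ U x
  hDU : ∀ x, ‖DU x‖ ≤ c
  hU2 : ∀ x y, U x + DU x (y - x) - c * ‖y - x‖ ^ 2 ≤ U y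
  hAα : ∀ x, ‖A x‖ ≤ c * α
  hDA : ∀ x, ‖DA x‖ ≤ c * α
  hBα : ∀ x, |B x| ≤ c * α
  hDAL : ∀ x y, ‖DA x - DA y‖ ≤ c * α * ‖x - y‖
  hBL : ∀ x y, |B x - B y| ≤ c * α * ‖x - y‖
  hBc : Continuous B

theorem step_lemma (n : ℕ) (c ε : ℝ) (hc : 0 < c) (hε : 0 < ε) :
    ∃ C α0 : ℝ, 0 ≤ C ∧ 0 < α0 ∧ ∀ α, 0 ≤ α → α ≤ α0 →
    ∀ (U : Euc n → ℝ) DU A DA B, StepHyp c ε α U DU A DA B →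
    (∀ x, |B x / U x| ≤ 1 / 2) ∧ 
    ∀ ψ : Euc n → ℝ≥0∞, 
      ∫⁻ x, ψ (x + (U x)⁻¹ • A x) * ENNReal.ofReal ((1 + B x / U x) ^ 2 * U x) ≤
        ENNReal.ofReal (1 + C * α ^ 2) * ∫⁻ x, ψ x * ENNReal.ofReal
          (U x - LinearMap.trace ℝ _ (DA x : Euc n →ₗ[ℝ] Euc n) + 2 * B x) := by
  obtain ⟨Ct, hCt, htr⟩ := trace_bound n
  obtain ⟨Cd, hCd, hdet⟩ := det_bound n
  set c1 := c / ε with hc1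
  have hc1p : 0 < c1 := by positivity
  set c2 := c1 + c1 ^ 2 with hc2
  have hc2p : 0 < c2 := by positivity
  set C3 := (c * c1 ^ 2 + Ct * c * c1 + 2 * c * c1) / ε with hC3
  set K := max (max (Ct * c2) c1) (max C3 (Cd * c2 ^ 2)) with hK
  have hK1 : Ct * c2 ≤ K := le_trans (le_max_left _ _) (le_max_left _ _)
  have hK2 : c1 ≤ K := le_trans (le_max_right _ _) (le_max_left _ _)
  have hK3 : C3 ≤ K := le_trans (le_max_left _ _) (le_max_right _ _)
  have hK4 : Cd * c2 ^ 2 ≤ K := le_trans (le_max_right _ _) (le_max_right _ _)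
  have hK0 : 0 ≤ K := hc1p.le.trans hK2
  obtain ⟨C, α0, hC, hα0, hnum⟩ := num_step K hK0
  refine ⟨C, min α0 (1 / (2 * c2)), hC, by positivity, ?_⟩
  intro α hα hαle U DU A DA B H
  have hα1 : α ≤ α0 := hαle.trans (min_le_left _ _)
  have hα2 : c2 * α ≤ 1 / 2 := by
    have := hαle.trans (min_le_right _ _)
    rw [le_div_iff₀ (by positivity)] at this
    linarith
  have hα3 : c1 * α ≤ 1 / 2 := by
    refine le_trans ?_ hα2
    gcongr
    nlinarith
  have hUp : ∀ x, 0 < U x := fun x => hε.trans_le (H.hUε x)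
  have hUinv : ∀ x, (U x)⁻¹ ≤ ε⁻¹ := fun x => by
    have := H.hUε x
    gcongr
  have hb : ∀ x, |B x / U x| ≤ c1 * α := fun x => by
    rw [abs_div, abs_of_pos (hUp x), div_eq_mul_inv]
    calc |B x| * (U x)⁻¹ ≤ (c * α) * ε⁻¹ := mul_le_mul (H.hBα x) (hUinv x) (inv_nonneg.2 (hUp x).le) (by positivity)
      _ = c1 * α := by rw [hc1]; ring
  refine ⟨fun x => (hb x).trans hα3, fun ψ => ?_⟩
  set a : Euc n → Euc n := fun x => (U x)⁻¹ • A x with ha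
  have hab : ∀ x, ‖a x‖ ≤ c1 * α := fun x => by
    simp only [ha]
    rw [norm_smul, norm_inv, Real.norm_eq_abs, abs_of_pos (hUp x)]
    calc (U x)⁻¹ * ‖A x‖ ≤ ε⁻¹ * (c * α) := mul_le_mul (hUinv x) (H.hAα x) (norm_nonneg _) (by positivity)
      _ = c1 * α := by rw [hc1]; ring
  set Da : Euc n → Euc n →L[ℝ] Euc n := fun x => (U x)⁻¹ • DA x +
    (-((U x)⁻¹ • DU x)).smulRight (a x) with hDa
  have hada : ∀ x, HasFDerivAt a (Da x) x := fun x => by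
    have h1 : HasFDerivAt (fun y => (U y)⁻¹) (-((U x ^ 2)⁻¹ • DU x)) x := by
      have := (hasDerivAt_inv (hUp x).ne').comp_hasFDerivAt x (H.hU x)
      exact this.congr_fderiv (by simp)
    have h2 := h1.smul (H.hA x)
    refine h2.congr_fderiv ?_
    ext y i
    simp [hDa, ha]
    ring
  have hDan : ∀ x, ‖Da x‖ ≤ c2 * α := fun x => by
    simp only [hDa]
    refine (norm_add_le _ _).trans ?_
    rw [ContinuousLinearMap.norm_smulRight_apply, norm_neg, norm_smul, norm_smul, norm_inv, Real.norm_eq_abs, abs_of_pos (hUp x)]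
    have h1 : (U x)⁻¹ * ‖DA x‖ ≤ ε⁻¹ * (c * α) := mul_le_mul (hUinv x) (H.hDA x) (norm_nonneg _) (by positivity)
    have h2 : (U x)⁻¹ * ‖DU x‖ ≤ ε⁻¹ * c := mul_le_mul (hUinv x) (H.hDU x) (norm_nonneg _) (by positivity)
    have h3 : (U x)⁻¹ * ‖DU x‖ * ‖a x‖ ≤ ε⁻¹ * c * (c1 * α) := mul_le_mul h2 (hab x) (norm_nonneg _) (by positivity)
    refine (add_le_add h1 h3).trans (le_of_eq ?_)
    rw [hc2, hc1]; ring
  set F : Euc n → Euc n := fun x => x + a x with hF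
  have hFd : ∀ x, HasFDerivAt F (ContinuousLinearMap.id ℝ (Euc n) + Da x) x := fun x =>
    (hasFDerivAt_id x).add (hada x)
  have hinj : Function.Injective F := by
    intro x y hxy
    have hl : ‖a y - a x‖ ≤ 1 / 2 * ‖y - x‖ :=
      convex_univ.norm_image_sub_le_of_norm_hasFDerivWithin_le (f := a) (f' := Da)
        (fun z _ => (hada z).hasFDerivWithinAt) (fun z _ => (hDan z).trans hα2) (mem_univ x) (mem_univ y)
    have : y - x = -(a y - a x) := by
      simp only [hF] at hxy
      have := sub_eq_zero.2 hxy
      rw [← sub_eq_zero, ← neg_eq_zero, ← this]; abel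
    have h4 : ‖y - x‖ = ‖a y - a x‖ := by rw [this, norm_neg, ]
    have : ‖y - x‖ = 0 := by linarith [norm_nonneg (y - x)]
    exact (sub_eq_zero.1 (norm_eq_zero.1 this)).symm
  set U' : Euc n → ℝ := fun x => U x - LinearMap.trace ℝ _ (DA x : Euc n →ₗ[ℝ] Euc n) + 2 * B x with hU'
  have hcov := lintegral_image_eq_lintegral_abs_det_fderiv_mul (volume : Measure (Euc n)) MeasurableSet.univ
    (fun x _ => (hFd x).hasFDerivWithinAt) hinj.injOn (fun x => ψ x * ENNReal.ofReal (U' x))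
  have hpt : ∀ x, 0 ≤ U' (F x) ∧ (1 + B x / U x) ^ 2 * U x ≤
      (1 + C * α ^ 2) * ((ContinuousLinearMap.id ℝ (Euc n) + Da x).det * U' (F x)) := by
    intro x
    have hαα : 0 ≤ α ^ 2 := by positivity
    refine hnum α hα hα1 (U x) (LinearMap.trace ℝ _ (Da x : Euc n →ₗ[ℝ] Euc n)) (B x / U x) _ _ (hUp x) ?_ ?_ ?_ ?_
    · calc _ ≤ Ct * ‖Da x‖ := htr _
        _ ≤ Ct * (c2 * α) := by gcongr; exact hDan x
        _ = Ct * c2 * α := by ring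
        _ ≤ K * α := by gcongr
    · exact (hb x).trans (by gcongr)
    · have e1 : LinearMap.trace ℝ _ (Da x : Euc n →ₗ[ℝ] Euc n) = (U x)⁻¹ * LinearMap.trace ℝ _ (DA x : Euc n →ₗ[ℝ] Euc n)
          - (U x)⁻¹ * DU x (a x) := by
        simp only [hDa]
        have : (((U x)⁻¹ • DA x + (-((U x)⁻¹ • DU x)).smulRight (a x) : Euc n →L[ℝ] Euc n) : Euc n →ₗ[ℝ] Euc n)
           = (U x)⁻¹ • (DA x : Euc n →ₗ[ℝ] Euc n) + ((-((U x)⁻¹ • DU x) : Euc n →L[ℝ] ℝ) : Euc n →ₗ[ℝ] ℝ).smulRight (a x) := by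
          ext; simp
        rw [this, map_add, map_smul, LinearMap.trace_smulRight]
        simp
        ring
      have hUx := (hUp x).ne'
      have e2 : U x * (1 - LinearMap.trace ℝ _ (Da x : Euc n →ₗ[ℝ] Euc n) + 2 * (B x / U x) - K * α ^ 2) =
          U x - LinearMap.trace ℝ _ (DA x : Euc n →ₗ[ℝ] Euc n) + DU x (a x) + 2 * B x - U x * (K * α ^ 2) := by
        rw [e1]; field_simp; ring
      rw [e2]
      have h1 := H.hU2 x (F x)
      have h2 := H.hBL (F x) x
      have h3 := H.hDAL (F x) x
      have e3 : F x - x = a x := by simp [hF]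
      rw [e3] at h1 h2 h3
      have h4 : |LinearMap.trace ℝ _ (DA (F x) : Euc n →ₗ[ℝ] Euc n) - LinearMap.trace ℝ _ (DA x : Euc n →ₗ[ℝ] Euc n)| ≤ Ct * (c * α * ‖a x‖) := by
        rw [← map_sub]
        exact (htr (DA (F x) - DA x)).trans (by gcongr)
      have h5 : c * ‖a x‖ ^ 2 ≤ c * (c1 * α) ^ 2 := by gcongr; exact hab x
      have h6 : c * α * ‖a x‖ ≤ c * α * (c1 * α) := by gcongr; exact hab x
      have h7 : Ct * (c * α * ‖a x‖) ≤ Ct * (c * α * (c1 * α)) := by gcongr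
      have h8 : ε * (C3 * α ^ 2) ≤ U x * (K * α ^ 2) := by
        have := H.hUε x
        have : 0 ≤ C3 := by positivity
        have := (hUp x).le
        gcongr
      have e4 : ε * (C3 * α ^ 2) = c * (c1 * α) ^ 2 + Ct * (c * α * (c1 * α)) + 2 * (c * α * (c1 * α)) := by
        rw [hC3]; field_simp
      have h9 := (abs_le.1 h2).1
      have h10 := (abs_le.1 h4).2
      simp only [hU']
      linarith
    · refine le_trans ?_ (hdet (Da x) ((hDan x).trans (by linarith)))
      have : Cd * ‖Da x‖ ^ 2 ≤ K * α ^ 2 := by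
        calc Cd * ‖Da x‖ ^ 2 ≤ Cd * (c2 * α) ^ 2 := by gcongr; exact hDan x
          _ = Cd * c2 ^ 2 * α ^ 2 := by ring
          _ ≤ _ := by gcongr
      linarith
  calc ∫⁻ x, ψ (F x) * ENNReal.ofReal ((1 + B x / U x) ^ 2 * U x)
      ≤ ∫⁻ x, ENNReal.ofReal (1 + C * α ^ 2) * (ENNReal.ofReal |(ContinuousLinearMap.id ℝ (Euc n) + Da x).det| *
          (ψ (F x) * ENNReal.ofReal (U' (F x)))) := by
        refine lintegral_mono fun x => ?_
        obtain ⟨h1, h2⟩ := hpt x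
        have h3 : (1 + B x / U x) ^ 2 * U x ≤ (1 + C * α ^ 2) * (|(ContinuousLinearMap.id ℝ (Euc n) + Da x).det| * U' (F x)) := by
          refine h2.trans ?_
          gcongr
          exact le_abs_self _
        calc ψ (F x) * ENNReal.ofReal ((1 + B x / U x) ^ 2 * U x)
            ≤ ψ (F x) * ENNReal.ofReal ((1 + C * α ^ 2) * (|(ContinuousLinearMap.id ℝ (Euc n) + Da x).det| * U' (F x))) := by gcongr
          _ = _ := by
            rw [ENNReal.ofReal_mul (by positivity), ENNReal.ofReal_mul (abs_nonneg _)]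
            ring
    _ = ENNReal.ofReal (1 + C * α ^ 2) * ∫⁻ x, (ENNReal.ofReal |(ContinuousLinearMap.id ℝ (Euc n) + Da x).det| *
          (ψ (F x) * ENNReal.ofReal (U' (F x)))) := by
        rw [lintegral_const_mul' _ _ ENNReal.ofReal_ne_top]
    _ ≤ ENNReal.ofReal (1 + C * α ^ 2) * ∫⁻ x, ψ x * ENNReal.ofReal (U' x) := by
        refine mul_le_mul_right ?_ _
        rw [setLIntegral_univ] at hcov
        rw [← hcov]
        exact setLIntegral_le_lintegral _ _
end

section
theorem primitive_smooth (η : ℝ → ℝ) (h : ContDiff ℝ (⊤ : ℕ∞) η) :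
    ContDiff ℝ (⊤ : ℕ∞) (fun t => ∫ s in (0:ℝ)..t, η s) ∧
    ∀ t, HasDerivAt (fun t => ∫ s in (0:ℝ)..t, η s) (η t) t := by
  have hd : ∀ t, HasDerivAt (fun t => ∫ s in (0:ℝ)..t, η s) (η t) t := fun t =>
    intervalIntegral.integral_hasDerivAt_right (h.continuous.intervalIntegrable _ _)
      (h.continuous.stronglyMeasurableAtFilter _ _) h.continuous.continuousAt
  refine ⟨?_, hd⟩
  rw [contDiff_infty_iff_deriv]
  refine ⟨fun t => (hd t).differentiableAt, ?_⟩
  have : deriv (fun t => ∫ s in (0:ℝ)..t, η s) = η := funext fun t => (hd t).deriv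
  rw [this]; exact h

theorem dbr (F G : ℝ → ℝ) (hF : ContinuousOn F (Icc 0 1)) (hG : IntegrableOn G (Icc 0 1))
    (h : ∀ χ : ℝ → ℝ, ContDiff ℝ (⊤ : ℕ∞) χ → HasCompactSupport χ → tsupport χ ⊆ Ioo 0 1 →
      ∫ t in Ioo (0:ℝ) 1, (deriv χ t * F t + χ t * G t) = 0) :
    ∀ s t, 0 ≤ s → s ≤ t → t ≤ 1 → F t - F s = ∫ τ in s..t, G τ := by
  have hGi : IntervalIntegrable G volume 0 1 :=
    (intervalIntegrable_iff_integrableOn_Icc_of_le zero_le_one).2 hG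
  set I : ℝ → ℝ := fun t => ∫ s in (0:ℝ)..t, G s with hI
  have hIac : AbsolutelyContinuousOnInterval I 0 1 :=
    hGi.absolutelyContinuousOnInterval_intervalIntegral (by simp)
  have hIc : ContinuousOn I (Icc 0 1) := by simpa using hIac.continuousOn
  set H : ℝ → ℝ := fun t => F t - I t with hH
  have hHc : ContinuousOn H (Icc 0 1) := hF.sub hIc
  have key0 : ∀ η : ℝ → ℝ, ContDiff ℝ (⊤ : ℕ∞) η → HasCompactSupport η → tsupport η ⊆ Ioo 0 1 →
      ∫ t in (0:ℝ)..1, η t = 0 → ∫ t in (0:ℝ)..1, η t * H t = 0 := by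
    intro η hη hηc hηs hη0
    obtain ⟨hχ, hχd⟩ := primitive_smooth η hη
    set χ := fun t => ∫ s in (0:ℝ)..t, η s with hχdef
    have hχder : deriv χ = η := funext fun t => (hχd t).deriv
    -- supports
    obtain ⟨a, b, ha, hb, hab⟩ : ∃ a b : ℝ, 0 < a ∧ b < 1 ∧ tsupport η ⊆ Icc a b := by
      rcases (tsupport η).eq_empty_or_nonempty with he | hne
      · exact ⟨1/2, 1/2, by norm_num, by norm_num, by rw [he]; simp⟩
      · refine ⟨sInf (tsupport η), sSup (tsupport η), ?_, ?_, ?_⟩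
        · exact (hηs (hηc.isCompact.sInf_mem hne)).1
        · exact (hηs (hηc.isCompact.sSup_mem hne)).2
        · exact fun x hx => ⟨csInf_le hηc.isCompact.bddBelow hx, le_csSup hηc.isCompact.bddAbove hx⟩
    have hz : ∀ t, t ∉ Icc a b → η t = 0 := fun t ht => by
      by_contra hne
      exact ht (hab (subset_tsupport _ hne))
    have hχz : ∀ t, t ∉ Icc a b → χ t = 0 := fun t ht => by
      by_cases hta : t < a
      · simp only [hχdef]
        rw [intervalIntegral.integral_congr (g := fun _ => (0:ℝ))]
        · simp
        · intro s hs
          refine hz s fun hs' => ?_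
          rcases le_total 0 t with h0 | h0
          · rw [uIcc_of_le h0] at hs; linarith [hs.2, hs'.1]
          · rw [uIcc_of_ge h0] at hs; linarith [hs.2, hs'.1]
      · have htb : b < t := by
          by_contra hh
          exact ht ⟨not_lt.1 hta, not_lt.1 hh⟩
        have : χ t = (∫ s in (0:ℝ)..1, η s) + ∫ s in (1:ℝ)..t, η s := by
          rw [intervalIntegral.integral_add_adjacent_intervals] <;>
          exact hη.continuous.intervalIntegrable _ _
        rw [this, hη0, zero_add, intervalIntegral.integral_congr (g := fun _ => (0:ℝ))]
        · simp
        · intro s hs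
          refine hz s fun hs' => ?_
          rcases le_total 1 t with h0 | h0
          · rw [uIcc_of_le h0] at hs; linarith [hs.1, hs'.2]
          · rw [uIcc_of_ge h0] at hs; linarith [hs.1, hs'.2]
    have hsub : tsupport χ ⊆ Icc a b := by
      refine closure_minimal (fun t ht => ?_) isClosed_Icc
      by_contra hh
      exact ht (hχz t hh)
    have hcs : HasCompactSupport χ := HasCompactSupport.of_support_subset_isCompact isCompact_Icc
      ((subset_tsupport _).trans hsub)
    have h1 := h χ hχ hcs (hsub.trans (Icc_subset_Ioo ha hb))
    rw [hχder, ← integral_Ioc_eq_integral_Ioo, ← intervalIntegral.integral_of_le zero_le_one] at h1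
    have hηF : IntervalIntegrable (fun t => η t * F t) volume 0 1 :=
      ContinuousOn.intervalIntegrable (by
        rw [uIcc_of_le zero_le_one]; exact hη.continuous.continuousOn.mul hF)
    have hηI : IntervalIntegrable (fun t => η t * I t) volume 0 1 :=
      ContinuousOn.intervalIntegrable (by
        rw [uIcc_of_le zero_le_one]; exact hη.continuous.continuousOn.mul hIc)
    have hχG : IntervalIntegrable (fun t => χ t * G t) volume 0 1 :=
      hGi.continuousOn_mul hχ.continuous.continuousOn
    rw [intervalIntegral.integral_add hηF hχG] at h1
    have hχac : AbsolutelyContinuousOnInterval χ 0 1 :=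
      ContDiffOn.absolutelyContinuousOnInterval (hχ.contDiffOn.of_le (by norm_cast))
    have h2 := hχac.integral_mul_deriv_eq_deriv_mul hIac
    rw [hχz 1 (fun h => by linarith [h.2]), hχz 0 (fun h => by linarith [h.1]), hχder] at h2
    have h3 : ∫ x in (0:ℝ)..1, χ x * deriv I x = ∫ x in (0:ℝ)..1, χ x * G x := by
      apply intervalIntegral.integral_congr_ae
      filter_upwards [hGi.ae_hasDerivAt_integral] with x hx hx'
      rw [(hx (uIoc_subset_uIcc hx') 0 (by simp)).deriv]
    rw [h3] at h2
    simp only [hH, mul_sub]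
    rw [intervalIntegral.integral_sub hηF hηI]
    linarith
  -- a fixed bump
  obtain ⟨η0, hη0, hη0c, hη0s, hη01⟩ : ∃ η0 : ℝ → ℝ, ContDiff ℝ (⊤ : ℕ∞) η0 ∧ HasCompactSupport η0 ∧
      tsupport η0 ⊆ Ioo 0 1 ∧ ∫ t in (0:ℝ)..1, η0 t = 1 := by
    let f : ContDiffBump (1/2 : ℝ) := ⟨1/8, 1/4, by norm_num, by norm_num⟩
    have hts : tsupport (f.normed volume) ⊆ Ioo 0 1 := by
      rw [f.tsupport_normed_eq]
      intro x hx
      rw [Metric.mem_closedBall, Real.dist_eq] at hx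
      have := abs_le.1 hx
      constructor <;> simp only [f] at this <;> linarith [this.1, this.2]
    refine ⟨f.normed volume, f.contDiff_normed, f.hasCompactSupport_normed, hts, ?_⟩
    rw [intervalIntegral.integral_of_le zero_le_one]
    refine Eq.trans ?_ (f.integral_normed (μ := volume))
    refine setIntegral_eq_integral_of_forall_compl_eq_zero fun x hx => ?_
    by_contra hne
    exact hx (Ioo_subset_Ioc_self (hts (subset_tsupport _ hne)))
  set c := ∫ t in (0:ℝ)..1, η0 t * H t with hc
  have hcont : ∀ η : ℝ → ℝ, ContDiff ℝ (⊤ : ℕ∞) η → IntervalIntegrable (fun t => η t * H t) volume 0 1 :=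
    fun η hη => ContinuousOn.intervalIntegrable (by
        rw [uIcc_of_le zero_le_one]; exact hη.continuous.continuousOn.mul hHc)
  have key : ∀ η : ℝ → ℝ, ContDiff ℝ (⊤ : ℕ∞) η → HasCompactSupport η → tsupport η ⊆ Ioo 0 1 →
      ∫ t, η t • (H t - c) = 0 := by
    intro η hη hηc hηs
    have h1 := key0 (fun t => η t - (∫ t in (0:ℝ)..1, η t) * η0 t) (hη.sub (contDiff_const.mul hη0))
      (hηc.sub (hη0c.mul_left)) ?_ ?_
    · have e : ∀ t, (η t - (∫ t in (0:ℝ)..1, η t) * η0 t) * H t = η t * H t - (∫ t in (0:ℝ)..1, η t) * (η0 t * H t) := fun t => by ring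
      simp only [e] at h1
      rw [intervalIntegral.integral_sub (hcont _ hη) ((hcont _ hη0).const_mul _), intervalIntegral.integral_const_mul] at h1
      have h2 : ∫ t, η t • (H t - c) = ∫ t in (0:ℝ)..1, η t • (H t - c) := by
        rw [intervalIntegral.integral_of_le zero_le_one]
        refine (setIntegral_eq_integral_of_forall_compl_eq_zero fun x hx => ?_).symm
        have : η x = 0 := by
          by_contra hne
          exact hx (Ioo_subset_Ioc_self (hηs (subset_tsupport _ hne)))
        simp [this]
      rw [h2]
      simp only [smul_eq_mul, mul_sub]
      rw [intervalIntegral.integral_sub (hcont _ hη) ((hη.continuous.intervalIntegrable _ _).mul_const _), intervalIntegral.integral_mul_const]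
      linarith
    · refine (tsupport_sub _ _).trans (union_subset hηs ?_)
      exact (tsupport_mul_subset_right).trans hη0s
    · rw [intervalIntegral.integral_sub (hη.continuous.intervalIntegrable _ _) ((hη0.continuous.intervalIntegrable _ _).const_mul _),
        intervalIntegral.integral_const_mul, hη01]
      simp
  have hae := isOpen_Ioo.ae_eq_zero_of_integral_contDiff_smul_eq_zero (U := Ioo (0:ℝ) 1) (μ := volume)
    (f := fun t => H t - c) (((hHc.sub continuousOn_const).integrableOn_Icc).mono_set Ioo_subset_Icc_self).locallyIntegrableOn key
  have hconst : ∀ t ∈ Icc (0:ℝ) 1, H t = c := by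
    have h1 : ∀ᵐ t ∂(volume.restrict (Ioo (0:ℝ) 1)), H t = c := by
      rw [ae_restrict_iff' measurableSet_Ioo]
      filter_upwards [hae] with t ht ht'
      linarith [ht ht']
    have h2 : EqOn H (fun _ => c) (Ioo 0 1) :=
      Measure.eqOn_open_of_ae_eq h1 isOpen_Ioo (hHc.mono Ioo_subset_Icc_self) continuousOn_const
    have h3 : EqOn H (fun _ => c) (closure (Ioo 0 1)) := by
      refine h2.of_subset_closure ?_ continuousOn_const subset_closure le_rfl
      rw [closure_Ioo (by norm_num)]; exact hHc
    rw [closure_Ioo (by norm_num)] at h3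
    exact h3
  intro s t hs hst ht
  have e1 := hconst s ⟨hs, hst.trans ht⟩
  have e2 := hconst t ⟨hs.trans hst, ht⟩
  have e3 : I s + ∫ τ in s..t, G τ = I t := by
    simp only [hI]
    apply intervalIntegral.integral_add_adjacent_intervals
    · exact hGi.mono_set (by rw [uIcc_of_le hs, uIcc_of_le zero_le_one]; exact Icc_subset_Icc le_rfl (hst.trans ht))
    · exact hGi.mono_set (by rw [uIcc_of_le hst, uIcc_of_le zero_le_one]; exact Icc_subset_Icc hs ht)
  simp only [hH] at e1 e2
  linarith
end

section
open ProbabilityTheory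

theorem measurable_of_narrow (κ : ℝ → Measure (Euc d)) (hf : ∀ t, IsFiniteMeasure (κ t))
    (hc : ∀ φ : Euc d → ℝ, Continuous φ → Continuous fun t => ∫ x, φ x ∂(κ t)) :
    Measurable κ := by
  have hcl : ∀ s : Set (Euc d), IsClosed s → Measurable fun t => κ t s := by
    intro s hs
    have hpos : ∀ n : ℕ, (0:ℝ) < 1 / ((n:ℝ) + 1) := fun n => by positivity
    refine measurable_of_tendsto_metrizable (f := fun (n : ℕ) t => ∫⁻ x, (thickenedIndicator (hpos n) s x : ℝ≥0∞) ∂(κ t)) ?_ ?_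
    · intro n
      have h1 : Continuous fun x => (thickenedIndicator (hpos n) s x : ℝ) :=
        NNReal.continuous_coe.comp (thickenedIndicator (hpos n) s).continuous
      have h2 : (fun t => ∫⁻ x, (thickenedIndicator (hpos n) s x : ℝ≥0∞) ∂(κ t)) =
          fun t => ENNReal.ofReal (∫ x, (thickenedIndicator (hpos n) s x : ℝ) ∂(κ t)) := by
        funext t
        rw [ofReal_integral_eq_lintegral_ofReal]
        · simp
        · exact integrable_thickenedIndicator s _
        · exact Eventually.of_forall fun x => NNReal.coe_nonneg _
      rw [h2]
      exact (hc _ h1).measurable.ennreal_ofReal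
    · rw [tendsto_pi_nhds]
      intro t
      exact tendsto_lintegral_thickenedIndicator_of_isClosed (κ t) hs hpos tendsto_one_div_add_atTop_nhds_zero_nat
  refine Measurable.measure_of_isPiSystem (S := {s | IsClosed s}) ?_ isPiSystem_isClosed (fun s hs => hcl s hs) (hcl _ isClosed_univ)
  rw [BorelSpace.measurable_eq (α := Euc d), borel_eq_generateFrom_isClosed]

/-- `dt ⊗ κ_t` on `(0,1] × ℝ^d` -/
def PP (κ : Kernel ℝ (Euc d)) : Measure (XX d) := (volume.restrict (Ioc (0:ℝ) 1)) ⊗ₘ κ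

structure CED (v : XX d → Euc d) (g : XX d → ℝ) (κ : Kernel ℝ (Euc d)) (R M : ℝ) : Prop where
  mv : Measurable v
  mg : Measurable g
  hR : 0 < R
  hM : 0 < M
  supp : ∀ t, κ t (Metric.ball 0 R)ᶜ = 0
  mass : ∀ t, κ t univ ≤ ENNReal.ofReal M
  cont : ∀ φ : Euc d → ℝ, Continuous φ → Continuous fun t => ∫ x, φ x ∂(κ t)
  ev : MemLp v 2 (PP κ)
  eg : MemLp g 2 (PP κ)
  ce : ∀ φ : Euc d → ℝ, ContDiff ℝ (⊤ : ℕ∞) φ → HasCompactSupport φ → ∀ s t, 0 ≤ s → s ≤ t → t ≤ 1 →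
    ∫ x, φ x ∂(κ t) - ∫ x, φ x ∂(κ s) =
      ∫ p in Ioc s t ×ˢ univ, (fderiv ℝ φ p.2 (v p) + φ p.2 * g p) ∂(PP κ)

theorem CED.fin {v : XX d → Euc d} {g : XX d → ℝ} {κ : Kernel ℝ (Euc d)} {R M : ℝ} (H : CED v g κ R M) :
    IsFiniteKernel κ := ⟨⟨ENNReal.ofReal M, ENNReal.ofReal_lt_top, H.mass⟩⟩

theorem clamp_mem (t : ℝ) : clamp t ∈ Icc (0:ℝ) 1 := by
  unfold clamp
  exact ⟨le_max_left _ _, max_le zero_le_one (min_le_left _ _)⟩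

theorem clamp_eq {t : ℝ} (ht : t ∈ Icc (0:ℝ) 1) : clamp t = t := by
  unfold clamp
  rw [min_eq_right ht.2, max_eq_right ht.1]

theorem continuous_clamp : Continuous clamp := by
  unfold clamp; fun_prop

theorem integrable_fderiv_term {P : Measure (XX d)} [IsFiniteMeasure P] {v : XX d → Euc d} {g : XX d → ℝ}
    (mv : Measurable v) (mg : Measurable g) (hv : Integrable v P) (hg : Integrable g P)
    (φ : Euc d → ℝ) (hφ : ContDiff ℝ (⊤ : ℕ∞) φ) (hc : HasCompactSupport φ) :
    Integrable (fun p : XX d => fderiv ℝ φ p.2 (v p)) P ∧ Integrable (fun p : XX d => φ p.2 * g p) P ∧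
    Measurable (fun p : XX d => fderiv ℝ φ p.2 (v p)) := by
  have hdc : Continuous (fderiv ℝ φ) := hφ.continuous_fderiv (by simp)
  have hm1 : Measurable (fun p : XX d => fderiv ℝ φ p.2 (v p)) := by
    have h1 : Continuous (fun q : (Euc d →L[ℝ] ℝ) × Euc d => q.1 q.2) := by fun_prop
    exact h1.measurable.comp ((hdc.measurable.comp measurable_snd).prodMk mv)
  obtain ⟨K, hK⟩ := hdc.bounded_above_of_compact_support (hc.fderiv ℝ)
  obtain ⟨K', hK'⟩ := hφ.continuous.bounded_above_of_compact_support hc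
  refine ⟨?_, ?_, hm1⟩
  · refine Integrable.mono' (hv.norm.const_mul K) hm1.aestronglyMeasurable (Eventually.of_forall fun p => ?_)
    refine ((fderiv ℝ φ p.2).le_opNorm (v p)).trans ?_
    gcongr
    exact hK _
  · refine Integrable.mono' (hg.norm.const_mul K') ((hφ.continuous.measurable.comp measurable_snd).mul mg).aestronglyMeasurable (Eventually.of_forall fun p => ?_)
    rw [norm_mul]
    gcongr
    exact hK' _

theorem exists_CED {Ω : Set (Euc d)} (hΩ : IsClosureOfBoundedConvexDomain Ω)
    {v : XX d → Euc d} {g : XX d → ℝ} (hv : Measurable v) (hg : Measurable g)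
    {ρ : ℝ → Measure (Euc d)} (hρ : Dvg Ω v g ρ) :
    ∃ (κ : Kernel ℝ (Euc d)) (R M : ℝ), CED v g κ R M ∧ (∀ t ∈ Icc (0:ℝ) 1, κ t = ρ t) ∧ Ω ⊆ Metric.ball 0 R := by
  obtain ⟨⟨hn1, hn2⟩, hce, hen⟩ := hρ
  obtain ⟨R, hR, hΩR⟩ : ∃ R : ℝ, 0 < R ∧ Ω ⊆ Metric.ball 0 R := by
    obtain ⟨U, -, -, -, hb, rfl⟩ := hΩ
    exact hb.closure.subset_ball_lt 0 0
  have hfin : ∀ t, IsFiniteMeasure (ρ (clamp t)) := fun t => ⟨lt_top_iff_ne_top.2 (hn1 _ (clamp_mem t)).2⟩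
  have hcont : ∀ φ : Euc d → ℝ, Continuous φ → Continuous fun t => ∫ x, φ x ∂(ρ (clamp t)) := fun φ hφ =>
    (hn2 φ hφ).comp_continuous continuous_clamp clamp_mem
  let κ : Kernel ℝ (Euc d) := ⟨fun t => ρ (clamp t), measurable_of_narrow _ hfin hcont⟩
  have hκ : ∀ t, κ t = ρ (clamp t) := fun t => rfl
  have hκI : ∀ t ∈ Icc (0:ℝ) 1, κ t = ρ t := fun t ht => by rw [hκ, clamp_eq ht]
  obtain ⟨M0, hM0⟩ : ∃ M0 : ℝ, ∀ t ∈ Icc (0:ℝ) 1, (ρ t).real univ ≤ M0 := by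
    have h1 := hn2 (fun _ => 1) continuous_const
    obtain ⟨M0, h⟩ := (isCompact_Icc.image_of_continuousOn h1).bddAbove
    refine ⟨M0, fun t ht => ?_⟩
    have := h ⟨t, ht, rfl⟩
    simpa using this
  have hmass : ∀ t, κ t univ ≤ ENNReal.ofReal (max M0 1) := fun t => by
    have := hM0 _ (clamp_mem t)
    rw [hκ]
    rw [← ENNReal.ofReal_toReal (hn1 _ (clamp_mem t)).2]
    exact ENNReal.ofReal_le_ofReal (this.trans (le_max_left _ _))
  haveI : IsFiniteKernel κ := ⟨⟨ENNReal.ofReal (max M0 1), ENNReal.ofReal_lt_top, hmass⟩⟩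
  haveI hPf : IsFiniteMeasure (PP κ) := by unfold PP; infer_instance
  have hen2 : ∫⁻ p, ENNReal.ofReal (‖v p‖ ^ 2 + g p ^ 2) ∂(PP κ) < ⊤ := by
    unfold PP
    rw [Measure.lintegral_compProd (by fun_prop)]
    rw [restrict_Ioo_eq_restrict_Ioc.symm]
    refine lt_of_le_of_lt (le_of_eq ?_) hen
    unfold EnergyVG
    refine setLIntegral_congr_fun measurableSet_Ioo fun t ht => ?_
    show ∫⁻ x, ENNReal.ofReal (‖v (t, x)‖ ^ 2 + g (t, x) ^ 2) ∂(κ t) = _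
    rw [hκI t (Ioo_subset_Icc_self ht)]
  have hev : MemLp v 2 (PP κ) := by
    refine ⟨hv.aestronglyMeasurable, ?_⟩
    rw [eLpNorm_lt_top_iff_lintegral_rpow_enorm_lt_top (by norm_num) (by norm_num)]
    refine lt_of_le_of_lt (lintegral_mono fun p => ?_) hen2
    rw [← ofReal_norm_eq_enorm, ENNReal.ofReal_rpow_of_nonneg (norm_nonneg _) (by simp)]
    apply ENNReal.ofReal_le_ofReal
    simp
    positivity
  have heg : MemLp g 2 (PP κ) := by
    refine ⟨hg.aestronglyMeasurable, ?_⟩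
    rw [eLpNorm_lt_top_iff_lintegral_rpow_enorm_lt_top (by norm_num) (by norm_num)]
    refine lt_of_le_of_lt (lintegral_mono fun p => ?_) hen2
    rw [← ofReal_norm_eq_enorm, ENNReal.ofReal_rpow_of_nonneg (norm_nonneg _) (by simp)]
    apply ENNReal.ofReal_le_ofReal
    simp
  refine ⟨κ, R, max M0 1, ⟨hv, hg, hR, by positivity, ?_, hmass, hcont, hev, heg, ?_⟩, hκI, hΩR⟩
  · intro t
    refine measure_mono_null (compl_subset_compl.2 hΩR) ?_
    exact (hn1 _ (clamp_mem t)).1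
  · intro φ hφ hφc
    obtain ⟨i1, i2, m1⟩ := integrable_fderiv_term hv hg (hev.integrable (by norm_num)) (heg.integrable (by norm_num)) φ hφ hφc
    have i3 := i1.add i2
    set F : ℝ → ℝ := fun t => ∫ x, φ x ∂(κ t) with hF
    set G : ℝ → ℝ := fun t => ∫ x, (fderiv ℝ φ x (v (t, x)) + φ x * g (t, x)) ∂(κ t) with hG
    have hGi : IntegrableOn G (Ioc 0 1) := by
      have i4 : Integrable (fun p : XX d => fderiv ℝ φ p.2 (v p) + φ p.2 * g p) ((volume.restrict (Ioc (0:ℝ) 1)) ⊗ₘ κ) := i3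
      have i5 := Integrable.integral_compProd (κ := Kernel.const Unit (volume.restrict (Ioc (0:ℝ) 1))) (η := Kernel.prodMkLeft Unit κ) (a := ()) i4
      exact i5
    have hGi' : IntegrableOn G (Icc 0 1) := by rwa [integrableOn_Icc_iff_integrableOn_Ioc]
    have hae : ∀ᵐ t ∂(volume.restrict (Ioc (0:ℝ) 1)), Integrable (fun x => fderiv ℝ φ x (v (t, x)) + φ x * g (t, x)) (κ t) := by
      have := (Measure.integrable_compProd_iff i3.aestronglyMeasurable).1 i3
      exact this.1
    have hdbr := dbr F G (hcont φ hφ.continuous).continuousOn hGi' ?_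
    · intro s t hs hst ht
      rw [hdbr s t hs hst ht, intervalIntegral.integral_of_le hst]
      unfold PP
      rw [Measure.setIntegral_compProd measurableSet_Ioc MeasurableSet.univ]
      · rw [Measure.restrict_restrict measurableSet_Ioc, inter_eq_left.2 (Ioc_subset_Ioc hs ht)]
        simp [hG]
      · exact i3.integrableOn
    · intro χ hχ hχc hχs
      have htest : IsTest (fun p : XX d => χ p.1 * φ p.2) := by
        refine ⟨(hχ.comp contDiff_fst).mul (hφ.comp contDiff_snd), ?_, ?_⟩
        · refine HasCompactSupport.of_support_subset_isCompact (hχc.isCompact.prod hφc.isCompact) ?_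
          intro p hp
          have hp' : χ p.1 * φ p.2 ≠ 0 := hp
          exact ⟨subset_tsupport _ (left_ne_zero_of_mul hp'), subset_tsupport _ (right_ne_zero_of_mul hp')⟩
        · have : tsupport (fun p : XX d => χ p.1 * φ p.2) ⊆ tsupport χ ×ˢ univ := by
            refine closure_minimal ?_ ((isClosed_tsupport _).prod isClosed_univ)
            intro p hp
            have hp' : χ p.1 * φ p.2 ≠ 0 := hp
            exact ⟨subset_tsupport _ (left_ne_zero_of_mul hp'), mem_univ _⟩
          exact this.trans (prod_mono hχs le_rfl)
      have h0 := hce _ htest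
      refine Eq.trans ?_ h0
      refine setIntegral_congr_ae measurableSet_Ioo ?_
      rw [← restrict_Ioo_eq_restrict_Ioc, ae_restrict_iff' measurableSet_Ioo] at hae
      filter_upwards [hae] with t hintg ht
      have hintg := hintg ht
      rw [hκI t (Ioo_subset_Icc_self ht)] at hintg
      simp only [hF, hG]
      rw [hκI t (Ioo_subset_Icc_self ht)]
      have hder : ∀ x : Euc d, ∀ w : Euc d, fderiv ℝ (fun p : XX d => χ p.1 * φ p.2) (t, x) (1, w) = deriv χ t * φ x + χ t * fderiv ℝ φ x w := by
        intro x w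
        have d1 : HasFDerivAt (fun p : XX d => χ p.1) ((deriv χ t) • ContinuousLinearMap.fst ℝ ℝ (Euc d)) (t, x) := by
          have h1 : HasDerivAt χ (deriv χ t) ((t, x) : XX d).1 := ((hχ.differentiable (by simp)).differentiableAt).hasDerivAt
          exact h1.comp_hasFDerivAt (t, x) hasFDerivAt_fst
        have d2 : HasFDerivAt (fun p : XX d => φ p.2) ((fderiv ℝ φ x).comp (ContinuousLinearMap.snd ℝ ℝ (Euc d))) (t, x) := by
          have h1 : HasFDerivAt φ (fderiv ℝ φ x) ((t, x) : XX d).2 := ((hφ.differentiable (by simp)).differentiableAt).hasFDerivAt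
          exact h1.comp (t, x) hasFDerivAt_snd
        rw [show fderiv ℝ (fun p : XX d => χ p.1 * φ p.2) (t, x) = _ from (d1.mul d2).fderiv]
        simp
        ring
      haveI : IsFiniteMeasure (ρ t) := by rw [← hκI t (Ioo_subset_Icc_self ht)]; infer_instance
      have hφi : Integrable φ (ρ t) := hφ.continuous.integrable_of_hasCompactSupport hφc
      have e : ∀ x, fderiv ℝ (fun p : XX d => χ p.1 * φ p.2) (t, x) (1, v (t, x)) + χ t * φ x * g (t, x)
        = deriv χ t * φ x + χ t * (fderiv ℝ φ x (v (t, x)) + φ x * g (t, x)) := fun x => by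
          rw [hder]; ring
      simp only [e]
      rw [integral_add (hφi.const_mul _) (hintg.const_mul _), integral_const_mul, integral_const_mul]
end

section
open ProbabilityTheory

structure Moll (ξ : Euc d → ℝ) (ε C : ℝ) : Prop where
  cd : ContDiff ℝ (⊤ : ℕ∞) ξ
  cs : HasCompactSupport ξ
  nn : ∀ x, 0 ≤ ξ x
  int : ∫ x, ξ x = 1
  supp : ∀ x, ξ x ≠ 0 → ‖x‖ < ε
  hC : 0 ≤ C
  b0 : ∀ x, |ξ x| ≤ C
  b1 : ∀ x, ‖fderiv ℝ ξ x‖ ≤ C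
  b2 : ∀ x y, ‖fderiv ℝ ξ x - fderiv ℝ ξ y‖ ≤ C * ‖x - y‖

theorem exists_moll (d : ℕ) (ε : ℝ) (hε : 0 < ε) : ∃ (ξ : Euc d → ℝ) (C : ℝ), 0 < C ∧ Moll ξ ε C := by
  let f : ContDiffBump (0 : Euc d) := ⟨ε / 2, ε, by positivity, by linarith⟩
  let ξ : Euc d → ℝ := f.normed volume
  have hcd : ContDiff ℝ (⊤ : ℕ∞) ξ := f.contDiff_normed
  have hcs : HasCompactSupport ξ := f.hasCompactSupport_normed
  obtain ⟨K0, h0⟩ := hcd.continuous.bounded_above_of_compact_support hcs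
  have hd1 : ContDiff ℝ 1 (fderiv ℝ ξ) := hcd.fderiv_right (m := 1) (by norm_cast)
  obtain ⟨K1, h1⟩ := hd1.continuous.bounded_above_of_compact_support (hcs.fderiv ℝ)
  obtain ⟨K2, h2⟩ := (hd1.continuous_fderiv (by simp)).bounded_above_of_compact_support ((hcs.fderiv ℝ).fderiv ℝ)
  refine ⟨ξ, max (max K0 K1) (max K2 1), by simp, hcd, hcs, fun x => f.nonneg_normed x, f.integral_normed, ?_, (lt_of_lt_of_le zero_lt_one (by simp)).le, ?_, ?_, ?_⟩
  · intro x hx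
    have : x ∈ Function.support ξ := hx
    rw [f.support_normed_eq] at this
    simpa [f] using this
  · intro x; exact (h0 x).trans (by simp)
  · intro x; exact (h1 x).trans (by simp)
  · intro x y
    have := Convex.norm_image_sub_le_of_norm_fderiv_le (f := fderiv ℝ ξ) (s := univ) (C := K2) (x := y) (y := x)
      (fun z _ => (hd1.differentiable (by simp)).differentiableAt) (fun z _ => h2 z) convex_univ (mem_univ _) (mem_univ _)
    refine this.trans ?_
    gcongr
    simp

section conv
variable {α : Type*} [MeasurableSpace α] {F : Type*} [NormedAddCommGroup F] [NormedSpace ℝ F]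

def conv (ξ : Euc d → ℝ) (P : Measure α) (π : α → Euc d) (f : α → F) (x : Euc d) : F :=
  ∫ p, ξ (x - π p) • f p ∂P

def convD (ξ : Euc d → ℝ) (P : Measure α) (π : α → Euc d) (f : α → F) (x : Euc d) : Euc d →L[ℝ] F :=
  ∫ p, (fderiv ℝ ξ (x - π p)).smulRight (f p) ∂P


theorem conv_integrable {ξ : Euc d → ℝ} {ε C : ℝ} (hξ : Moll ξ ε C) {P : Measure α} {π : α → Euc d} (mπ : Measurable π)
  {f : α → F} (hf : Integrable f P)
    (x : Euc d) : Integrable (fun p => ξ (x - π p) • f p) P := by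
  refine Integrable.mono' (hf.norm.const_mul C) ?_ (Eventually.of_forall fun p => ?_)
  · have : Measurable fun p => ξ (x - π p) := hξ.cd.continuous.measurable.comp (measurable_const.sub mπ)
    exact this.aestronglyMeasurable.smul hf.aestronglyMeasurable
  · rw [norm_smul]
    gcongr
    exact hξ.b0 _

theorem convD_integrable {ξ : Euc d → ℝ} {ε C : ℝ} (hξ : Moll ξ ε C) {P : Measure α} {π : α → Euc d} (mπ : Measurable π)
  {f : α → F} (hf : Integrable f P)
    (x : Euc d) : Integrable (fun p => (fderiv ℝ ξ (x - π p)).smulRight (f p)) P := by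
  refine Integrable.mono' (hf.norm.const_mul C) ?_ (Eventually.of_forall fun p => ?_)
  · have h1 : Measurable fun p => fderiv ℝ ξ (x - π p) :=
      (hξ.cd.continuous_fderiv (by simp)).measurable.comp (measurable_const.sub mπ)
    have h2 : Continuous fun q : (Euc d →L[ℝ] ℝ) × F => (q.1).smulRight q.2 := by fun_prop
    exact h2.comp_aestronglyMeasurable (h1.aestronglyMeasurable.prodMk hf.aestronglyMeasurable)
  · rw [ContinuousLinearMap.norm_smulRight_apply]
    gcongr
    exact hξ.b1 _

theorem conv_bound {ξ : Euc d → ℝ} {ε C : ℝ} (hξ : Moll ξ ε C) {P : Measure α} {π : α → Euc d} (mπ : Measurable π)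
  {f : α → F} (hf : Integrable f P)
    (x : Euc d) : ‖conv ξ P π f x‖ ≤ C * ∫ p, ‖f p‖ ∂P := by
  unfold conv
  rw [← integral_const_mul]
  refine norm_integral_le_of_norm_le (hf.norm.const_mul C) (Eventually.of_forall fun p => ?_)
  rw [norm_smul]
  gcongr
  exact hξ.b0 _

theorem convD_bound {ξ : Euc d → ℝ} {ε C : ℝ} (hξ : Moll ξ ε C) {P : Measure α} {π : α → Euc d} (mπ : Measurable π)
  {f : α → F} (hf : Integrable f P)
    (x : Euc d) : ‖convD ξ P π f x‖ ≤ C * ∫ p, ‖f p‖ ∂P := by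
  unfold convD
  rw [← integral_const_mul]
  refine norm_integral_le_of_norm_le (hf.norm.const_mul C) (Eventually.of_forall fun p => ?_)
  rw [ContinuousLinearMap.norm_smulRight_apply]
  gcongr
  exact hξ.b1 _

theorem convD_lip {ξ : Euc d → ℝ} {ε C : ℝ} (hξ : Moll ξ ε C) {P : Measure α} {π : α → Euc d} (mπ : Measurable π)
  {f : α → F} (hf : Integrable f P)
    (x y : Euc d) : ‖convD ξ P π f x - convD ξ P π f y‖ ≤ C * (∫ p, ‖f p‖ ∂P) * ‖x - y‖ := by
  unfold convD
  rw [← integral_sub (convD_integrable hξ mπ hf x) (convD_integrable hξ mπ hf y), mul_right_comm, ← integral_const_mul]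
  refine norm_integral_le_of_norm_le (hf.norm.const_mul _) (Eventually.of_forall fun p => ?_)
  have : (fderiv ℝ ξ (x - π p)).smulRight (f p) - (fderiv ℝ ξ (y - π p)).smulRight (f p)
      = (fderiv ℝ ξ (x - π p) - fderiv ℝ ξ (y - π p)).smulRight (f p) := by
    ext; simp [sub_smul]
  rw [this, ContinuousLinearMap.norm_smulRight_apply]
  gcongr
  refine (hξ.b2 _ _).trans_eq ?_
  congr 2
  abel

theorem conv_hasFDerivAt {ξ : Euc d → ℝ} {ε C : ℝ} (hξ : Moll ξ ε C) {P : Measure α} {π : α → Euc d} (mπ : Measurable π)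
  {f : α → F} (hf : Integrable f P)
    (x : Euc d) : HasFDerivAt (conv ξ P π f) (convD ξ P π f x) x := by
  refine hasFDerivAt_integral_of_dominated_of_fderiv_le (𝕜 := ℝ) (F := fun x p => ξ (x - π p) • f p)
    (F' := fun x p => (fderiv ℝ ξ (x - π p)).smulRight (f p)) (bound := fun p => C * ‖f p‖) (s := univ) univ_mem
    (Eventually.of_forall fun y => (conv_integrable hξ mπ hf y).aestronglyMeasurable) (conv_integrable hξ mπ hf x)
    (convD_integrable hξ mπ hf x).aestronglyMeasurable (Eventually.of_forall fun p y _ => ?_) (hf.norm.const_mul C)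
    (Eventually.of_forall fun p y _ => ?_)
  · rw [ContinuousLinearMap.norm_smulRight_apply]
    gcongr
    exact hξ.b1 _
  · have h1 : HasFDerivAt ξ (fderiv ℝ ξ (y - π p)) (y - π p) := ((hξ.cd.differentiable (by simp)).differentiableAt).hasFDerivAt
    have h2 : HasFDerivAt (fun y => ξ (y - π p)) (fderiv ℝ ξ (y - π p)) y :=
      (h1.comp y ((hasFDerivAt_id y).sub_const (π p))).congr_fderiv (by ext; simp)
    exact h2.smul_const (f p)

theorem conv_lip {ξ : Euc d → ℝ} {ε C : ℝ} (hξ : Moll ξ ε C) {P : Measure α} {π : α → Euc d} (mπ : Measurable π)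
  {f : α → F} (hf : Integrable f P)
    (x y : Euc d) : ‖conv ξ P π f x - conv ξ P π f y‖ ≤ C * (∫ p, ‖f p‖ ∂P) * ‖x - y‖ :=
  Convex.norm_image_sub_le_of_norm_hasFDerivWithin_le (s := univ)
      (fun z _ => (conv_hasFDerivAt hξ mπ hf z).hasFDerivWithinAt) (fun z _ => convD_bound hξ mπ hf z) convex_univ (mem_univ _) (mem_univ _)

theorem conv_taylor {ξ : Euc d → ℝ} {ε C : ℝ} (hξ : Moll ξ ε C) {P : Measure α} {π : α → Euc d} (mπ : Measurable π)
  {f : α → F} (hf : Integrable f P)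
    (x y : Euc d) : ‖conv ξ P π f y - conv ξ P π f x - convD ξ P π f x (y - x)‖
    ≤ C * (∫ p, ‖f p‖ ∂P) * ‖y - x‖ ^ 2 := by
  have hA0 : 0 ≤ C * (∫ p, ‖f p‖ ∂P) := mul_nonneg hξ.hC (integral_nonneg fun _ => norm_nonneg _)
  have := Convex.norm_image_sub_le_of_norm_hasFDerivWithin_le' (s := segment ℝ x y) (C := C * (∫ p, ‖f p‖ ∂P) * ‖y - x‖)
      (φ := convD ξ P π f x)
      (fun z _ => (conv_hasFDerivAt hξ mπ hf z).hasFDerivWithinAt) (fun z hz => ?_) (convex_segment x y) (left_mem_segment _ _ _) (right_mem_segment _ _ _)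
  · rw [pow_two, ← mul_assoc]; exact this
  · refine (convD_lip hξ mπ hf z x).trans ?_
    gcongr
    exact norm_sub_le_of_mem_segment hz
end conv

theorem trace_convD {ξ : Euc d → ℝ} {ε C : ℝ} (hξ : Moll ξ ε C) {α : Type*} [MeasurableSpace α] {P : Measure α} {π : α → Euc d} (mπ : Measurable π)
  {f : α → Euc d} (hf : Integrable f P) (x : Euc d) :
    LinearMap.trace ℝ _ (convD ξ P π f x : Euc d →ₗ[ℝ] Euc d) = ∫ p, fderiv ℝ ξ (x - π p) (f p) ∂P := by
  let T : (Euc d →L[ℝ] Euc d) →ₗ[ℝ] ℝ := (LinearMap.trace ℝ (Euc d)).comp (ContinuousLinearMap.coeLM ℝ)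
  let T' : (Euc d →L[ℝ] Euc d) →L[ℝ] ℝ := LinearMap.toContinuousLinearMap T
  have h1 : ∀ A : Euc d →L[ℝ] Euc d, T' A = LinearMap.trace ℝ _ (A : Euc d →ₗ[ℝ] Euc d) := fun A => rfl
  rw [← h1, convD, ← ContinuousLinearMap.integral_comp_comm _ (convD_integrable hξ mπ hf x)]
  congr 1
  funext p
  rw [h1]
  exact LinearMap.trace_smulRight (fderiv ℝ ξ (x - π p) : Euc d →ₗ[ℝ] ℝ) (f p)
end

section
open ProbabilityTheory

theorem cs_weight {α : Type*} [MeasurableSpace α] {F : Type*} [NormedAddCommGroup F] [NormedSpace ℝ F]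
    {P : Measure α} {w : α → ℝ} {f : α → F} (hw : ∀ p, 0 ≤ w p) (i0 : Integrable w P)
    (i1 : Integrable (fun p => w p • f p) P) (i2 : Integrable (fun p => w p * ‖f p‖ ^ 2) P) :
    ‖∫ p, w p • f p ∂P‖ ^ 2 ≤ (∫ p, w p ∂P) * ∫ p, w p * ‖f p‖ ^ 2 ∂P := by
  have i1' : Integrable (fun p => w p * ‖f p‖) P := by
    refine i1.norm.congr (Eventually.of_forall fun p => ?_)
    simp only [norm_smul, Real.norm_eq_abs, abs_of_nonneg (hw p)]
  have hb : ‖∫ p, w p • f p ∂P‖ ≤ ∫ p, w p * ‖f p‖ ∂P := by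
    refine norm_integral_le_of_norm_le i1' (Eventually.of_forall fun p => ?_)
    rw [norm_smul, Real.norm_eq_abs, abs_of_nonneg (hw p)]
  have hq : ∀ l : ℝ, 0 ≤ (∫ p, w p ∂P) * (l * l) + (-2 * ∫ p, w p * ‖f p‖ ∂P) * l + ∫ p, w p * ‖f p‖ ^ 2 ∂P := by
    intro l
    have h1 : 0 ≤ ∫ p, w p * (l - ‖f p‖) ^ 2 ∂P := integral_nonneg fun p => mul_nonneg (hw p) (sq_nonneg _)
    have h2 : ∫ p, w p * (l - ‖f p‖) ^ 2 ∂P = ∫ p, (w p * (l * l) + (w p * ‖f p‖) * (-2 * l) + w p * ‖f p‖ ^ 2) ∂P := by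
      congr 1; funext p; ring
    rw [h2, integral_add, integral_add, integral_mul_const, integral_mul_const] at h1
    · linarith
    · exact i0.mul_const _
    · exact i1'.mul_const _
    · exact (i0.mul_const _).add (i1'.mul_const _)
    · exact i2
  have := discrim_le_zero hq
  unfold discrim at this
  calc ‖∫ p, w p • f p ∂P‖ ^ 2 ≤ (∫ p, w p * ‖f p‖ ∂P) ^ 2 := by gcongr
    _ ≤ _ := by nlinarith

def Pk (κ : Kernel ℝ (Euc d)) (N k : ℕ) : Measure (XX d) :=
  (PP κ).restrict (Ioc ((k:ℝ) / N) (((k + 1 : ℕ) : ℝ) / N) ×ˢ univ)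

def Vk (κ : Kernel ℝ (Euc d)) (ξ : Euc d → ℝ) (t : ℝ) (x : Euc d) : ℝ := conv ξ (κ t) id (fun _ => (1:ℝ)) x

def Uk (κ : Kernel ℝ (Euc d)) (ξ : Euc d → ℝ) (ε : ℝ) (N k : ℕ) (x : Euc d) : ℝ := Vk κ ξ ((k:ℝ) / N) x + ε

def Ak (κ : Kernel ℝ (Euc d)) (v : XX d → Euc d) (ξ : Euc d → ℝ) (N k : ℕ) : Euc d → Euc d :=
  conv ξ (Pk κ N k) Prod.snd v

def Bk (κ : Kernel ℝ (Euc d)) (g : XX d → ℝ) (ξ : Euc d → ℝ) (N k : ℕ) : Euc d → ℝ :=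
  conv ξ (Pk κ N k) Prod.snd (fun p => g p / 2)

def alk (κ : Kernel ℝ (Euc d)) (v : XX d → Euc d) (g : XX d → ℝ) (N k : ℕ) : ℝ :=
  ∫ p, (‖v p‖ + |g p|) ∂(Pk κ N k)

section
variable {v : XX d → Euc d} {g : XX d → ℝ} {κ : Kernel ℝ (Euc d)} {R M : ℝ}

theorem CED.finPP (H : CED v g κ R M) : IsFiniteMeasure (PP κ) := by
  haveI := H.fin
  unfold PP; infer_instance

theorem CED.finPk (H : CED v g κ R M) (N k : ℕ) : IsFiniteMeasure (Pk κ N k) := by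
  haveI := H.finPP
  unfold Pk; infer_instance

theorem CED.iv (H : CED v g κ R M) : Integrable v (PP κ) := by
  haveI := H.finPP
  exact H.ev.integrable (by norm_num)

theorem CED.ig (H : CED v g κ R M) : Integrable g (PP κ) := by
  haveI := H.finPP
  exact H.eg.integrable (by norm_num)

theorem CED.ivk (H : CED v g κ R M) (N k : ℕ) : Integrable v (Pk κ N k) := H.iv.restrict
theorem CED.igk (H : CED v g κ R M) (N k : ℕ) : Integrable g (Pk κ N k) := H.ig.restrict

theorem CED.massR (H : CED v g κ R M) (t : ℝ) : (κ t).real univ ≤ M := by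
  have := H.mass t
  exact ENNReal.toReal_le_of_le_ofReal H.hM.le this

theorem CED.Pk_mass (H : CED v g κ R M) {N : ℕ} (hN : 1 ≤ N) (k : ℕ) : (Pk κ N k).real univ ≤ M / N := by
  haveI := H.fin
  apply ENNReal.toReal_le_of_le_ofReal (by have := H.hM; positivity)
  unfold Pk PP
  rw [Measure.restrict_apply_univ, Measure.compProd_apply_prod measurableSet_Ioc MeasurableSet.univ]
  have hN0 : (0:ℝ) < N := by exact_mod_cast hN
  calc ∫⁻ a in Ioc ((k:ℝ) / N) (((k + 1 : ℕ) : ℝ) / N), κ a univ ∂(volume.restrict (Ioc 0 1))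
      ≤ ∫⁻ a in Ioc ((k:ℝ) / N) (((k + 1 : ℕ) : ℝ) / N), ENNReal.ofReal M ∂(volume.restrict (Ioc 0 1)) :=
        lintegral_mono fun a => H.mass a
    _ = ENNReal.ofReal M * (volume.restrict (Ioc 0 1)) (Ioc ((k:ℝ) / N) (((k + 1 : ℕ) : ℝ) / N)) := by simp
    _ ≤ ENNReal.ofReal M * volume (Ioc ((k:ℝ) / N) (((k + 1 : ℕ) : ℝ) / N)) := by
        gcongr
        exact Measure.restrict_le_self
    _ = ENNReal.ofReal (M / N) := by
        rw [Real.volume_Ioc, ← ENNReal.ofReal_mul H.hM.le]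
        congr 1
        push_cast
        field_simp
        ring

theorem CED.ialk (H : CED v g κ R M) (N k : ℕ) : Integrable (fun p => ‖v p‖ + |g p|) (Pk κ N k) :=
  (H.ivk N k).norm.add (H.igk N k).norm

theorem CED.alk_nonneg (N k : ℕ) : 0 ≤ alk κ v g N k :=
  integral_nonneg fun p => by positivity

theorem CED.memL (H : CED v g κ R M) : MemLp (fun p => ‖v p‖ + |g p|) 2 (PP κ) := H.ev.norm.add H.eg.norm

theorem CED.iE (H : CED v g κ R M) : Integrable (fun p => (‖v p‖ + |g p|) ^ 2) (PP κ) := by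
  have := H.memL.integrable_norm_pow (by norm_num)
  refine this.congr (Eventually.of_forall fun p => ?_)
  show ‖‖v p‖ + |g p|‖ ^ _ = _
  rw [Real.norm_of_nonneg (by positivity)]

theorem CED.alk_sq (H : CED v g κ R M) {N : ℕ} (hN : 1 ≤ N) (k : ℕ) :
    (alk κ v g N k) ^ 2 ≤ M / N * ∫ p, (‖v p‖ + |g p|) ^ 2 ∂(Pk κ N k) := by
  haveI := H.finPk N k
  have h := cs_weight (P := Pk κ N k) (w := fun _ => 1) (f := fun p => ‖v p‖ + |g p|) (fun _ => zero_le_one)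
    (integrable_const _) (by simpa using H.ialk N k) (by simpa using (show Integrable _ (Pk κ N k) from H.iE.restrict))
  simp only [one_smul, one_mul, Real.norm_eq_abs, sq_abs, integral_const, smul_eq_mul, mul_one] at h
  refine h.trans ?_
  gcongr
  exact H.Pk_mass hN k

theorem CED.ivl_sub {N k : ℕ} (hN : 1 ≤ N) (hk : k < N) : 0 ≤ (k:ℝ) / N ∧ (k:ℝ)/N ≤ ((k + 1 : ℕ) : ℝ) / N ∧ ((k + 1 : ℕ) : ℝ) / N ≤ 1 := by
  have hN0 : (0:ℝ) < N := by exact_mod_cast hN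
  refine ⟨by positivity, ?_, ?_⟩
  · gcongr; simp
  · rw [div_le_one hN0]; exact_mod_cast hk

variable {ξ : Euc d → ℝ} {ε C : ℝ}

theorem CED.stepHyp (H : CED v g κ R M) (hξ : Moll ξ ε C) (e : ℝ) (N k : ℕ) :
    StepHyp (C * M + C) e (alk κ v g N k) (Uk κ ξ e N k)
      (convD ξ (κ ((k:ℝ)/N)) id (fun _ => (1:ℝ))) (Ak κ v ξ N k) (convD ξ (Pk κ N k) Prod.snd v) (Bk κ g ξ N k) := by
  haveI := H.fin
  haveI := H.finPk N k
  have hC := hξ.hC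
  have hM := H.hM
  have hal := CED.alk_nonneg (κ := κ) (v := v) (g := g) N k
  have i1 : Integrable (fun _ : Euc d => (1:ℝ)) (κ ((k:ℝ)/N)) := integrable_const _
  have hm1 : ∫ p, ‖(1:ℝ)‖ ∂(κ ((k:ℝ)/N)) ≤ M := by simpa using H.massR ((k:ℝ)/N)
  have hv : ∫ p, ‖v p‖ ∂(Pk κ N k) ≤ alk κ v g N k :=
    integral_mono (H.ivk N k).norm (H.ialk N k) fun p => by simp
  have ig : Integrable (fun p => g p / 2) (Pk κ N k) := (H.igk N k).div_const 2
  have hg : ∫ p, ‖g p / 2‖ ∂(Pk κ N k) ≤ alk κ v g N k :=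
    integral_mono ig.norm (H.ialk N k) fun p => by
      have : ‖g p / 2‖ = |g p| / 2 := by simp
      show ‖g p / 2‖ ≤ ‖v p‖ + |g p|
      rw [this]
      linarith [norm_nonneg (v p), abs_nonneg (g p)]
  have cM : 0 ≤ C * M := by positivity
  have hcv : C * ∫ p, ‖v p‖ ∂(Pk κ N k) ≤ (C * M + C) * alk κ v g N k := by
    calc C * ∫ p, ‖v p‖ ∂(Pk κ N k) ≤ C * alk κ v g N k := by gcongr
      _ ≤ _ := by gcongr; linarith
  have hcg : C * ∫ p, ‖g p / 2‖ ∂(Pk κ N k) ≤ (C * M + C) * alk κ v g N k := by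
    calc C * ∫ p, ‖g p / 2‖ ∂(Pk κ N k) ≤ C * alk κ v g N k := by gcongr
      _ ≤ _ := by gcongr; linarith
  have hc1 : C * ∫ p, ‖(1:ℝ)‖ ∂(κ ((k:ℝ)/N)) ≤ C * M + C := by
    calc C * ∫ p, ‖(1:ℝ)‖ ∂(κ ((k:ℝ)/N)) ≤ C * M := by gcongr
      _ ≤ _ := by linarith
  refine ⟨fun x => (conv_hasFDerivAt hξ measurable_id i1 x).add_const _, fun x => conv_hasFDerivAt hξ measurable_snd (H.ivk N k) x,
    fun x => ?_, fun x => (convD_bound hξ measurable_id i1 x).trans hc1, fun x y => ?_,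
    fun x => (conv_bound hξ measurable_snd (H.ivk N k) x).trans hcv,
    fun x => (convD_bound hξ measurable_snd (H.ivk N k) x).trans hcv,
    fun x => (conv_bound hξ measurable_snd ig x).trans hcg,
    fun x y => (convD_lip hξ measurable_snd (H.ivk N k) x y).trans (by gcongr),
    fun x y => (conv_lip hξ measurable_snd ig x y).trans (by gcongr), ?_⟩
  · have : 0 ≤ Vk κ ξ ((k:ℝ)/N) x := integral_nonneg fun p => by simpa using hξ.nn _
    unfold Uk; linarith
  · have h := conv_taylor hξ measurable_id i1 x y
    have h2 := h.trans (mul_le_mul_of_nonneg_right hc1 (sq_nonneg _))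
    rw [Real.norm_eq_abs] at h2
    have h3 := (abs_le.1 h2).1
    unfold Uk Vk
    linarith
  · exact continuous_iff_continuousAt.2 fun x => (conv_hasFDerivAt hξ measurable_snd ig x).continuousAt

theorem CED.ce_xi (H : CED v g κ R M) (hξ : Moll ξ ε C) (x : Euc d) {s t : ℝ} (hs : 0 ≤ s) (hst : s ≤ t) (ht : t ≤ 1) :
    Vk κ ξ t x - Vk κ ξ s x = ∫ p in Ioc s t ×ˢ univ, (- fderiv ℝ ξ (x - p.2) (v p) + ξ (x - p.2) * g p) ∂(PP κ) := by
  have h := H.ce (fun y => ξ (x - y)) (hξ.cd.comp (contDiff_const.sub contDiff_id))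
    (hξ.cs.comp_homeomorph (Homeomorph.subLeft x)) s t hs hst ht
  have hd : ∀ y w, fderiv ℝ (fun y => ξ (x - y)) y w = - fderiv ℝ ξ (x - y) w := by
    intro y w
    have h1 : HasFDerivAt ξ (fderiv ℝ ξ (x - y)) (x - y) := ((hξ.cd.differentiable (by simp)).differentiableAt).hasFDerivAt
    have h2 : HasFDerivAt (fun y => ξ (x - y)) (-fderiv ℝ ξ (x - y)) y :=
      (h1.comp y ((hasFDerivAt_id y).const_sub x)).congr_fderiv (by ext; simp)
    rw [h2.fderiv]; simp
  simp only [hd] at h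
  rw [← h]
  simp [Vk, conv]

theorem CED.integrands (H : CED v g κ R M) (hξ : Moll ξ ε C) (x : Euc d) :
    Integrable (fun p : XX d => fderiv ℝ ξ (x - p.2) (v p)) (PP κ) ∧ Integrable (fun p : XX d => ξ (x - p.2) * g p) (PP κ) := by
  haveI := H.finPP
  constructor
  · refine Integrable.mono' (H.iv.norm.const_mul C) ?_ (Eventually.of_forall fun p => ?_)
    · have h1 : Continuous (fun q : (Euc d →L[ℝ] ℝ) × Euc d => q.1 q.2) := by fun_prop
      exact (h1.measurable.comp (((hξ.cd.continuous_fderiv (by simp)).measurable.comp (measurable_const.sub measurable_snd)).prodMk H.mv)).aestronglyMeasurable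
    · refine ((fderiv ℝ ξ _).le_opNorm (v p)).trans ?_
      gcongr
      exact hξ.b1 _
  · exact conv_integrable hξ measurable_snd H.ig x

theorem CED.Uk_succ (H : CED v g κ R M) (hξ : Moll ξ ε C) (e : ℝ) {N k : ℕ} (hN : 1 ≤ N) (hk : k < N) (x : Euc d) :
    Uk κ ξ e N (k+1) x = Uk κ ξ e N k x - LinearMap.trace ℝ _ (convD ξ (Pk κ N k) Prod.snd v x : Euc d →ₗ[ℝ] Euc d) + 2 * Bk κ g ξ N k x := by
  obtain ⟨h0, h1, h2⟩ := CED.ivl_sub hN hk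
  have h := H.ce_xi hξ x h0 h1 h2
  obtain ⟨i1, i2⟩ := H.integrands hξ x
  rw [integral_add (f := fun p : XX d => -(fderiv ℝ ξ (x - p.2)) (v p)) i1.restrict.neg i2.restrict, integral_neg] at h
  rw [trace_convD hξ measurable_snd (H.ivk N k)]
  have hb : 2 * Bk κ g ξ N k x = ∫ p, ξ (x - p.2) * g p ∂(Pk κ N k) := by
    unfold Bk conv
    rw [← integral_const_mul]
    congr 1; funext p; simp; ring
  rw [hb]
  unfold Uk Pk
  linarith

theorem CED.Vk_time (H : CED v g κ R M) (hξ : Moll ξ ε C) {N k : ℕ} (hN : 1 ≤ N) (hk : k < N) (x : Euc d)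
    {s : ℝ} (hs : s ∈ Icc ((k:ℝ)/N) (((k + 1 : ℕ) : ℝ) / N)) :
    |Vk κ ξ s x - Vk κ ξ ((k:ℝ)/N) x| ≤ C * alk κ v g N k := by
  obtain ⟨h0, h1, h2⟩ := CED.ivl_sub hN hk
  rw [H.ce_xi hξ x h0 hs.1 (hs.2.trans h2)]
  have hi : Integrable (fun p => C * (‖v p‖ + |g p|)) (PP κ) := (H.iv.norm.add H.ig.norm).const_mul C
  calc |∫ p in Ioc ((k:ℝ)/N) s ×ˢ univ, (- fderiv ℝ ξ (x - p.2) (v p) + ξ (x - p.2) * g p) ∂(PP κ)|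
      ≤ ∫ p in Ioc ((k:ℝ)/N) s ×ˢ univ, C * (‖v p‖ + |g p|) ∂(PP κ) := by
        rw [← Real.norm_eq_abs]
        refine norm_integral_le_of_norm_le hi.restrict (Eventually.of_forall fun p => ?_)
        refine (norm_add_le _ _).trans ?_
        rw [norm_neg, norm_mul, mul_add]
        refine add_le_add (((fderiv ℝ ξ _).le_opNorm (v p)).trans ?_) ?_
        · gcongr
          exact hξ.b1 _
        · rw [Real.norm_eq_abs, Real.norm_eq_abs]
          gcongr
          exact hξ.b0 _
    _ ≤ ∫ p in Ioc ((k:ℝ)/N) (((k + 1 : ℕ) : ℝ) / N) ×ˢ univ, C * (‖v p‖ + |g p|) ∂(PP κ) := by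
        refine setIntegral_mono_set hi.restrict (Eventually.of_forall fun p => ?_) ?_
        · have := hξ.hC
          show 0 ≤ C * (‖v p‖ + |g p|)
          positivity
        · exact HasSubset.Subset.eventuallyLE (prod_mono (Ioc_subset_Ioc_right hs.2) le_rfl)
    _ = C * alk κ v g N k := by
        rw [integral_const_mul]; rfl

theorem CED.xi_mass (H : CED v g κ R M) (hξ : Moll ξ ε C) {N k : ℕ} (hN : 1 ≤ N) (hk : k < N) (x : Euc d) :
    |(∫ p, ξ (x - p.2) ∂(Pk κ N k)) - 1 / N * Vk κ ξ ((k:ℝ)/N) x| ≤ 1 / N * (C * alk κ v g N k) := by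
  haveI := H.fin
  haveI := H.finPP
  obtain ⟨h0, h1, h2⟩ := CED.ivl_sub hN hk
  have hN0 : (0:ℝ) < N := by exact_mod_cast hN
  have hlen : ((k + 1 : ℕ) : ℝ) / N - (k:ℝ)/N = 1 / N := by push_cast; field_simp; ring
  have hi : Integrable (fun p : XX d => ξ (x - p.2)) (PP κ) := by
    simpa using conv_integrable hξ measurable_snd (integrable_const (μ := PP κ) (1:ℝ)) x
  have e1 : ∫ p, ξ (x - p.2) ∂(Pk κ N k) = ∫ s in ((k:ℝ)/N)..(((k + 1 : ℕ) : ℝ) / N), Vk κ ξ s x := by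
    rw [intervalIntegral.integral_of_le h1]
    unfold Pk PP
    rw [Measure.setIntegral_compProd measurableSet_Ioc MeasurableSet.univ hi.restrict,
      Measure.restrict_restrict measurableSet_Ioc, inter_eq_left.2 (Ioc_subset_Ioc h0 h2)]
    simp [Vk, conv]
  have hVc : Continuous fun s => Vk κ ξ s x := by
    have := H.cont (fun y => ξ (x - y)) (hξ.cd.continuous.comp (continuous_const.sub continuous_id))
    simpa [Vk, conv] using this
  have e2 : 1 / N * Vk κ ξ ((k:ℝ)/N) x = ∫ s in ((k:ℝ)/N)..(((k + 1 : ℕ) : ℝ) / N), Vk κ ξ ((k:ℝ)/N) x := by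
    rw [intervalIntegral.integral_const, hlen]; simp
  rw [e1, e2, ← intervalIntegral.integral_sub (hVc.intervalIntegrable _ _) (by simp)]
  have := intervalIntegral.norm_integral_le_of_norm_le_const (a := (k:ℝ)/N) (b := (((k + 1 : ℕ) : ℝ) / N))
    (f := fun s => Vk κ ξ s x - Vk κ ξ ((k:ℝ)/N) x) (C := C * alk κ v g N k) (fun s hs => by
      rw [uIoc_of_le h1] at hs
      exact H.Vk_time hξ hN hk x (Ioc_subset_Icc_self hs))
  rw [hlen, abs_of_pos (by positivity)] at this
  rw [Real.norm_eq_abs] at this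
  linarith
end
end

section
open ProbabilityTheory

def ak (κ : Kernel ℝ (Euc d)) (v : XX d → Euc d) (ξ : Euc d → ℝ) (ε : ℝ) (N k : ℕ) (x : Euc d) : Euc d :=
  (Uk κ ξ ε N k x)⁻¹ • Ak κ v ξ N k x

def bk (κ : Kernel ℝ (Euc d)) (g : XX d → ℝ) (ξ : Euc d → ℝ) (ε : ℝ) (N k : ℕ) (x : Euc d) : ℝ :=
  Bk κ g ξ N k x / Uk κ ξ ε N k x

def Xk (κ : Kernel ℝ (Euc d)) (v : XX d → Euc d) (ξ : Euc d → ℝ) (ε : ℝ) (N : ℕ) : ℕ → Euc d → Euc d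
  | 0, x => x
  | k + 1, x => Xk κ v ξ ε N k x + ak κ v ξ ε N k (Xk κ v ξ ε N k x)

def rk (κ : Kernel ℝ (Euc d)) (v : XX d → Euc d) (g : XX d → ℝ) (ξ : Euc d → ℝ) (ε : ℝ) (N : ℕ) : ℕ → Euc d → ℝ
  | 0, _ => 1
  | k + 1, x => rk κ v g ξ ε N k x * (1 + bk κ g ξ ε N k (Xk κ v ξ ε N k x))

structure Sch (v : XX d → Euc d) (g : XX d → ℝ) (κ : Kernel ℝ (Euc d)) (R M : ℝ) (ξ : Euc d → ℝ) (ε C : ℝ) (N : ℕ) : Prop where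
  H : CED v g κ R M
  hξ : Moll ξ ε C
  hε : 0 < ε
  hε1 : ε ≤ 1
  hN : 1 ≤ N
  hNε : 1 / (N:ℝ) ≤ ε
  hal : ∀ k < N, C * alk κ v g N k ≤ ε
  ha : ∀ k < N, ∀ x, ‖ak κ v ξ ε N k x‖ ^ 2 ≤ ε
  hb : ∀ k < N, ∀ x, |bk κ g ξ ε N k x| ≤ 1 / 2
  dom : ∀ k ≤ N, ∀ ψ : Euc d → ℝ≥0∞, ∫⁻ x, ψ (Xk κ v ξ ε N k x) * ENNReal.ofReal (rk κ v g ξ ε N k x ^ 2) * ENNReal.ofReal (Uk κ ξ ε N 0 x)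
    ≤ ENNReal.ofReal (1 + ε) * ∫⁻ x, ψ x * ENNReal.ofReal (Uk κ ξ ε N k x)

theorem ivl_disj (N : ℕ) (t : Finset ℕ) : (t : Set ℕ).PairwiseDisjoint
    (fun k : ℕ => (Ioc ((k:ℝ) / N) (((k + 1 : ℕ) : ℝ) / N) ×ˢ univ : Set (XX d))) := by
  intro i _ j _ hij
  have key : ∀ i j : ℕ, i < j → Disjoint (Ioc ((i:ℝ) / N) (((i + 1 : ℕ) : ℝ) / N) ×ˢ univ : Set (XX d)) (Ioc ((j:ℝ) / N) (((j + 1 : ℕ) : ℝ) / N) ×ˢ univ) := by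
    intro i j hij
    rw [Set.disjoint_left]
    rintro ⟨s, x⟩ ⟨h1, -⟩ ⟨h2, -⟩
    have h3 : (((i + 1 : ℕ) : ℝ) / N) ≤ (j:ℝ) / N := by gcongr; omega
    exact absurd (h1.2.trans h3) (not_le.2 h2.1)
  rcases lt_or_gt_of_ne hij with h | h
  · exact key i j h
  · exact (key j i h).symm

theorem sum_Pk_lintegral (κ : Kernel ℝ (Euc d)) (N n : ℕ) (f : XX d → ℝ≥0∞) :
    ∑ k ∈ Finset.range n, ∫⁻ p, f p ∂(Pk κ N k) ≤ ∫⁻ p, f p ∂(PP κ) := by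
  unfold Pk
  rw [← lintegral_biUnion_finset (ivl_disj N _) (fun k _ => measurableSet_Ioc.prod MeasurableSet.univ)]
  exact setLIntegral_le_lintegral _ _

theorem sum_Pk_integral (κ : Kernel ℝ (Euc d)) (N n : ℕ) (f : XX d → ℝ) (hf : ∀ p, 0 ≤ f p) (hi : Integrable f (PP κ)) :
    ∑ k ∈ Finset.range n, ∫ p, f p ∂(Pk κ N k) ≤ ∫ p, f p ∂(PP κ) := by
  unfold Pk
  rw [← integral_biUnion_finset _ (fun k _ => measurableSet_Ioc.prod MeasurableSet.univ) (ivl_disj N _) (fun k _ => hi.restrict)]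
  exact setIntegral_le_integral hi (Eventually.of_forall hf)

section
variable {v : XX d → Euc d} {g : XX d → ℝ} {κ : Kernel ℝ (Euc d)} {R M : ℝ} {ξ : Euc d → ℝ} {ε C : ℝ} {N : ℕ}

theorem dom_aux (cc : ℕ → ℝ) (h : ∀ k < N, ∀ ψ : Euc d → ℝ≥0∞,
      ∫⁻ x, ψ (x + ak κ v ξ ε N k x) * ENNReal.ofReal ((1 + bk κ g ξ ε N k x) ^ 2 * Uk κ ξ ε N k x)
      ≤ ENNReal.ofReal (cc k) * ∫⁻ x, ψ x * ENNReal.ofReal (Uk κ ξ ε N (k+1) x)) : ∀ k ≤ N, ∀ ψ : Euc d → ℝ≥0∞,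
    ∫⁻ x, ψ (Xk κ v ξ ε N k x) * ENNReal.ofReal (rk κ v g ξ ε N k x ^ 2) * ENNReal.ofReal (Uk κ ξ ε N 0 x)
    ≤ (∏ j ∈ Finset.range k, ENNReal.ofReal (cc j)) * ∫⁻ x, ψ x * ENNReal.ofReal (Uk κ ξ ε N k x) := by
  intro k
  induction k with
  | zero => intro _ ψ; simp [Xk, rk]
  | succ k ih =>
    intro hk ψ
    have h1 := ih (by omega) (fun x => ψ (x + ak κ v ξ ε N k x) * ENNReal.ofReal ((1 + bk κ g ξ ε N k x) ^ 2))
    have h2 := h k (by omega) ψ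
    rw [Finset.prod_range_succ, mul_assoc]
    refine le_trans (le_of_eq ?_) (h1.trans ?_)
    · congr 1; funext x
      simp only [Xk, rk]
      rw [mul_pow, ENNReal.ofReal_mul (sq_nonneg _)]
      ring
    · refine mul_le_mul_right ?_ _
      refine le_trans (le_of_eq ?_) h2
      congr 1; funext x
      rw [mul_assoc, ENNReal.ofReal_mul (sq_nonneg _)]

theorem exists_Sch (H : CED v g κ R M) {ε : ℝ} (hε : 0 < ε) (hε1 : ε ≤ 1) (n : ℕ) :
    ∃ K, n ≤ K ∧ ∃ ξ C, Sch v g κ R M ξ ε C (2 ^ K) := by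
  obtain ⟨ξ, C, hC, hξ⟩ := exists_moll d ε hε
  have hM := H.hM
  set c := C * M + C with hc
  have hc0 : 0 < c := by positivity
  obtain ⟨C', α0, hC', hα0, hstep⟩ := step_lemma d c ε hc0 hε
  set E := ∫ p, (‖v p‖ + |g p|) ^ 2 ∂(PP κ) with hE
  have hE0 : 0 ≤ E := integral_nonneg fun p => by positivity
  have hpow : Tendsto (fun K : ℕ => ((2 ^ K : ℕ) : ℝ)) atTop atTop := by
    have := tendsto_pow_atTop_atTop_of_one_lt (r := (2:ℝ)) (by norm_num)
    simpa using this
  have hinv : ∀ a : ℝ, Tendsto (fun K : ℕ => a / ((2 ^ K : ℕ) : ℝ)) atTop (𝓝 0) := fun a => hpow.const_div_atTop a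
  have ev : ∀ a b : ℝ, 0 < b → ∀ᶠ K : ℕ in atTop, a / ((2 ^ K : ℕ) : ℝ) ≤ b := fun a b hb =>
    (hinv a).eventually (eventually_le_nhds hb)
  have hlog : 0 < Real.log (1 + ε) := Real.log_pos (by linarith)
  obtain ⟨K, hKn, h1, h2, h3, h4, h5⟩ := ((eventually_ge_atTop n).and ((ev 1 ε hε).and ((ev (M * E) (α0 ^ 2) (by positivity)).and
    ((ev (M * E) ((ε / (C + 1)) ^ 2) (by positivity)).and ((ev (M * E) (ε ^ 3 / (c ^ 2 + 1)) (by positivity)).and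
    (ev (C' * (M * E)) (Real.log (1 + ε)) hlog)))))).exists
  refine ⟨K, hKn, ξ, C, ?_⟩
  generalize hNd : 2 ^ K = N at *
  have hN : 1 ≤ N := by rw [← hNd]; exact Nat.one_le_two_pow
  have hN0 : (0:ℝ) < N := by exact_mod_cast hN
  have hal0 : ∀ k, 0 ≤ alk κ v g N k := fun k => CED.alk_nonneg N k
  have halsq : ∀ k, alk κ v g N k ^ 2 ≤ M * E / N := by
    intro k
    refine (H.alk_sq hN k).trans ?_
    rw [div_mul_eq_mul_div]
    gcongr
    exact integral_mono_measure Measure.restrict_le_self (Eventually.of_forall fun p => by positivity) H.iE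
  have hal1 : ∀ k, alk κ v g N k ≤ α0 := fun k => abs_le_of_sq_le_sq' ((halsq k).trans h2) hα0.le |>.2
  have hal2 : ∀ k, C * alk κ v g N k ≤ ε := fun k => by
    have := abs_le_of_sq_le_sq' ((halsq k).trans h3) (by positivity) |>.2
    rw [le_div_iff₀ (by positivity)] at this
    nlinarith [hal0 k]
  have hst : ∀ k < N, (∀ x, |bk κ g ξ ε N k x| ≤ 1 / 2) ∧ ∀ ψ : Euc d → ℝ≥0∞,
      ∫⁻ x, ψ (x + ak κ v ξ ε N k x) * ENNReal.ofReal ((1 + bk κ g ξ ε N k x) ^ 2 * Uk κ ξ ε N k x)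
      ≤ ENNReal.ofReal (1 + C' * alk κ v g N k ^ 2) * ∫⁻ x, ψ x * ENNReal.ofReal (Uk κ ξ ε N (k+1) x) := by
    intro k hk
    obtain ⟨g1, g2⟩ := hstep _ (hal0 k) (hal1 k) _ _ _ _ _ (H.stepHyp hξ ε N k)
    refine ⟨g1, fun ψ => (g2 ψ).trans (le_of_eq ?_)⟩
    congr 2; funext x
    rw [H.Uk_succ hξ ε hN hk x]
  refine ⟨H, hξ, hε, hε1, hN, h1, fun k _ => hal2 k, fun k hk x => ?_, fun k hk => (hst k hk).1, fun k hk ψ => ?_⟩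
  · have sh := H.stepHyp hξ ε N k
    have a1 := sh.hAα x
    have a2 := sh.hUε x
    have a3 : ‖ak κ v ξ ε N k x‖ ≤ c * alk κ v g N k / ε := by
      unfold ak
      rw [norm_smul, norm_inv, Real.norm_of_nonneg (hε.le.trans a2), inv_mul_eq_div]
      have := hal0 k
      gcongr
    calc ‖ak κ v ξ ε N k x‖ ^ 2 ≤ (c * alk κ v g N k / ε) ^ 2 := by gcongr
      _ = c ^ 2 * alk κ v g N k ^ 2 / ε ^ 2 := by ring
      _ ≤ c ^ 2 * (ε ^ 3 / (c ^ 2 + 1)) / ε ^ 2 := by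
        gcongr
        exact (halsq k).trans h4
      _ = c ^ 2 / (c ^ 2 + 1) * ε := by field_simp
      _ ≤ 1 * ε := by
        gcongr
        rw [div_le_one (by positivity)]; linarith
      _ = ε := one_mul _
  · refine (dom_aux (fun k => 1 + C' * alk κ v g N k ^ 2) (fun k hk => (hst k hk).2) k hk ψ).trans ?_
    gcongr
    rw [← ENNReal.ofReal_prod_of_nonneg (fun i _ => by positivity)]
    apply ENNReal.ofReal_le_ofReal
    calc ∏ j ∈ Finset.range k, (1 + C' * alk κ v g N j ^ 2) ≤ ∏ j ∈ Finset.range k, Real.exp (C' * alk κ v g N j ^ 2) := by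
          apply Finset.prod_le_prod
          · intro i _; positivity
          · intro i _
            have := Real.add_one_le_exp (C' * alk κ v g N i ^ 2)
            linarith
      _ = Real.exp (∑ j ∈ Finset.range k, C' * alk κ v g N j ^ 2) := (Real.exp_sum _ _).symm
      _ ≤ Real.exp (Real.log (1 + ε)) := by
          apply Real.exp_le_exp.2
          refine le_trans ?_ h5
          rw [← Finset.mul_sum, mul_div_assoc]
          gcongr
          calc ∑ j ∈ Finset.range k, alk κ v g N j ^ 2 ≤ ∑ j ∈ Finset.range k, M / N * ∫ p, (‖v p‖ + |g p|) ^ 2 ∂(Pk κ N j) :=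
                Finset.sum_le_sum fun j _ => H.alk_sq hN j
            _ = M / N * ∑ j ∈ Finset.range k, ∫ p, (‖v p‖ + |g p|) ^ 2 ∂(Pk κ N j) := by rw [Finset.mul_sum]
            _ ≤ M / N * E := by
                gcongr
                exact sum_Pk_integral κ N k _ (fun p => by positivity) H.iE
            _ = M * E / N := by ring
      _ = 1 + ε := Real.exp_log (by linarith)
end
end

section
open ProbabilityTheory

theorem tonelli_xi {ξ : Euc d → ℝ} {ε C : ℝ} (hξ : Moll ξ ε C) {α : Type*} [MeasurableSpace α] {P : Measure α} [IsFiniteMeasure P]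
    {π : α → Euc d} (mπ : Measurable π) {f : α → ℝ} (mf : Measurable f) (f0 : ∀ p, 0 ≤ f p) (hf : Integrable f P) :
    ∫⁻ x, ENNReal.ofReal (∫ p, ξ (x - π p) * f p ∂P) = ENNReal.ofReal (∫ p, f p ∂P) := by
  have mx : Measurable fun q : Euc d × α => ξ (q.1 - π q.2) :=
    hξ.cd.continuous.measurable.comp (measurable_fst.sub (mπ.comp measurable_snd))
  have e1 : ∀ x, ENNReal.ofReal (∫ p, ξ (x - π p) * f p ∂P) = ∫⁻ p, ENNReal.ofReal (ξ (x - π p)) * ENNReal.ofReal (f p) ∂P := by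
    intro x
    have := conv_integrable hξ mπ hf x
    simp only [smul_eq_mul] at this
    rw [ofReal_integral_eq_lintegral_ofReal this (Eventually.of_forall fun p => mul_nonneg (hξ.nn _) (f0 p))]
    congr 1; funext p
    rw [ENNReal.ofReal_mul (hξ.nn _)]
  simp only [e1]
  rw [lintegral_lintegral_swap]
  · rw [ofReal_integral_eq_lintegral_ofReal hf (Eventually.of_forall f0)]
    congr 1; funext p
    rw [lintegral_mul_const _ (by exact (hξ.cd.continuous.measurable.comp (measurable_id.sub_const _)).ennreal_ofReal)]
    rw [lintegral_sub_right_eq_self (fun x => ENNReal.ofReal (ξ x)) (π p), ← ofReal_integral_eq_lintegral_ofReal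
      (hξ.cd.continuous.integrable_of_hasCompactSupport hξ.cs) (Eventually.of_forall hξ.nn), hξ.int]
    simp
  · exact (mx.ennreal_ofReal.mul (mf.comp measurable_snd).ennreal_ofReal).aemeasurable

/-- drift of `(r, r γ)` divided by `r` -/
def phat (v : XX d → Euc d) (g : XX d → ℝ) (p : XX d) : ℝ × Euc d := (g p / 2, v p + (g p / 2) • p.2)

section
variable {v : XX d → Euc d} {g : XX d → ℝ} {κ : Kernel ℝ (Euc d)} {R M : ℝ} {ξ : Euc d → ℝ} {ε C : ℝ} {N : ℕ}

theorem CED.ae_ball (H : CED v g κ R M) : ∀ᵐ p ∂(PP κ), ‖p.2‖ < R := by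
  haveI := H.fin
  have ms : MeasurableSet {p : XX d | ¬ ‖p.2‖ < R} := by
    exact (measurableSet_lt (f := fun p : XX d => ‖p.2‖) measurable_snd.norm measurable_const).compl
  rw [ae_iff]
  unfold PP
  rw [Measure.compProd_apply ms]
  have : ∀ t, κ t (Prod.mk t ⁻¹' {p : XX d | ¬ ‖p.2‖ < R}) = 0 := by
    intro t
    refine measure_mono_null ?_ (H.supp t)
    intro x hx
    simpa using hx
  simp only [this, lintegral_zero]

theorem CED.m_phat (H : CED v g κ R M) : Measurable (phat v g) := by
  have := H.mv
  have := H.mg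
  unfold phat
  fun_prop

theorem CED.phat_memLp (H : CED v g κ R M) : MemLp (phat v g) 2 (PP κ) := by
  have hR := H.hR
  have h1 : MemLp (fun p => (1 + R) * (‖v p‖ + |g p|)) 2 (PP κ) := H.memL.const_mul _
  refine h1.mono' H.m_phat.aestronglyMeasurable ?_
  filter_upwards [H.ae_ball] with p hp
  unfold phat
  have h2 : ‖g p / 2‖ ≤ |g p| := by
    rw [norm_div, Real.norm_eq_abs]; norm_num
  rw [Prod.norm_def]
  refine max_le ?_ ?_
  · refine h2.trans ?_
    nlinarith [norm_nonneg (v p), abs_nonneg (g p), mul_nonneg hR.le (add_nonneg (norm_nonneg (v p)) (abs_nonneg (g p)))]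
  · refine (norm_add_le _ _).trans ?_
    show ‖v p‖ + ‖(g p / 2) • p.2‖ ≤ _
    rw [norm_smul]
    have : ‖g p / 2‖ * ‖p.2‖ ≤ |g p| * R := by gcongr
    nlinarith [norm_nonneg (v p), abs_nonneg (g p), mul_nonneg hR.le (norm_nonneg (v p))]

theorem Sch.U_pos (S : Sch v g κ R M ξ ε C N) (k : ℕ) (x : Euc d) : 0 < Uk κ ξ ε N k x :=
  lt_of_lt_of_le S.hε ((S.H.stepHyp S.hξ ε N k).hUε x)

theorem Sch.xi_le (S : Sch v g κ R M ξ ε C N) {k : ℕ} (hk : k < N) (x : Euc d) :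
    ∫ p, ξ (x - p.2) ∂(Pk κ N k) ≤ Uk κ ξ ε N k x / N ∧ |∫ p, ξ (x - p.2) ∂(Pk κ N k) - Uk κ ξ ε N k x / N| ≤ 2 * ε / N := by
  have h := S.H.xi_mass S.hξ S.hN hk x
  have h2 := S.hal k hk
  have hN0 : (0:ℝ) < N := by exact_mod_cast S.hN
  have h3 : 1 / (N:ℝ) * (C * alk κ v g N k) ≤ 1 / N * ε := by gcongr
  have h4 := abs_le.1 (h.trans h3)
  have e : Uk κ ξ ε N k x / N = 1 / N * Vk κ ξ ((k:ℝ)/N) x + 1 / N * ε := by unfold Uk; ring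
  have e2 : 2 * ε / N = 2 * (1 / N * ε) := by ring
  rw [e, e2]
  have : 0 ≤ 1 / (N:ℝ) * ε := by have := S.hε; positivity
  exact ⟨by linarith [h4.2], abs_le.2 ⟨by linarith [h4.1], by linarith [h4.2]⟩⟩

theorem Sch.ae_Pk (S : Sch v g κ R M ξ ε C N) (k : ℕ) : ∀ᵐ p ∂(Pk κ N k), ‖p.2‖ < R ∧ |p.1 - (k:ℝ)/N| ≤ ε := by
  have h1 : ∀ᵐ p ∂(Pk κ N k), ‖p.2‖ < R := ae_restrict_of_ae S.H.ae_ball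
  have h2 : ∀ᵐ p ∂(Pk κ N k), p ∈ (Ioc ((k:ℝ) / N) (((k + 1 : ℕ) : ℝ) / N) ×ˢ univ : Set (XX d)) :=
    ae_restrict_mem (measurableSet_Ioc.prod MeasurableSet.univ)
  have hN0 : (0:ℝ) < N := by exact_mod_cast S.hN
  have hlen : ((k + 1 : ℕ) : ℝ) / N = (k:ℝ)/N + 1 / N := by push_cast; field_simp
  filter_upwards [h1, h2] with p hp1 hp2
  refine ⟨hp1, ?_⟩
  have h3 := hp2.1.1
  have h4 := hp2.1.2
  rw [hlen] at h4
  have := S.hNε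
  rw [abs_le]
  constructor <;> linarith [S.hε]

def Dfun (v : XX d → Euc d) (g : XX d → ℝ) (W : XX d → ℝ × Euc d) (ε L : ℝ) (p : XX d) : ℝ :=
  2 * ‖phat v g p - W p‖ ^ 2 + 2 * ε ^ 2 * (|g p| + L) ^ 2

theorem CED.iW (H : CED v g κ R M) {W : XX d → ℝ × Euc d} (mW : Continuous W) {S : ℝ} (hW : ∀ p, ‖W p‖ ≤ S) :
    Integrable (fun p => ‖phat v g p - W p‖ ^ 2) (PP κ) := by
  haveI := H.finPP
  have h1 : MemLp W 2 (PP κ) := MemLp.of_bound mW.aestronglyMeasurable S (Eventually.of_forall hW)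
  exact (H.phat_memLp.sub h1).integrable_norm_pow (by norm_num)

theorem CED.iq (H : CED v g κ R M) (L : ℝ) : Integrable (fun p => (|g p| + L) ^ 2) (PP κ) := by
  haveI := H.finPP
  have h1 : MemLp (fun p => |g p| + L) 2 (PP κ) := H.eg.norm.add (memLp_const L)
  have := h1.integrable_norm_pow (by norm_num)
  refine this.congr (Eventually.of_forall fun p => ?_)
  show ‖|g p| + L‖ ^ 2 = _
  rw [Real.norm_eq_abs, sq_abs]

theorem CED.iD (H : CED v g κ R M) {W : XX d → ℝ × Euc d} (mW : Continuous W) {S : ℝ} (hW : ∀ p, ‖W p‖ ≤ S) (ε L : ℝ) :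
    Integrable (Dfun v g W ε L) (PP κ) := ((H.iW mW hW).const_mul _).add ((H.iq L).const_mul _)

theorem CED.mD (H : CED v g κ R M) {W : XX d → ℝ × Euc d} (mW : Continuous W) (ε L : ℝ) :
    Measurable (Dfun v g W ε L) := by
  have := H.m_phat
  have := H.mg
  have h2 := mW.measurable
  unfold Dfun
  fun_prop

theorem Sch.energy_pt1 (S : Sch v g κ R M ξ ε C N) {k : ℕ} (hk : k < N) {W : XX d → ℝ × Euc d} {s : ℝ} (hs : ∀ p, ‖W p‖ ≤ s)
    {L : ℝ≥0} (hL : LipschitzWith L W) (x : Euc d) :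
    Uk κ ξ ε N k x * N * ‖((bk κ g ξ ε N k x, ak κ v ξ ε N k x + bk κ g ξ ε N k x • x) : ℝ × Euc d) - (1 / (N:ℝ)) • W ((k:ℝ)/N, x)‖ ^ 2
      ≤ 2 * (∫ p, ξ (x - p.2) * Dfun v g W ε L p ∂(Pk κ N k)) + 8 * ε * s ^ 2 / N := by
  have hU := S.U_pos k x
  have hN0 : (0:ℝ) < N := by exact_mod_cast S.hN
  have hε := S.hε
  haveI := S.H.finPk N k
  set U := Uk κ ξ ε N k x with hUd
  set w0 := W ((k:ℝ)/N, x) with hw0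
  set I0 := ∫ p, ξ (x - p.2) ∂(Pk κ N k) with hI0
  obtain ⟨m1, m2⟩ := S.xi_le hk x
  have iv := S.H.ivk N k
  have ig : Integrable (fun p => g p / 2) (Pk κ N k) := (S.H.igk N k).div_const 2
  have c0 : Integrable (fun p : XX d => ξ (x - p.2)) (Pk κ N k) := by
    simpa using conv_integrable S.hξ measurable_snd (integrable_const (μ := Pk κ N k) (1:ℝ)) x
  have ip : Integrable (fun p : XX d => ((g p / 2, v p + (g p / 2) • x) : ℝ × Euc d)) (Pk κ N k) :=
    ig.prodMk (iv.add (ig.smul_const x))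
  have ip2 : Integrable (fun p : XX d => ((g p / 2, v p + (g p / 2) • x) : ℝ × Euc d) - w0) (Pk κ N k) := ip.sub (integrable_const _)
  have ipc := conv_integrable S.hξ measurable_snd ip x
  have ip2c := conv_integrable S.hξ measurable_snd ip2 x
  have iD : Integrable (fun p => ξ (x - p.2) * Dfun v g W ε L p) (Pk κ N k) :=
    conv_integrable S.hξ measurable_snd ((S.H.iD hL.continuous hs ε L).restrict : Integrable _ (Pk κ N k)) x
  set G := ∫ p, ξ (x - p.2) • (((g p / 2, v p + (g p / 2) • x) : ℝ × Euc d) - w0) ∂(Pk κ N k) with hG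
  have e1 : ∫ p, ξ (x - p.2) • ((g p / 2, v p + (g p / 2) • x) : ℝ × Euc d) ∂(Pk κ N k)
      = U • ((bk κ g ξ ε N k x, ak κ v ξ ε N k x + bk κ g ξ ε N k x • x) : ℝ × Euc d) := by
    have hc1 := conv_integrable S.hξ measurable_snd ig x
    have hc2 := conv_integrable S.hξ measurable_snd iv x
    have : (fun p : XX d => ξ (x - p.2) • ((g p / 2, v p + (g p / 2) • x) : ℝ × Euc d)) =
        fun p => (ξ (x - p.2) • (g p / 2), ξ (x - p.2) • v p + (ξ (x - p.2) • (g p / 2)) • x) := by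
      funext p
      ext1
      · rfl
      · simp [smul_add, smul_smul]
    have hc3 : Integrable (fun p : XX d => ξ (x - p.2) • v p + (ξ (x - p.2) • (g p / 2)) • x) (Pk κ N k) := hc2.add (hc1.smul_const x)
    rw [this, integral_pair hc1 hc3, integral_add hc2 (hc1.smul_const x), integral_smul_const]
    have hb : bk κ g ξ ε N k x = (∫ p, ξ (x - p.2) • (g p / 2) ∂(Pk κ N k)) / U := rfl
    have ha : ak κ v ξ ε N k x = U⁻¹ • ∫ p, ξ (x - p.2) • v p ∂(Pk κ N k) := rfl
    rw [hb, ha]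
    ext1
    · simp; field_simp
    · simp only [Prod.smul_mk, smul_add, smul_smul]
      rw [mul_inv_cancel₀ hU.ne', one_smul, mul_div_cancel₀ _ hU.ne']
  have e2 : G = U • ((bk κ g ξ ε N k x, ak κ v ξ ε N k x + bk κ g ξ ε N k x • x) : ℝ × Euc d) - I0 • w0 := by
    rw [← e1, hG, hI0, ← integral_smul_const, ← integral_sub ipc (c0.smul_const w0)]
    congr 1; funext p
    rw [smul_sub]
  have bnd : ∀ᵐ p ∂(Pk κ N k), ξ (x - p.2) * ‖((g p / 2, v p + (g p / 2) • x) : ℝ × Euc d) - w0‖ ^ 2 ≤ ξ (x - p.2) * Dfun v g W ε L p := by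
    filter_upwards [S.ae_Pk k] with p hp
    by_cases hx : ξ (x - p.2) = 0
    · simp [hx]
    have hx2 := S.hξ.supp _ hx
    have d1 : ((g p / 2, v p + (g p / 2) • x) : ℝ × Euc d) - w0 = (phat v g p - W p) + ((0, (g p / 2) • (x - p.2)) + (W p - w0)) := by
      unfold phat
      have : ((0, (g p / 2) • (x - p.2)) : ℝ × Euc d) = (g p / 2, v p + (g p / 2) • x) - (g p / 2, v p + (g p / 2) • p.2) := by
        ext1
        · simp
        · simp [smul_sub]
      rw [this]; abel
    have d2 : ‖((0, (g p / 2) • (x - p.2)) : ℝ × Euc d)‖ ≤ |g p| * ε := by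
      rw [Prod.norm_mk, norm_zero, max_eq_right (norm_nonneg _), norm_smul]
      have : ‖g p / 2‖ ≤ |g p| := by
        rw [norm_div, Real.norm_eq_abs]; norm_num
      gcongr
    have d3 : ‖W p - w0‖ ≤ L * ε := by
      rw [← dist_eq_norm]
      refine (hL.dist_le_mul _ _).trans ?_
      gcongr
      rw [Prod.dist_eq]
      refine max_le ?_ ?_
      · rw [Real.dist_eq]; exact hp.2
      · rw [dist_comm, dist_eq_norm]; exact hx2.le
    have d4 : ‖((g p / 2, v p + (g p / 2) • x) : ℝ × Euc d) - w0‖ ≤ ‖phat v g p - W p‖ + ε * (|g p| + L) := by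
      rw [d1]
      refine (norm_add_le _ _).trans ?_
      gcongr
      refine (norm_add_le _ _).trans ?_
      linarith
    refine mul_le_mul_of_nonneg_left ?_ (S.hξ.nn _)
    unfold Dfun
    calc _ ≤ (‖phat v g p - W p‖ + ε * (|g p| + L)) ^ 2 := by gcongr
      _ ≤ _ := by nlinarith [sq_nonneg (‖phat v g p - W p‖ - ε * (|g p| + L))]
  have iG2 : Integrable (fun p : XX d => ξ (x - p.2) * ‖((g p / 2, v p + (g p / 2) • x) : ℝ × Euc d) - w0‖ ^ 2) (Pk κ N k) := by
    refine iD.mono' ?_ ?_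
    · have h1 : Measurable fun p : XX d => ξ (x - p.2) := S.hξ.cd.continuous.measurable.comp (measurable_const.sub measurable_snd)
      have := S.H.mg
      have := S.H.mv
      have h2 : Measurable fun p : XX d => ((g p / 2, v p + (g p / 2) • x) : ℝ × Euc d) - w0 := by fun_prop
      exact (h1.mul (h2.norm.pow_const 2)).aestronglyMeasurable
    · filter_upwards [bnd] with p hp
      rw [Real.norm_of_nonneg (mul_nonneg (S.hξ.nn _) (sq_nonneg _))]
      exact hp
  have cs := cs_weight (P := Pk κ N k) (w := fun p => ξ (x - p.2)) (fun p => S.hξ.nn _) c0 ip2c iG2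
  have cs2 : ‖G‖ ^ 2 ≤ U / N * ∫ p, ξ (x - p.2) * Dfun v g W ε L p ∂(Pk κ N k) := by
    refine cs.trans ?_
    refine mul_le_mul m1 (integral_mono_ae iG2 iD bnd) (integral_nonneg fun p => mul_nonneg (S.hξ.nn _) (sq_nonneg _)) (by positivity)
  set J := ∫ p, ξ (x - p.2) * Dfun v g W ε L p ∂(Pk κ N k) with hJ
  set Z := ((bk κ g ξ ε N k x, ak κ v ξ ε N k x + bk κ g ξ ε N k x • x) : ℝ × Euc d) with hZ
  have e3 : U • (Z - (1 / (N:ℝ)) • w0) = G + (I0 - U / N) • w0 := by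
    rw [e2, smul_sub, sub_smul, smul_smul]
    have : U * (1 / (N:ℝ)) = U / N := by ring
    rw [this]; abel
  have e4 : U * ‖Z - (1 / (N:ℝ)) • w0‖ ≤ ‖G‖ + 2 * ε / N * s := by
    have e30 : U * ‖Z - (1 / (N:ℝ)) • w0‖ = ‖U • (Z - (1 / (N:ℝ)) • w0)‖ := by rw [norm_smul, Real.norm_of_nonneg hU.le]
    rw [e30, e3]
    refine (norm_add_le _ _).trans ?_
    rw [norm_smul]
    have := hs ((k:ℝ)/N, x)
    gcongr
    exact m2
  have hUε : ε ≤ U := (S.H.stepHyp S.hξ ε N k).hUε x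
  have e5 : (U * ‖Z - (1 / (N:ℝ)) • w0‖) ^ 2 ≤ 2 * (U / N * J) + 2 * (2 * ε / N * s) ^ 2 := by
    calc _ ≤ (‖G‖ + 2 * ε / N * s) ^ 2 := by gcongr
      _ ≤ 2 * ‖G‖ ^ 2 + 2 * (2 * ε / N * s) ^ 2 := by nlinarith [sq_nonneg (‖G‖ - 2 * ε / N * s)]
      _ ≤ _ := by gcongr
  have e6 : U * N * ‖Z - (1 / (N:ℝ)) • w0‖ ^ 2 = (N / U) * (U * ‖Z - (1 / (N:ℝ)) • w0‖) ^ 2 := by field_simp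
  rw [e6]
  calc (N / U) * (U * ‖Z - (1 / (N:ℝ)) • w0‖) ^ 2 ≤ (N / U) * (2 * (U / N * J) + 2 * (2 * ε / N * s) ^ 2) := by gcongr
    _ = 2 * J + 8 * (ε / U) * ε * s ^ 2 / N := by field_simp; ring
    _ ≤ 2 * J + 8 * 1 * ε * s ^ 2 / N := by
      gcongr
      rw [div_le_one hU]; exact hUε
    _ = _ := by ring

theorem Sch.energy_pt2 (S : Sch v g κ R M ξ ε C N) {k : ℕ} (hk : k < N) (x : Euc d) :
    Uk κ ξ ε N k x * N * ‖bk κ g ξ ε N k x • ak κ v ξ ε N k x‖ ^ 2 ≤ ε * ∫ p, ξ (x - p.2) * |g p| ^ 2 ∂(Pk κ N k) := by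
  have hU := S.U_pos k x
  have hN0 : (0:ℝ) < N := by exact_mod_cast S.hN
  have hε := S.hε
  haveI := S.H.finPk N k
  obtain ⟨m1, m2⟩ := S.xi_le hk x
  have ig := S.H.igk N k
  have c0 : Integrable (fun p : XX d => ξ (x - p.2)) (Pk κ N k) := by
    simpa using conv_integrable S.hξ measurable_snd (integrable_const (μ := Pk κ N k) (1:ℝ)) x
  have i2 : Integrable (fun p => |g p| ^ 2) (Pk κ N k) := by
    have : Integrable (fun p => (|g p| + 0) ^ 2) (Pk κ N k) := (S.H.iq 0).restrict
    simpa only [add_zero] using this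
  have i2c : Integrable (fun p : XX d => ξ (x - p.2) * |g p| ^ 2) (Pk κ N k) := conv_integrable S.hξ measurable_snd i2 x
  have cs := cs_weight (P := Pk κ N k) (w := fun p => ξ (x - p.2)) (f := g) (fun p => S.hξ.nn _) c0 (conv_integrable S.hξ measurable_snd ig x) i2c
  set J := ∫ p, ξ (x - p.2) * |g p| ^ 2 ∂(Pk κ N k) with hJ
  have hJ0 : 0 ≤ J := integral_nonneg fun p => mul_nonneg (S.hξ.nn _) (sq_nonneg _)
  have hB : ∫ p, ξ (x - p.2) • g p ∂(Pk κ N k) = 2 * Bk κ g ξ N k x := by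
    unfold Bk conv
    rw [← integral_const_mul]
    congr 1; funext p; simp; ring
  have cs2 : (2 * Bk κ g ξ N k x) ^ 2 ≤ Uk κ ξ ε N k x / N * J := by
    rw [hB, Real.norm_eq_abs, sq_abs] at cs
    refine cs.trans ?_
    have : (∫ p, ξ (x - p.2) * ‖g p‖ ^ 2 ∂(Pk κ N k)) = J := rfl
    rw [this]
    gcongr
  have ha := S.ha k hk x
  set U := Uk κ ξ ε N k x with hUd
  rw [norm_smul, mul_pow, Real.norm_eq_abs, sq_abs]
  have hb : bk κ g ξ ε N k x = Bk κ g ξ N k x / U := rfl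
  rw [hb]
  calc U * N * ((Bk κ g ξ N k x / U) ^ 2 * ‖ak κ v ξ ε N k x‖ ^ 2) ≤ U * N * ((Bk κ g ξ N k x / U) ^ 2 * ε) := by gcongr
    _ = N / U * ((2 * Bk κ g ξ N k x) ^ 2 / 4) * ε := by field_simp; ring
    _ ≤ N / U * ((U / N * J) / 4) * ε := by gcongr
    _ = ε * J / 4 := by field_simp
    _ ≤ ε * J := by
      have : 0 ≤ ε * J := by positivity
      linarith
end
end

section
open ProbabilityTheory

section
variable {v : XX d → Euc d} {g : XX d → ℝ} {κ : Kernel ℝ (Euc d)} {R M : ℝ} {ξ : Euc d → ℝ} {ε C : ℝ} {N : ℕ}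

def evec (κ : Kernel ℝ (Euc d)) (v : XX d → Euc d) (g : XX d → ℝ) (ξ : Euc d → ℝ) (ε : ℝ) (N k : ℕ) (x : Euc d) : ℝ × Euc d :=
  (bk κ g ξ ε N k x, ak κ v ξ ε N k x + bk κ g ξ ε N k x • x + bk κ g ξ ε N k x • ak κ v ξ ε N k x)

def zk (κ : Kernel ℝ (Euc d)) (v : XX d → Euc d) (g : XX d → ℝ) (ξ : Euc d → ℝ) (ε : ℝ) (N k : ℕ) (x : Euc d) : ℝ × Euc d :=
  (rk κ v g ξ ε N k x, rk κ v g ξ ε N k x • Xk κ v ξ ε N k x)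

def Dk (κ : Kernel ℝ (Euc d)) (v : XX d → Euc d) (g : XX d → ℝ) (ξ : Euc d → ℝ) (ε : ℝ) (N k : ℕ) (x : Euc d) : ℝ × Euc d :=
  zk κ v g ξ ε N (k+1) x - zk κ v g ξ ε N k x

def mu0 (κ : Kernel ℝ (Euc d)) (ξ : Euc d → ℝ) : Measure (Euc d) := volume.withDensity fun x => ENNReal.ofReal (Vk κ ξ 0 x)

theorem Dk_eq (k : ℕ) (x : Euc d) : Dk κ v g ξ ε N k x = rk κ v g ξ ε N k x • evec κ v g ξ ε N k (Xk κ v ξ ε N k x) := by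
  unfold Dk zk evec
  ext1
  · simp [rk]; ring
  · simp only [rk, Xk, Prod.snd_sub, Prod.smul_mk]
    module

def Ffun (v : XX d → Euc d) (g : XX d → ℝ) (W : XX d → ℝ × Euc d) (ε L : ℝ) (p : XX d) : ℝ :=
  4 * Dfun v g W ε L p + 2 * ε * |g p| ^ 2

theorem Sch.energy_pt (S : Sch v g κ R M ξ ε C N) {k : ℕ} (hk : k < N) {W : XX d → ℝ × Euc d} {s : ℝ} (hs : ∀ p, ‖W p‖ ≤ s)
    {L : ℝ≥0} (hL : LipschitzWith L W) (x : Euc d) :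
    Uk κ ξ ε N k x * N * ‖evec κ v g ξ ε N k x - (1 / (N:ℝ)) • W ((k:ℝ)/N, x)‖ ^ 2
      ≤ (∫ p, ξ (x - p.2) * Ffun v g W ε L p ∂(Pk κ N k)) + 16 * ε * s ^ 2 / N := by
  have h1 := S.energy_pt1 hk hs hL x
  have h2 := S.energy_pt2 hk x
  haveI := S.H.finPk N k
  have iD : Integrable (fun p => ξ (x - p.2) * Dfun v g W ε L p) (Pk κ N k) :=
    conv_integrable S.hξ measurable_snd ((S.H.iD hL.continuous hs ε L).restrict : Integrable _ (Pk κ N k)) x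
  have i2 : Integrable (fun p => |g p| ^ 2) (Pk κ N k) := by
    have : Integrable (fun p => (|g p| + 0) ^ 2) (Pk κ N k) := (S.H.iq 0).restrict
    simpa only [add_zero] using this
  have i2c : Integrable (fun p : XX d => ξ (x - p.2) * |g p| ^ 2) (Pk κ N k) := conv_integrable S.hξ measurable_snd i2 x
  have e : ∫ p, ξ (x - p.2) * Ffun v g W ε L p ∂(Pk κ N k) = 4 * (∫ p, ξ (x - p.2) * Dfun v g W ε L p ∂(Pk κ N k))
      + 2 * ε * ∫ p, ξ (x - p.2) * |g p| ^ 2 ∂(Pk κ N k) := by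
    rw [← integral_const_mul, ← integral_const_mul, ← integral_add (iD.const_mul _) (i2c.const_mul _)]
    congr 1; funext p; unfold Ffun; ring
  rw [e]
  have hU := S.U_pos k x
  have hN0 : (0:ℝ) < N := by exact_mod_cast S.hN
  have es : evec κ v g ξ ε N k x - (1 / (N:ℝ)) • W ((k:ℝ)/N, x) =
     (((bk κ g ξ ε N k x, ak κ v ξ ε N k x + bk κ g ξ ε N k x • x) : ℝ × Euc d) - (1 / (N:ℝ)) • W ((k:ℝ)/N, x)) +
      (0, bk κ g ξ ε N k x • ak κ v ξ ε N k x) := by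
    unfold evec
    have : ((bk κ g ξ ε N k x, ak κ v ξ ε N k x + bk κ g ξ ε N k x • x + bk κ g ξ ε N k x • ak κ v ξ ε N k x) : ℝ × Euc d)
      = ((bk κ g ξ ε N k x, ak κ v ξ ε N k x + bk κ g ξ ε N k x • x) : ℝ × Euc d) + (0, bk κ g ξ ε N k x • ak κ v ξ ε N k x) := by
      ext1 <;> simp
    rw [this]; abel
  rw [es]
  set P := ((bk κ g ξ ε N k x, ak κ v ξ ε N k x + bk κ g ξ ε N k x • x) : ℝ × Euc d) - (1 / (N:ℝ)) • W ((k:ℝ)/N, x)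
  set Q := bk κ g ξ ε N k x • ak κ v ξ ε N k x
  have hq : ‖P + (0, Q)‖ ^ 2 ≤ 2 * ‖P‖ ^ 2 + 2 * ‖Q‖ ^ 2 := by
    have hh : ‖P + (0, Q)‖ ≤ ‖P‖ + ‖Q‖ := by
      refine (norm_add_le _ _).trans ?_
      have h0 : ‖((0, Q) : ℝ × Euc d)‖ = ‖Q‖ := by rw [Prod.norm_mk, norm_zero, max_eq_right (norm_nonneg _)]
      rw [h0]
    calc _ ≤ (‖P‖ + ‖Q‖) ^ 2 := by gcongr
      _ ≤ _ := by nlinarith [sq_nonneg (‖P‖ - ‖Q‖)]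
  calc _ ≤ Uk κ ξ ε N k x * N * (2 * ‖P‖ ^ 2 + 2 * ‖Q‖ ^ 2) := by gcongr
    _ = 2 * (Uk κ ξ ε N k x * N * ‖P‖ ^ 2) + 2 * (Uk κ ξ ε N k x * N * ‖Q‖ ^ 2) := by ring
    _ ≤ _ := by
      have : 16 * ε * s ^ 2 / N = 2 * (8 * ε * s ^ 2 / N) := by ring
      rw [this]
      linarith

theorem Sch.cont_U (S : Sch v g κ R M ξ ε C N) (k : ℕ) : Continuous (Uk κ ξ ε N k) :=
  continuous_iff_continuousAt.2 fun x => ((S.H.stepHyp S.hξ ε N k).hU x).continuousAt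

theorem Sch.cont_a (S : Sch v g κ R M ξ ε C N) (k : ℕ) : Continuous (ak κ v ξ ε N k) := by
  have h1 : Continuous (Ak κ v ξ N k) := continuous_iff_continuousAt.2 fun x => ((S.H.stepHyp S.hξ ε N k).hA x).continuousAt
  exact ((S.cont_U k).inv₀ fun x => (S.U_pos k x).ne').smul h1

theorem Sch.cont_b (S : Sch v g κ R M ξ ε C N) (k : ℕ) : Continuous (bk κ g ξ ε N k) := by
  have h1 : Continuous (Bk κ g ξ N k) := continuous_iff_continuousAt.2 fun x =>
    (conv_hasFDerivAt S.hξ measurable_snd ((S.H.igk N k).div_const 2) x).continuousAt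
  exact h1.div (S.cont_U k) fun x => (S.U_pos k x).ne'

theorem Sch.cont_X (S : Sch v g κ R M ξ ε C N) (k : ℕ) : Continuous (Xk κ v ξ ε N k) := by
  induction k with
  | zero => exact continuous_id
  | succ k ih => exact ih.add ((S.cont_a k).comp ih)

theorem Sch.cont_r (S : Sch v g κ R M ξ ε C N) (k : ℕ) : Continuous (rk κ v g ξ ε N k) := by
  induction k with
  | zero => exact continuous_const
  | succ k ih => exact ih.mul (continuous_const.add ((S.cont_b k).comp (S.cont_X k)))

theorem Sch.cont_z (S : Sch v g κ R M ξ ε C N) (k : ℕ) : Continuous (zk κ v g ξ ε N k) :=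
  (S.cont_r k).prodMk ((S.cont_r k).smul (S.cont_X k))

theorem Sch.r_pos (S : Sch v g κ R M ξ ε C N) (x : Euc d) : ∀ k ≤ N, 0 < rk κ v g ξ ε N k x := by
  intro k
  induction k with
  | zero => intro _; exact one_pos
  | succ k ih =>
    intro hk
    have := abs_le.1 (S.hb k (by omega) (Xk κ v ξ ε N k x))
    exact mul_pos (ih (by omega)) (by linarith [this.1])

theorem Sch.a_zero (S : Sch v g κ R M ξ ε C N) (k : ℕ) {x : Euc d} (hx : R + 1 ≤ ‖x‖) : ak κ v ξ ε N k x = 0 := by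
  have : Ak κ v ξ N k x = 0 := by
    unfold Ak conv
    refine integral_eq_zero_of_ae ?_
    filter_upwards [S.ae_Pk k] with p hp
    have : ξ (x - p.2) = 0 := by
      by_contra h
      have h1 := S.hξ.supp _ h
      have h2 := norm_sub_norm_le x p.2
      linarith [hp.1, S.hε1]
    simp [this]
  unfold ak
  rw [this, smul_zero]

theorem Sch.X_bd (S : Sch v g κ R M ξ ε C N) {x : Euc d} (hx : ‖x‖ < R + 1) : ∀ k ≤ N, ‖Xk κ v ξ ε N k x‖ < R + 2 := by
  intro k
  induction k with
  | zero => intro _; show ‖x‖ < _; linarith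
  | succ k ih =>
    intro hk
    have ih := ih (by omega)
    show ‖Xk κ v ξ ε N k x + ak κ v ξ ε N k (Xk κ v ξ ε N k x)‖ < _
    by_cases h : R + 1 ≤ ‖Xk κ v ξ ε N k x‖
    · rw [S.a_zero k h, add_zero]; exact ih
    · have h1 := S.ha k (by omega) (Xk κ v ξ ε N k x)
      have h2 : ‖ak κ v ξ ε N k (Xk κ v ξ ε N k x)‖ ≤ 1 := by
        have := S.hε1
        nlinarith [norm_nonneg (ak κ v ξ ε N k (Xk κ v ξ ε N k x))]
      linarith [norm_add_le (Xk κ v ξ ε N k x) (ak κ v ξ ε N k (Xk κ v ξ ε N k x)), not_le.1 h]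

theorem Sch.V_zero (S : Sch v g κ R M ξ ε C N) (t : ℝ) {x : Euc d} (hx : R + 1 ≤ ‖x‖) : Vk κ ξ t x = 0 := by
  unfold Vk conv
  refine integral_eq_zero_of_ae ?_
  have : ∀ᵐ y ∂(κ t), y ∈ Metric.ball 0 R := by
    rw [ae_iff]; exact S.H.supp t
  filter_upwards [this] with p hp
  have : ξ (x - p) = 0 := by
    by_contra h
    have h1 := S.hξ.supp _ h
    have h2 := norm_sub_norm_le x p
    rw [mem_ball_zero_iff] at hp
    linarith [S.hε1]
  simp [this]

theorem Sch.cont_V (S : Sch v g κ R M ξ ε C N) : Continuous (Vk κ ξ 0) := by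
  have h1 := S.cont_U 0
  have : Vk κ ξ 0 = fun x => Uk κ ξ ε N 0 x - ε := by funext x; simp [Uk]
  rw [this]; exact h1.sub continuous_const

theorem Sch.mu0_univ (S : Sch v g κ R M ξ ε C N) : mu0 κ ξ univ = κ 0 univ := by
  haveI := S.H.fin
  unfold mu0
  rw [withDensity_apply _ MeasurableSet.univ, Measure.restrict_univ]
  have := tonelli_xi S.hξ (P := κ 0) measurable_id (measurable_const (a := (1:ℝ))) (fun _ => zero_le_one) (integrable_const _)
  simp only [integral_const, smul_eq_mul, mul_one] at this
  have e : ∀ x, Vk κ ξ 0 x = ∫ p, ξ (x - id p) ∂(κ 0) := by intro x; simp [Vk, conv]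
  simp only [e, this]
  simp [Measure.real]

theorem Sch.mu0_ae (S : Sch v g κ R M ξ ε C N) : ∀ᵐ x ∂(mu0 κ ξ), ‖x‖ < R + 1 := by
  unfold mu0
  rw [ae_withDensity_iff S.cont_V.measurable.ennreal_ofReal]
  refine Eventually.of_forall fun x hx => ?_
  by_contra h
  rw [S.V_zero 0 (not_lt.1 h)] at hx
  simp at hx

theorem Sch.dom0 (S : Sch v g κ R M ξ ε C N) {k : ℕ} (hk : k ≤ N) {ψ : Euc d → ℝ≥0∞} (mψ : Measurable ψ) :
    ∫⁻ x, ψ (Xk κ v ξ ε N k x) * ENNReal.ofReal (rk κ v g ξ ε N k x ^ 2) ∂(mu0 κ ξ)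
    ≤ ENNReal.ofReal (1 + ε) * ∫⁻ x in Metric.ball 0 (R + 2), ψ x * ENNReal.ofReal (Uk κ ξ ε N k x) := by
  unfold mu0
  have mm : Measurable fun x => ψ (Xk κ v ξ ε N k x) * ENNReal.ofReal (rk κ v g ξ ε N k x ^ 2) :=
    ((mψ.comp (S.cont_X k).measurable).mul ((S.cont_r k).measurable.pow_const 2).ennreal_ofReal)
  rw [lintegral_withDensity_eq_lintegral_mul _ S.cont_V.measurable.ennreal_ofReal mm]
  have h := S.dom k hk ((Metric.ball 0 (R+2)).indicator ψ)
  rw [← lintegral_indicator Metric.isOpen_ball.measurableSet]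
  refine le_trans (lintegral_mono fun x => ?_) (h.trans (le_of_eq ?_))
  · show ENNReal.ofReal (Vk κ ξ 0 x) * (ψ (Xk κ v ξ ε N k x) * ENNReal.ofReal (rk κ v g ξ ε N k x ^ 2)) ≤ _
    by_cases hx : ‖x‖ < R + 1
    · have : Xk κ v ξ ε N k x ∈ Metric.ball (0 : Euc d) (R+2) := by
        rw [mem_ball_zero_iff]; exact S.X_bd hx k hk
      rw [Set.indicator_of_mem this, mul_comm]
      gcongr
      simp [Uk, S.hε.le]
    · rw [S.V_zero 0 (not_lt.1 hx)]; simp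
  · congr 1
    congr 1; funext x
    by_cases hx : x ∈ Metric.ball (0 : Euc d) (R+2)
    · simp only [Set.indicator_of_mem hx]
    · simp only [Set.indicator_of_notMem hx, zero_mul]

def VB (d : ℕ) (R : ℝ) : ℝ := (volume (Metric.ball (0 : Euc d) (R + 2))).toReal

theorem VB_eq (d : ℕ) (R : ℝ) : volume (Metric.ball (0 : Euc d) (R + 2)) = ENNReal.ofReal (VB d R) := by
  unfold VB
  rw [ENNReal.ofReal_toReal measure_ball_lt_top.ne]

theorem VB_nonneg (d : ℕ) (R : ℝ) : 0 ≤ VB d R := ENNReal.toReal_nonneg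

theorem Sch.energy (S : Sch v g κ R M ξ ε C N) {W : XX d → ℝ × Euc d} {s : ℝ} (hs : ∀ p, ‖W p‖ ≤ s)
    {L : ℝ≥0} (hL : LipschitzWith L W) :
    ∑ k ∈ Finset.range N, ∫⁻ x, ENNReal.ofReal (N * ‖Dk κ v g ξ ε N k x - (rk κ v g ξ ε N k x / N) • W ((k:ℝ)/N, Xk κ v ξ ε N k x)‖ ^ 2) ∂(mu0 κ ξ)
    ≤ ENNReal.ofReal (16 * (∫ p, ‖phat v g p - W p‖ ^ 2 ∂(PP κ)) + ε * (16 * (∫ p, (|g p| + L) ^ 2 ∂(PP κ))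
       + 4 * (∫ p, (|g p| + 0) ^ 2 ∂(PP κ)) + 32 * s ^ 2 * VB d R)) := by
  have hN0 : (0:ℝ) < N := by exact_mod_cast S.hN
  have hε := S.hε
  have hVB := VB_nonneg d R
  have i2 : Integrable (fun p => (|g p| + 0) ^ 2) (PP κ) := S.H.iq 0
  have iF : Integrable (Ffun v g W ε L) (PP κ) := by
    have : Integrable (fun p => 4 * Dfun v g W ε L p + 2 * ε * (|g p| + 0) ^ 2) (PP κ) :=
      ((S.H.iD hL.continuous hs ε L).const_mul 4).add (i2.const_mul _)
    simp only [add_zero] at this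
    exact this
  have F0 : ∀ p, 0 ≤ Ffun v g W ε L p := by intro p; unfold Ffun Dfun; positivity
  have mF : Measurable (Ffun v g W ε L) := by
    have := S.H.mD hL.continuous ε L
    have := S.H.mg
    unfold Ffun; fun_prop
  have per : ∀ k ∈ Finset.range N, ∫⁻ x, ENNReal.ofReal (N * ‖Dk κ v g ξ ε N k x - (rk κ v g ξ ε N k x / N) • W ((k:ℝ)/N, Xk κ v ξ ε N k x)‖ ^ 2) ∂(mu0 κ ξ)
      ≤ ENNReal.ofReal (2 * ((∫ p, Ffun v g W ε L p ∂(Pk κ N k)) + 16 * ε * s ^ 2 / N * VB d R)) := by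
    intro k hk
    rw [Finset.mem_range] at hk
    haveI := S.H.finPk N k
    set ψ : Euc d → ℝ≥0∞ := fun x => ENNReal.ofReal (N * ‖evec κ v g ξ ε N k x - (1 / (N:ℝ)) • W ((k:ℝ)/N, x)‖ ^ 2) with hψ
    have mψ : Measurable ψ := by
      have := S.cont_a k
      have := S.cont_b k
      have := hL.continuous
      have h : Continuous (evec κ v g ξ ε N k) := by unfold evec; fun_prop
      apply Measurable.ennreal_ofReal
      apply Continuous.measurable
      fun_prop
    have e1 : ∀ x, ENNReal.ofReal (N * ‖Dk κ v g ξ ε N k x - (rk κ v g ξ ε N k x / N) • W ((k:ℝ)/N, Xk κ v ξ ε N k x)‖ ^ 2)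
        = ψ (Xk κ v ξ ε N k x) * ENNReal.ofReal (rk κ v g ξ ε N k x ^ 2) := by
      intro x
      rw [hψ]
      simp only
      rw [← ENNReal.ofReal_mul (by positivity), Dk_eq]
      congr 1
      have : (rk κ v g ξ ε N k x / N) • W ((k:ℝ)/N, Xk κ v ξ ε N k x) = rk κ v g ξ ε N k x • ((1 / (N:ℝ)) • W ((k:ℝ)/N, Xk κ v ξ ε N k x)) := by
        rw [smul_smul]; congr 1; ring
      rw [this, ← smul_sub, norm_smul, mul_pow, Real.norm_eq_abs, sq_abs]
      ring
    simp only [e1]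
    refine (S.dom0 hk.le mψ).trans ?_
    have e2 : ∀ x, ψ x * ENNReal.ofReal (Uk κ ξ ε N k x) ≤ ENNReal.ofReal (∫ p, ξ (x - p.2) * Ffun v g W ε L p ∂(Pk κ N k)) + ENNReal.ofReal (16 * ε * s ^ 2 / N) := by
      intro x
      rw [hψ]
      simp only
      rw [← ENNReal.ofReal_mul (by positivity), ← ENNReal.ofReal_add (integral_nonneg fun p => mul_nonneg (S.hξ.nn _) (F0 p)) (by positivity)]
      apply ENNReal.ofReal_le_ofReal
      refine le_trans (le_of_eq ?_) (S.energy_pt hk hs hL x)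
      ring
    have e3 : ∫⁻ x in Metric.ball 0 (R + 2), ψ x * ENNReal.ofReal (Uk κ ξ ε N k x) ≤
        ENNReal.ofReal (∫ p, Ffun v g W ε L p ∂(Pk κ N k)) + ENNReal.ofReal (16 * ε * s ^ 2 / N) * ENNReal.ofReal (VB d R) := by
      refine (lintegral_mono e2).trans ?_
      rw [lintegral_add_right _ measurable_const, lintegral_const, Measure.restrict_apply_univ, VB_eq]
      gcongr
      refine (setLIntegral_le_lintegral _ _).trans (le_of_eq ?_)
      exact tonelli_xi S.hξ measurable_snd mF F0 iF.restrict
    calc _ ≤ ENNReal.ofReal 2 * (ENNReal.ofReal (∫ p, Ffun v g W ε L p ∂(Pk κ N k)) + ENNReal.ofReal (16 * ε * s ^ 2 / N) * ENNReal.ofReal (VB d R)) := by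
          refine mul_le_mul' (ENNReal.ofReal_le_ofReal (by linarith [S.hε1])) e3
      _ = _ := by
        rw [← ENNReal.ofReal_mul (by positivity), ← ENNReal.ofReal_add (integral_nonneg F0) (by positivity), ← ENNReal.ofReal_mul (by positivity)]
  refine (Finset.sum_le_sum per).trans ?_
  rw [← ENNReal.ofReal_sum_of_nonneg]
  · apply ENNReal.ofReal_le_ofReal
    rw [← Finset.mul_sum, Finset.sum_add_distrib, Finset.sum_const, Finset.card_range, nsmul_eq_mul]
    have h1 := sum_Pk_integral κ N N _ F0 iF
    have h2 : ∫ p, Ffun v g W ε L p ∂(PP κ) = 8 * (∫ p, ‖phat v g p - W p‖ ^ 2 ∂(PP κ)) + 8 * ε ^ 2 * (∫ p, (|g p| + L) ^ 2 ∂(PP κ))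
        + 2 * ε * ∫ p, (|g p| + 0) ^ 2 ∂(PP κ) := by
      rw [← integral_const_mul, ← integral_const_mul, ← integral_const_mul]
      have a1 := (S.H.iW hL.continuous hs).const_mul 8
      have a2 := (S.H.iq L).const_mul (8 * ε ^ 2)
      have a3 := i2.const_mul (2 * ε)
      have a12 : Integrable (fun p => 8 * ‖phat v g p - W p‖ ^ 2 + 8 * ε ^ 2 * (|g p| + L) ^ 2) (PP κ) := a1.add a2
      rw [← integral_add a1 a2, ← integral_add a12 a3]
      congr 1; funext p; simp only [Ffun, Dfun]; ring
    have h3 : (N:ℝ) * (16 * ε * s ^ 2 / N * VB d R) = 16 * ε * s ^ 2 * VB d R := by field_simp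
    have h4 : 0 ≤ ∫ p, (|g p| + L) ^ 2 ∂(PP κ) := integral_nonneg fun p => by positivity
    have h5 : ε ^ 2 * (∫ p, (|g p| + L) ^ 2 ∂(PP κ)) ≤ ε * (∫ p, (|g p| + L) ^ 2 ∂(PP κ)) := by
      gcongr; nlinarith [S.hε1]
    rw [h3]
    rw [h2] at h1
    nlinarith
  · intro k _
    have : 0 ≤ ∫ p, Ffun v g W ε L p ∂(Pk κ N k) := integral_nonneg F0
    positivity
end
end

section
open ProbabilityTheory

section
variable {E : Type*} [NormedAddCommGroup E] [NormedSpace ℝ E]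

def pl (N : ℕ) (z : ℕ → E) (t : ℝ) : E := z 0 + ∑ k ∈ Finset.range N, clamp (N * t - k) • (z (k+1) - z k)

theorem clamp_of_ge {u : ℝ} (h : 1 ≤ u) : clamp u = 1 := by
  unfold clamp; rw [min_eq_left h]; norm_num

theorem clamp_of_le {u : ℝ} (h : u ≤ 0) : clamp u = 0 := by
  unfold clamp; rw [min_eq_right (by linarith)]; exact max_eq_left h

theorem pl_seg {N : ℕ} (hN : 1 ≤ N) (z : ℕ → E) {k : ℕ} (hk : k < N) {t : ℝ} (ht : t ∈ Icc ((k:ℝ)/N) (((k+1:ℕ):ℝ)/N)) :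
    pl N z t = z k + (N * t - k) • (z (k+1) - z k) ∧ 0 ≤ N * t - k ∧ N * t - k ≤ 1 := by
  have hN0 : (0:ℝ) < N := by exact_mod_cast hN
  have h1 : (k:ℝ) ≤ N * t := by have := ht.1; rw [div_le_iff₀ hN0] at this; linarith
  have h2 : N * t ≤ k + 1 := by have := ht.2; rw [le_div_iff₀ hN0] at this; push_cast at this; linarith
  refine ⟨?_, by linarith, by linarith⟩
  unfold pl
  rw [← Finset.sum_subset (Finset.range_subset_range.2 (show k + 1 ≤ N by omega)), Finset.sum_range_succ]
  · rw [clamp_eq ⟨by linarith, by linarith⟩, Finset.sum_congr rfl (g := fun i => z (i+1) - z i), Finset.sum_range_sub]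
    · abel
    · intro i hi
      rw [Finset.mem_range] at hi
      rw [clamp_of_ge, one_smul]
      have : (i:ℝ) + 1 ≤ k := by exact_mod_cast hi
      linarith
  · intro i _ hi
    rw [Finset.mem_range, not_lt] at hi
    rw [clamp_of_le, zero_smul]
    have : (k:ℝ) + 1 ≤ i := by exact_mod_cast hi
    linarith

theorem pl_node {N : ℕ} (hN : 1 ≤ N) (z : ℕ → E) {j : ℕ} (hj : j ≤ N) : pl N z ((j:ℝ)/N) = z j := by
  have hN0 : (0:ℝ) < N := by exact_mod_cast hN
  rcases hj.lt_or_eq with h | h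
  · rw [(pl_seg hN z h (t := (j:ℝ)/N) ⟨le_rfl, by gcongr; omega⟩).1]
    have : (N:ℝ) * (j/N) - j = 0 := by field_simp; ring
    rw [this, zero_smul, add_zero]
  · subst h
    have e := pl_seg hN z (k := j - 1) (by omega) (t := (j:ℝ)/j) ⟨by gcongr; omega, by gcongr; omega⟩
    rw [e.1]
    have h1 : j - 1 + 1 = j := by omega
    have : (j:ℝ) * (j/j) - ((j - 1 : ℕ):ℝ) = 1 := by
      rw [Nat.cast_sub hN]; field_simp; push_cast; ring
    rw [this, one_smul, h1]; abel

theorem exists_seg {N : ℕ} (hN : 1 ≤ N) {t : ℝ} (ht : t ∈ Icc (0:ℝ) 1) : ∃ k < N, t ∈ Icc ((k:ℝ)/N) (((k+1:ℕ):ℝ)/N) := by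
  have hN0 : (0:ℝ) < N := by exact_mod_cast hN
  rcases ht.2.lt_or_eq with h | h
  · refine ⟨⌊N * t⌋₊, ?_, ?_, ?_⟩
    · rw [Nat.floor_lt (by have := ht.1; positivity)]; nlinarith
    · rw [div_le_iff₀ hN0, mul_comm]; exact Nat.floor_le (by have := ht.1; positivity)
    · rw [le_div_iff₀ hN0, mul_comm]; push_cast; exact (Nat.lt_floor_add_one _).le
  · refine ⟨N - 1, by omega, ?_, ?_⟩
    · rw [h, div_le_one hN0]; exact_mod_cast (by omega : N - 1 ≤ N)
    · rw [h, le_div_iff₀ hN0, one_mul]; exact_mod_cast (by omega : N ≤ N - 1 + 1)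

theorem sum_clamp (u : ℝ) (n : ℕ) : ∑ k ∈ Finset.range n, clamp (u - k) = max 0 (min (n:ℝ) u) := by
  induction n with
  | zero => simp
  | succ n ih =>
    rw [Finset.sum_range_succ, ih]
    unfold clamp
    push_cast
    have hn : (0:ℝ) ≤ n := by positivity
    rcases le_total u 0 with h1 | h1
    · rw [min_eq_right (by linarith : u ≤ n), min_eq_right (by linarith : u - n ≤ 1), min_eq_right (by linarith : u ≤ n+1), max_eq_left h1,
        max_eq_left (by linarith)]; ring
    · rcases le_total u n with h2 | h2
      · rw [min_eq_right h2, min_eq_right (by linarith : u - n ≤ 1), min_eq_right (by linarith : u ≤ n+1), max_eq_right h1,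
          max_eq_left (by linarith)]; ring
      · rcases le_total u (n+1) with h3 | h3
        · rw [min_eq_left h2, min_eq_right (by linarith : u - n ≤ 1), min_eq_right (by linarith : u ≤ n+1), max_eq_right h1,
            max_eq_right (by linarith), max_eq_right (by linarith)]; ring
        · rw [min_eq_left h2, min_eq_left (by linarith : 1 ≤ u - n), min_eq_left (by linarith : (n:ℝ)+1 ≤ u), max_eq_right (by linarith),
            max_eq_right (by linarith), max_eq_right (by linarith)]

theorem clamp_mono : Monotone clamp := by
  intro a b h; unfold clamp; gcongr

theorem cs_fin (n : ℕ) (c : ℕ → ℝ) (hc : ∀ k, 0 ≤ c k) (x : ℕ → E) :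
    ‖∑ k ∈ Finset.range n, c k • x k‖ ^ 2 ≤ (∑ k ∈ Finset.range n, c k) * ∑ k ∈ Finset.range n, c k * ‖x k‖ ^ 2 := by
  have h1 : ‖∑ k ∈ Finset.range n, c k • x k‖ ≤ ∑ k ∈ Finset.range n, c k * ‖x k‖ := by
    refine (norm_sum_le _ _).trans (Finset.sum_le_sum fun k _ => ?_)
    rw [norm_smul, Real.norm_of_nonneg (hc k)]
  calc _ ≤ (∑ k ∈ Finset.range n, c k * ‖x k‖) ^ 2 := by gcongr
    _ ≤ _ := Finset.sum_sq_le_sum_mul_sum_of_sq_eq_mul _ (fun k _ => hc k) (fun k _ => mul_nonneg (hc k) (sq_nonneg _)) (fun k _ => by ring)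

theorem pl_holder {N : ℕ} (z : ℕ → E) (s t : ℝ) :
    ‖pl N z t - pl N z s‖ ^ 2 ≤ |t - s| * (N * ∑ k ∈ Finset.range N, ‖z (k+1) - z k‖ ^ 2) := by
  wlog hst : s ≤ t generalizing s t
  · rw [norm_sub_rev, abs_sub_comm]; exact this t s (not_le.1 hst).le
  have e : pl N z t - pl N z s = ∑ k ∈ Finset.range N, (clamp (N * t - k) - clamp (N * s - k)) • (z (k+1) - z k) := by
    unfold pl
    rw [add_sub_add_left_eq_sub, ← Finset.sum_sub_distrib]
    exact Finset.sum_congr rfl fun k _ => by rw [sub_smul]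
  have hN0 : (0:ℝ) ≤ N := by positivity
  have hc : ∀ k : ℕ, 0 ≤ clamp (N * t - k) - clamp (N * s - k) := fun k => sub_nonneg.2 (clamp_mono (by gcongr))
  rw [e]
  refine (cs_fin N (fun k => clamp (N * t - k) - clamp (N * s - k)) hc (fun k => z (k+1) - z k)).trans ?_
  have h1 : ∑ k ∈ Finset.range N, (clamp (N * t - k) - clamp (N * s - k)) ≤ N * |t - s| := by
    rw [Finset.sum_sub_distrib, sum_clamp, sum_clamp, abs_of_nonneg (by linarith)]
    have a : |max 0 (min (N:ℝ) (N * t)) - max 0 (min (N:ℝ) (N * s))| ≤ |N * t - N * s| :=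
      (abs_max_sub_max_le_max 0 _ 0 _).trans (max_le (by simp) ((abs_min_sub_min_le_max (N:ℝ) _ N _).trans (max_le (by simp) le_rfl)))
    have b : |N * t - N * s| = N * (t - s) := by rw [← mul_sub, abs_of_nonneg (by nlinarith)]
    exact (le_abs_self _).trans (b ▸ a)
  have h2 : ∑ k ∈ Finset.range N, (clamp (N * t - k) - clamp (N * s - k)) * ‖z (k+1) - z k‖ ^ 2 ≤ ∑ k ∈ Finset.range N, ‖z (k+1) - z k‖ ^ 2 := by
    refine Finset.sum_le_sum fun k _ => ?_
    have := (clamp_mem (N * t - k)).2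
    have := (clamp_mem (N * s - k)).1
    refine mul_le_of_le_one_left (by positivity) (by linarith)
  calc _ ≤ (N * |t - s|) * ∑ k ∈ Finset.range N, ‖z (k+1) - z k‖ ^ 2 := by
        refine mul_le_mul h1 h2 (Finset.sum_nonneg fun k _ => mul_nonneg (hc k) (sq_nonneg _)) (by positivity)
    _ = _ := by ring
end

section
variable {F : Type*} [NormedAddCommGroup F] [NormedSpace ℝ F]

/-- one-homogeneous lift of `W` to the cone -/
def hom (W : XX d → F) (t : ℝ) (z : ℝ × Euc d) : F := (max z.1 0) • W (t, (max z.1 0)⁻¹ • z.2)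

theorem hom_pos (W : XX d → F) (t : ℝ) {z : ℝ × Euc d} (hz : 0 < z.1) : hom W t z = z.1 • W (t, z.1⁻¹ • z.2) := by
  unfold hom; rw [max_eq_left hz.le]

theorem hom_bd {W : XX d → F} {s : ℝ} (hs : ∀ p, ‖W p‖ ≤ s) (t : ℝ) (z : ℝ × Euc d) : ‖hom W t z‖ ≤ max z.1 0 * s := by
  unfold hom
  rw [norm_smul, Real.norm_of_nonneg (le_max_right _ _)]
  exact mul_le_mul_of_nonneg_left (hs _) (le_max_right _ _)

theorem hom_cont {W : XX d → F} (hW : Continuous W) {s : ℝ} (hs : ∀ p, ‖W p‖ ≤ s) :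
    Continuous fun q : ℝ × (ℝ × Euc d) => hom W q.1 q.2 := by
  rw [continuous_iff_continuousAt]
  rintro ⟨t, z⟩
  rcases lt_or_ge 0 z.1 with h | h
  · unfold hom
    have h1 : ContinuousAt (fun q : ℝ × (ℝ × Euc d) => max q.2.1 0) (t, z) := by
      apply Continuous.continuousAt; fun_prop
    have h2 : (fun q : ℝ × (ℝ × Euc d) => max q.2.1 0) (t, z) ≠ 0 := by
      show max z.1 0 ≠ 0
      exact (lt_of_lt_of_le h (le_max_left _ _)).ne'
    refine h1.smul (hW.continuousAt.comp (continuousAt_fst.prodMk ((h1.inv₀ h2).smul ?_)))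
    apply Continuous.continuousAt; fun_prop
  · have e : hom W t z = 0 := by unfold hom; rw [max_eq_right h, zero_smul]
    unfold ContinuousAt
    simp only [e]
    apply squeeze_zero_norm (fun q : ℝ × (ℝ × Euc d) => hom_bd hs q.1 q.2)
    have : Continuous fun q : ℝ × (ℝ × Euc d) => max q.2.1 0 * s := by fun_prop
    have h3 := this.tendsto (t, z)
    simp only [max_eq_right h, zero_mul] at h3
    exact h3

theorem hom_lip {W : XX d → F} {s : ℝ} (hs : ∀ p, ‖W p‖ ≤ s) {L : ℝ≥0} (hL : LipschitzWith L W) {C : ℝ} (hC : 0 ≤ C)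
    {t t' : ℝ} {z z' : ℝ × Euc d} (hz : 0 < z.1) (hz' : 0 < z'.1) (hc : ‖z.2‖ ≤ C * z.1) :
    ‖hom W t z - hom W t' z'‖ ≤ L * (z'.1 * |t - t'|) + (s + L * (1 + C)) * ‖z - z'‖ := by
  rw [hom_pos W t hz, hom_pos W t' hz']
  have n1 : |z.1 - z'.1| ≤ ‖z - z'‖ := norm_fst_le (z - z')
  have n2 : ‖z.2 - z'.2‖ ≤ ‖z - z'‖ := norm_snd_le (z - z')
  have e : z.1 • W (t, z.1⁻¹ • z.2) - z'.1 • W (t', z'.1⁻¹ • z'.2) =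
     (z.1 - z'.1) • W (t, z.1⁻¹ • z.2) + z'.1 • (W (t, z.1⁻¹ • z.2) - W (t', z'.1⁻¹ • z'.2)) := by module
  have a1 : ‖(z.1 - z'.1) • W (t, z.1⁻¹ • z.2)‖ ≤ s * ‖z - z'‖ := by
    rw [norm_smul, mul_comm]
    exact mul_le_mul (hs _) n1 (norm_nonneg _) ((norm_nonneg _).trans (hs (t, z.1⁻¹ • z.2)))
  have a2 : z'.1 * ‖z.1⁻¹ • z.2 - z'.1⁻¹ • z'.2‖ ≤ (1 + C) * ‖z - z'‖ := by
    have : z'.1 * ‖z.1⁻¹ • z.2 - z'.1⁻¹ • z'.2‖ = ‖(z'.1 - z.1) • (z.1⁻¹ • z.2) + (z.2 - z'.2)‖ := by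
      rw [← Real.norm_of_nonneg hz'.le, ← norm_smul, Real.norm_of_nonneg hz'.le]
      congr 1
      rw [smul_sub, sub_smul, smul_smul z'.1 z'.1⁻¹, mul_inv_cancel₀ hz'.ne', smul_smul z.1 z.1⁻¹, mul_inv_cancel₀ hz.ne', one_smul, one_smul]
      abel
    rw [this]
    refine (norm_add_le _ _).trans ?_
    have : ‖(z'.1 - z.1) • (z.1⁻¹ • z.2)‖ ≤ ‖z - z'‖ * C := by
      rw [norm_smul, Real.norm_eq_abs, abs_sub_comm, norm_smul, norm_inv, Real.norm_of_nonneg hz.le]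
      refine mul_le_mul n1 ?_ (by positivity) (norm_nonneg _)
      rw [inv_mul_le_iff₀ hz]; linarith
    linarith
  have a3 : ‖z'.1 • (W (t, z.1⁻¹ • z.2) - W (t', z'.1⁻¹ • z'.2))‖ ≤ L * (z'.1 * |t - t'|) + L * ((1 + C) * ‖z - z'‖) := by
    rw [norm_smul, Real.norm_of_nonneg hz'.le, ← dist_eq_norm]
    have b := hL.dist_le_mul (t, z.1⁻¹ • z.2) (t', z'.1⁻¹ • z'.2)
    have c : dist (t, z.1⁻¹ • z.2) (t', z'.1⁻¹ • z'.2) ≤ |t - t'| + ‖z.1⁻¹ • z.2 - z'.1⁻¹ • z'.2‖ := by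
      rw [Prod.dist_eq, dist_eq_norm, dist_eq_norm]
      exact max_le_add_of_nonneg (norm_nonneg _) (norm_nonneg _)
    calc z'.1 * dist (W (t, z.1⁻¹ • z.2)) (W (t', z'.1⁻¹ • z'.2)) ≤ z'.1 * (L * (|t - t'| + ‖z.1⁻¹ • z.2 - z'.1⁻¹ • z'.2‖)) := by
          gcongr; exact b.trans (by gcongr)
      _ = L * (z'.1 * |t - t'|) + L * (z'.1 * ‖z.1⁻¹ • z.2 - z'.1⁻¹ • z'.2‖) := by ring
      _ ≤ _ := by gcongr
  rw [e]
  refine (norm_add_le _ _).trans ?_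
  nlinarith
end

theorem pl_cone {N : ℕ} (hN : 1 ≤ N) {z : ℕ → ℝ × Euc d} {C : ℝ} (hr : ∀ k ≤ N, 0 < (z k).1) (hc : ∀ k ≤ N, ‖(z k).2‖ ≤ C * (z k).1)
    {t : ℝ} (ht : t ∈ Icc (0:ℝ) 1) : 0 < (pl N z t).1 ∧ ‖(pl N z t).2‖ ≤ C * (pl N z t).1 := by
  obtain ⟨k, hk, hkt⟩ := exists_seg hN ht
  obtain ⟨e, h0, h1⟩ := pl_seg hN z hk hkt
  set θ := N * t - k with hθ
  have e1 : pl N z t = (1 - θ) • z k + θ • z (k+1) := by rw [e]; module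
  rw [e1]
  have p1 := hr k hk.le
  have p2 := hr (k+1) hk
  have q1 := hc k hk.le
  have q2 := hc (k+1) hk
  simp only [Prod.fst_add, Prod.snd_add, Prod.smul_fst, Prod.smul_snd, smul_eq_mul]
  constructor
  · rcases h0.lt_or_eq with h | h
    · nlinarith [mul_nonneg (sub_nonneg.2 h1) p1.le, mul_pos h p2]
    · rw [← h]; linarith
  · refine (norm_add_le _ _).trans ?_
    rw [norm_smul, norm_smul, Real.norm_of_nonneg (sub_nonneg.2 h1), Real.norm_of_nonneg h0]
    nlinarith [mul_le_mul_of_nonneg_left q1 (sub_nonneg.2 h1), mul_le_mul_of_nonneg_left q2 h0]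

theorem pl_cont {E : Type*} [NormedAddCommGroup E] [NormedSpace ℝ E] (N : ℕ) (z : ℕ → E) : Continuous (pl N z) := by
  have := continuous_clamp
  unfold pl; fun_prop

theorem pl_int {N : ℕ} (hN : 1 ≤ N) {z : ℕ → ℝ × Euc d} {C : ℝ} (hC : 0 ≤ C) (hr : ∀ k ≤ N, 0 < (z k).1) (hc : ∀ k ≤ N, ‖(z k).2‖ ≤ C * (z k).1)
    (hr0 : (z 0).1 = 1) {W : XX d → ℝ × Euc d} {s : ℝ} (hs : ∀ p, ‖W p‖ ≤ s) {L : ℝ≥0} (hL : LipschitzWith L W) {j : ℕ} (hj : j ≤ N) :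
    ‖pl N z ((j:ℝ)/N) - pl N z 0 - ∫ τ in (0:ℝ)..(j:ℝ)/N, hom W τ (pl N z τ)‖ ^ 2 ≤
      2 * (∑ k ∈ Finset.range N, N * ‖(z (k+1) - z k) - ((z k).1 / N) • W ((k:ℝ)/N, (z k).1⁻¹ • (z k).2)‖ ^ 2) +
      1 / N * ((8 * L ^ 2 + 4 * (s + L * (1 + C)) ^ 2) * (1 + N * ∑ k ∈ Finset.range N, ‖z (k+1) - z k‖ ^ 2)) := by
  have hN0 : (0:ℝ) < N := by exact_mod_cast hN
  have hN1 : (1:ℝ) ≤ N := by exact_mod_cast hN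
  have hs0 : 0 ≤ s := (norm_nonneg _).trans (hs 0)
  set L1 := s + L * (1 + C) with hL1
  have hL10 : 0 ≤ L1 := by positivity
  set S := N * ∑ k ∈ Finset.range N, ‖z (k+1) - z k‖ ^ 2 with hS
  have hS0 : 0 ≤ S := by positivity
  have hcont : Continuous fun τ => hom W τ (pl N z τ) :=
    (hom_cont hL.continuous hs).comp (continuous_id.prodMk (pl_cont N z))
  set e : ℕ → ℝ × Euc d := fun k => (z (k+1) - z k) - ((z k).1 / N) • W ((k:ℝ)/N, (z k).1⁻¹ • (z k).2) with he
  set f : ℕ → ℝ × Euc d := fun k => ∫ τ in (k:ℝ)/N..((k+1:ℕ):ℝ)/N, (hom W τ (pl N z τ) - hom W ((k:ℝ)/N) (z k)) with hf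
  have e0 : pl N z 0 = z 0 := by
    have := pl_node hN z (Nat.zero_le N); simpa using this
  have hlen : ∀ k : ℕ, ((k+1:ℕ):ℝ)/N - (k:ℝ)/N = 1 / N := by intro k; push_cast; field_simp; ring
  have e1 : pl N z ((j:ℝ)/N) - pl N z 0 - ∫ τ in (0:ℝ)..(j:ℝ)/N, hom W τ (pl N z τ) = ∑ k ∈ Finset.range j, (e k - f k) := by
    rw [pl_node hN z hj, e0]
    have h1 : ∑ k ∈ Finset.range j, ∫ τ in (k:ℝ)/N..((k+1:ℕ):ℝ)/N, hom W τ (pl N z τ) = ∫ τ in ((0:ℕ):ℝ)/N..(j:ℝ)/N, hom W τ (pl N z τ) :=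
      intervalIntegral.sum_integral_adjacent_intervals (a := fun k : ℕ => (k:ℝ)/N) (fun k _ => hcont.intervalIntegrable _ _)
    rw [Nat.cast_zero, zero_div] at h1
    rw [← h1, ← Finset.sum_range_sub z j, ← Finset.sum_sub_distrib]
    refine Finset.sum_congr rfl fun k hk => ?_
    rw [Finset.mem_range] at hk
    rw [he, hf]
    simp only
    rw [intervalIntegral.integral_sub (hcont.intervalIntegrable _ _) intervalIntegrable_const, intervalIntegral.integral_const, hlen,
      hom_pos W _ (hr k (by omega)), smul_smul]
    have : 1 / (N:ℝ) * (z k).1 = (z k).1 / N := by ring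
    rw [this]; abel
  have hz2 : ∀ k ≤ N, (z k).1 ^ 2 ≤ 2 + 2 * S := by
    intro k hk
    have h := pl_holder (N := N) z 0 ((k:ℝ)/N)
    rw [pl_node hN z hk, e0] at h
    have h1 : |(k:ℝ)/N - 0| ≤ 1 := by
      rw [sub_zero, abs_of_nonneg (by positivity), div_le_one hN0]; exact_mod_cast hk
    have h2 : ‖z k - z 0‖ ^ 2 ≤ S := h.trans (by nlinarith)
    have h3 : |(z k).1 - (z 0).1| ≤ ‖z k - z 0‖ := norm_fst_le (z k - z 0)
    have h4 : ((z k).1 - (z 0).1) ^ 2 ≤ S := by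
      refine le_trans ?_ h2
      rw [← sq_abs]; gcongr
    rw [hr0] at h4
    nlinarith [sq_nonneg ((z k).1 - 2)]
  have hfb : ∀ k < N, ‖f k‖ ≤ 1 / N * (L * (z k).1 / N + L1 * ‖z (k+1) - z k‖) := by
    intro k hk
    have hle : (k:ℝ)/N ≤ ((k+1:ℕ):ℝ)/N := by gcongr; omega
    have := intervalIntegral.norm_integral_le_of_norm_le_const (a := (k:ℝ)/N) (b := ((k+1:ℕ):ℝ)/N)
      (f := fun τ => hom W τ (pl N z τ) - hom W ((k:ℝ)/N) (z k)) (C := L * (z k).1 / N + L1 * ‖z (k+1) - z k‖) ?_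
    · rw [hlen, abs_of_nonneg (by positivity)] at this
      rw [mul_comm]; exact this
    · intro τ hτ
      rw [uIoc_of_le hle] at hτ
      have hτ' : τ ∈ Icc ((k:ℝ)/N) (((k+1:ℕ):ℝ)/N) := ⟨hτ.1.le, hτ.2⟩
      have hτ1 : τ ∈ Icc (0:ℝ) 1 := by
        obtain ⟨a, b, c⟩ := CED.ivl_sub hN hk
        exact ⟨a.trans hτ'.1, hτ'.2.trans c⟩
      obtain ⟨c1, c2⟩ := pl_cone hN hr hc hτ1
      obtain ⟨s1, s2, s3⟩ := pl_seg hN z hk hτ'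
      refine (hom_lip hs hL hC c1 (hr k hk.le) c2).trans ?_
      have q1 : ‖pl N z τ - z k‖ ≤ ‖z (k+1) - z k‖ := by
        rw [s1, add_sub_cancel_left, norm_smul, Real.norm_of_nonneg s2]
        exact mul_le_of_le_one_left (norm_nonneg _) s3
      have q2 : |τ - (k:ℝ)/N| ≤ 1 / N := by
        rw [abs_of_nonneg (by linarith [hτ'.1])]; linarith [hτ'.2, hlen k]
      have := (hr k hk.le).le
      calc _ ≤ L * ((z k).1 * (1 / N)) + L1 * ‖z (k+1) - z k‖ := by gcongr
        _ = _ := by ring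
  rw [e1]
  have c1 := cs_fin j (fun _ => (1:ℝ)) (fun _ => zero_le_one) (fun k => e k - f k)
  simp only [one_smul, one_mul, Finset.sum_const, Finset.card_range, nsmul_eq_mul, mul_one] at c1
  refine c1.trans ?_
  have hjN : (j:ℝ) ≤ N := by exact_mod_cast hj
  calc (j:ℝ) * ∑ k ∈ Finset.range j, ‖e k - f k‖ ^ 2 ≤ N * ∑ k ∈ Finset.range N, ‖e k - f k‖ ^ 2 := by
        refine mul_le_mul hjN ?_ (by positivity) hN0.le
        exact Finset.sum_le_sum_of_subset_of_nonneg (Finset.range_subset_range.2 hj) (fun _ _ _ => by positivity)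
    _ = ∑ k ∈ Finset.range N, N * ‖e k - f k‖ ^ 2 := by rw [Finset.mul_sum]
    _ ≤ ∑ k ∈ Finset.range N, (2 * (N * ‖e k‖ ^ 2) + (1 / N * (8 * L ^ 2 * (1 + S) / N) + 1 / N * (4 * L1 ^ 2 * ‖z (k+1) - z k‖ ^ 2))) := by
        refine Finset.sum_le_sum fun k hk => ?_
        rw [Finset.mem_range] at hk
        have b1 : ‖e k - f k‖ ^ 2 ≤ 2 * ‖e k‖ ^ 2 + 2 * ‖f k‖ ^ 2 := by
          calc _ ≤ (‖e k‖ + ‖f k‖) ^ 2 := by gcongr; exact norm_sub_le _ _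
            _ ≤ _ := by nlinarith [sq_nonneg (‖e k‖ - ‖f k‖)]
        have b2 : ‖f k‖ ^ 2 ≤ (1 / N) ^ 2 * (2 * (L * (z k).1 / N) ^ 2 + 2 * (L1 * ‖z (k+1) - z k‖) ^ 2) := by
          calc _ ≤ (1 / N * (L * (z k).1 / N + L1 * ‖z (k+1) - z k‖)) ^ 2 := by gcongr; exact hfb k hk
            _ = (1 / N) ^ 2 * (L * (z k).1 / N + L1 * ‖z (k+1) - z k‖) ^ 2 := by ring
            _ ≤ _ := by
              gcongr
              nlinarith [sq_nonneg (L * (z k).1 / N - L1 * ‖z (k+1) - z k‖)]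
        have b3 : (L * (z k).1 / N) ^ 2 ≤ L ^ 2 * (2 + 2 * S) / N := by
          have : (L * (z k).1 / N) ^ 2 = L ^ 2 * (z k).1 ^ 2 / (N * N) := by ring
          rw [this]
          have hh := hz2 k hk.le
          calc _ ≤ L ^ 2 * (2 + 2 * S) / (N * N) := by gcongr
            _ ≤ _ := by
              gcongr
              nlinarith
        calc N * ‖e k - f k‖ ^ 2 ≤ N * (2 * ‖e k‖ ^ 2 + 2 * ((1 / N) ^ 2 * (2 * (L ^ 2 * (2 + 2 * S) / N) + 2 * (L1 * ‖z (k+1) - z k‖) ^ 2))) := by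
              gcongr
              refine b1.trans ?_
              gcongr
              refine b2.trans ?_
              gcongr
          _ = _ := by field_simp; ring
    _ = 2 * (∑ k ∈ Finset.range N, N * ‖e k‖ ^ 2) + 1 / N * (8 * L ^ 2 * (1 + S) + 4 * L1 ^ 2 * ∑ k ∈ Finset.range N, ‖z (k+1) - z k‖ ^ 2) := by
        rw [Finset.sum_add_distrib, Finset.sum_add_distrib, Finset.sum_const, Finset.card_range, nsmul_eq_mul, ← Finset.mul_sum, ← Finset.mul_sum,
          ← Finset.mul_sum, ← Finset.mul_sum]
        have : (N:ℝ) * (1 / N * (8 * L ^ 2 * (1 + S) / N)) = 1 / N * (8 * L ^ 2 * (1 + S)) := by field_simp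
        rw [this]; ring
    _ ≤ _ := by
        have h1 : ∑ k ∈ Finset.range N, ‖z (k+1) - z k‖ ^ 2 ≤ 1 + S := by
          have : 0 ≤ ∑ k ∈ Finset.range N, ‖z (k+1) - z k‖ ^ 2 := by positivity
          nlinarith
        have h2 : 8 * L ^ 2 * (1 + S) + 4 * L1 ^ 2 * ∑ k ∈ Finset.range N, ‖z (k+1) - z k‖ ^ 2 ≤ (8 * L ^ 2 + 4 * L1 ^ 2) * (1 + S) := by
          nlinarith [sq_nonneg L1]
        gcongr
end

section
open ProbabilityTheory

abbrev PathE (d : ℕ) := C(unitInterval, ℝ × Euc d)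

instance instMSPathE : MeasurableSpace (PathE d) := borel _
instance instBSPathE : BorelSpace (PathE d) := ⟨rfl⟩

def ev (z : PathE d) (t : ℝ) : ℝ × Euc d := z (projIcc 0 1 zero_le_one t)

theorem ev_cont2 : Continuous fun q : PathE d × ℝ => ev q.1 q.2 := by
  unfold ev
  have : Continuous (projIcc (0:ℝ) 1 zero_le_one) := continuous_projIcc
  exact continuous_eval.comp (continuous_fst.prodMk (this.comp continuous_snd))

theorem ev_cont (z : PathE d) : Continuous (ev z) := ev_cont2.comp (continuous_const.prodMk continuous_id)
theorem ev_cont1 (t : ℝ) : Continuous (fun z : PathE d => ev z t) := ev_cont2.comp (continuous_id.prodMk continuous_const)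

structure Appr (v : XX d → Euc d) (g : XX d → ℝ) (κ : Kernel ℝ (Euc d)) (R M C0 : ℝ) (Cf : ℝ → ℝ≥0 → ℝ) (K : ℕ) (ε : ℝ) (σ : Measure (PathE d)) : Prop where
  mass : σ univ = κ 0 univ
  start : ∀ᵐ z ∂σ, (ev z 0).1 = 1
  cone : ∀ᵐ z ∂σ, ∀ t ∈ Icc (0:ℝ) 1, 0 ≤ (ev z t).1 ∧ ‖(ev z t).2‖ ≤ (R + 2) * (ev z t).1
  hold : ∀ a > 0, σ {z | ∀ s ∈ Icc (0:ℝ) 1, ∀ t ∈ Icc (0:ℝ) 1, ‖ev z t - ev z s‖ ^ 2 ≤ a * |t - s|}ᶜ ≤ ENNReal.ofReal (C0 / a)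
  dom : ∀ j : ℕ, j ≤ 2 ^ K → ∀ (ψ : Euc d → ℝ) (s : ℝ) (L : ℝ≥0), (∀ x, 0 ≤ ψ x) → (∀ x, ψ x ≤ s) → LipschitzWith L ψ →
    ∫⁻ z, ENNReal.ofReal (max (ev z ((j:ℝ)/(2^K:ℕ))).1 0 * hom (fun p => ψ p.2) 0 (ev z ((j:ℝ)/(2^K:ℕ)))) ∂σ ≤
      ENNReal.ofReal ((1 + ε) * ((∫ x, ψ x ∂(κ ((j:ℝ)/(2^K:ℕ)))) + ε * (L * M + s * VB d R)))
  eq : ∀ j : ℕ, j ≤ 2 ^ K → ∀ (W : XX d → ℝ × Euc d) (s : ℝ) (L : ℝ≥0), (∀ p, ‖W p‖ ≤ s) → LipschitzWith L W →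
    ∫⁻ z, ENNReal.ofReal (‖ev z ((j:ℝ)/(2^K:ℕ)) - ev z 0 - ∫ τ in (0:ℝ)..(j:ℝ)/(2^K:ℕ), hom W τ (ev z τ)‖ ^ 2) ∂σ ≤
      ENNReal.ofReal (32 * (∫ p, ‖phat v g p - W p‖ ^ 2 ∂(PP κ)) + ε * Cf s L)

section
variable {v : XX d → Euc d} {g : XX d → ℝ} {κ : Kernel ℝ (Euc d)} {R M : ℝ} {ξ : Euc d → ℝ} {ε C : ℝ} {N : ℕ}

theorem Sch.path (S : Sch v g κ R M ξ ε C N) : ∃ P : Euc d → PathE d, Continuous P ∧ ∀ x, ∀ t ∈ Icc (0:ℝ) 1, ev (P x) t = pl N (fun k => zk κ v g ξ ε N k x) t := by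
  have hc : Continuous fun q : Euc d × unitInterval => pl N (fun k => zk κ v g ξ ε N k q.1) q.2 := by
    have h1 := S.cont_z
    have := continuous_clamp
    unfold pl
    refine ((h1 0).comp continuous_fst).add (continuous_finset_sum _ fun k _ => ?_)
    exact (this.comp (by fun_prop)).smul (((h1 (k+1)).comp continuous_fst).sub ((h1 k).comp continuous_fst))
  refine ⟨fun x => ContinuousMap.curry ⟨_, hc⟩ x, ContinuousMap.continuous _, ?_⟩
  intro x t ht
  unfold ev
  rw [projIcc_of_mem _ ht]
  rfl

def C0f (v : XX d → Euc d) (g : XX d → ℝ) (κ : Kernel ℝ (Euc d)) : ℝ := 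
  16 * (∫ p, ‖phat v g p - 0‖ ^ 2 ∂(PP κ)) + 20 * (∫ p, (|g p| + 0) ^ 2 ∂(PP κ))

def Cff (v : XX d → Euc d) (g : XX d → ℝ) (κ : Kernel ℝ (Euc d)) (R M : ℝ) (s : ℝ) (L : ℝ≥0) : ℝ := 
  2 * (16 * (∫ p, (|g p| + L) ^ 2 ∂(PP κ)) + 4 * (∫ p, (|g p| + 0) ^ 2 ∂(PP κ)) + 32 * s ^ 2 * VB d R) + 
    (8 * L ^ 2 + 4 * (s + L * (1 + (R + 2))) ^ 2) * (M + C0f v g κ)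

theorem C0f_nonneg : 0 ≤ C0f v g κ := by
  unfold C0f
  have h1 : 0 ≤ ∫ p, ‖phat v g p - 0‖ ^ 2 ∂(PP κ) := integral_nonneg fun p => by positivity
  have h2 : 0 ≤ ∫ p, (|g p| + 0) ^ 2 ∂(PP κ) := integral_nonneg fun p => by positivity
  positivity

theorem Sch.ES (S : Sch v g κ R M ξ ε C N) :
    ∫⁻ x, ENNReal.ofReal (N * ∑ k ∈ Finset.range N, ‖zk κ v g ξ ε N (k+1) x - zk κ v g ξ ε N k x‖ ^ 2) ∂(mu0 κ ξ) ≤ ENNReal.ofReal (C0f v g κ) := by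
  have h := S.energy (W := fun _ => 0) (s := 0) (L := 0) (fun p => by simp) (LipschitzWith.const 0)
  simp only [smul_zero, sub_zero] at h
  have e : ∀ x, ENNReal.ofReal (N * ∑ k ∈ Finset.range N, ‖zk κ v g ξ ε N (k+1) x - zk κ v g ξ ε N k x‖ ^ 2) =
      ∑ k ∈ Finset.range N, ENNReal.ofReal (N * ‖Dk κ v g ξ ε N k x‖ ^ 2) := by
    intro x
    rw [Finset.mul_sum, ENNReal.ofReal_sum_of_nonneg (fun _ _ => by positivity)]
    rfl
  simp only [e]
  rw [lintegral_finset_sum]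
  · refine h.trans (ENNReal.ofReal_le_ofReal ?_)
    unfold C0f
    simp only [sub_zero]
    have h2 : 0 ≤ ∫ p, (|g p| + 0) ^ 2 ∂(PP κ) := integral_nonneg fun p => by positivity
    have := S.hε1
    push_cast
    nlinarith
  · intro k _
    have h1 := S.cont_z
    have : Continuous (Dk κ v g ξ ε N k) := (h1 (k+1)).sub (h1 k)
    apply Measurable.ennreal_ofReal
    exact ((this.norm.pow 2).const_mul _).measurable

theorem zk_ray (S : Sch v g κ R M ξ ε C N) {k : ℕ} (hk : k ≤ N) (x : Euc d) :
    (zk κ v g ξ ε N k x).1⁻¹ • (zk κ v g ξ ε N k x).2 = Xk κ v ξ ε N k x := by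
  unfold zk
  simp only [smul_smul]
  rw [inv_mul_cancel₀ (S.r_pos x k hk).ne', one_smul]

theorem Sch.appr {K : ℕ} (S : Sch v g κ R M ξ ε C (2^K)) :
    ∃ σ : Measure (PathE d), Appr v g κ R M (C0f v g κ) (Cff v g κ R M) K ε σ := by
  obtain ⟨P, hP, hPe⟩ := S.path
  haveI := S.H.fin
  have hR := S.H.hR
  have hM := S.H.hM
  have hε := S.hε
  set N := 2 ^ K with hN
  have hN0 : (0:ℝ) < N := by exact_mod_cast S.hN
  have m0 : (0:ℝ) ∈ Icc (0:ℝ) 1 := ⟨le_rfl, zero_le_one⟩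
  have mj : ∀ j ≤ N, (j:ℝ)/N ∈ Icc (0:ℝ) 1 := fun j hj => ⟨by positivity, by rw [div_le_one hN0]; exact_mod_cast hj⟩
  have hev0 : ∀ x, ev (P x) 0 = zk κ v g ξ ε N 0 x := by
    intro x; rw [hPe x 0 m0]
    have := pl_node S.hN (fun k => zk κ v g ξ ε N k x) (Nat.zero_le N); simpa using this
  have hevj : ∀ x, ∀ j ≤ N, ev (P x) ((j:ℝ)/N) = zk κ v g ξ ε N j x := by
    intro x j hj; rw [hPe x _ (mj j hj), pl_node S.hN _ hj]
  have hae := S.mu0_ae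
  have hrp : ∀ x, ∀ k ≤ N, 0 < (zk κ v g ξ ε N k x).1 := fun x k hk => S.r_pos x k hk
  have hcp : ∀ x, ‖x‖ < R + 1 → ∀ k ≤ N, ‖(zk κ v g ξ ε N k x).2‖ ≤ (R + 2) * (zk κ v g ξ ε N k x).1 := by
    intro x hx k hk
    have h1 := S.r_pos x k hk
    have h2 := S.X_bd hx k hk
    show ‖rk κ v g ξ ε N k x • Xk κ v ξ ε N k x‖ ≤ (R+2) * rk κ v g ξ ε N k x
    rw [norm_smul, Real.norm_of_nonneg h1.le, mul_comm]
    gcongr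
  have mP := hP.measurable
  refine ⟨(mu0 κ ξ).map P, ?_, ?_, ?_, ?_, ?_, ?_⟩
  · rw [Measure.map_apply mP MeasurableSet.univ, preimage_univ, S.mu0_univ]
  · refine (ae_map_iff mP.aemeasurable ?_).2 (Eventually.of_forall fun x => ?_)
    · exact (isClosed_eq (continuous_fst.comp (ev_cont1 0)) continuous_const).measurableSet
    · rw [hev0]; rfl
  · refine (ae_map_iff mP.aemeasurable ?_).2 ?_
    · refine IsClosed.measurableSet ?_
      simp only [setOf_forall]
      refine isClosed_iInter fun t => isClosed_iInter fun _ => ?_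
      have c1 : Continuous fun z : PathE d => (ev z t).1 := continuous_fst.comp (ev_cont1 t)
      have c2 : Continuous fun z : PathE d => (ev z t).2 := continuous_snd.comp (ev_cont1 t)
      exact (isClosed_le continuous_const c1).inter (isClosed_le c2.norm (continuous_const.mul c1))
    · filter_upwards [hae] with x hx t ht
      rw [hPe x t ht]
      have := pl_cone S.hN (hrp x) (hcp x hx) ht
      exact ⟨this.1.le, this.2⟩
  · intro a ha
    have cl : IsClosed {z : PathE d | ∀ s ∈ Icc (0:ℝ) 1, ∀ t ∈ Icc (0:ℝ) 1, ‖ev z t - ev z s‖ ^ 2 ≤ a * |t - s|} := by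
      simp only [setOf_forall]
      refine isClosed_iInter fun s => isClosed_iInter fun _ => isClosed_iInter fun t => isClosed_iInter fun _ => ?_
      have := ev_cont1 (d := d) t
      have := ev_cont1 (d := d) s
      exact isClosed_le (by fun_prop) (by fun_prop)
    rw [Measure.map_apply mP cl.measurableSet.compl]
    have hsub : P ⁻¹' {z : PathE d | ∀ s ∈ Icc (0:ℝ) 1, ∀ t ∈ Icc (0:ℝ) 1, ‖ev z t - ev z s‖ ^ 2 ≤ a * |t - s|}ᶜ ⊆
       {x | ENNReal.ofReal a ≤ ENNReal.ofReal (N * ∑ k ∈ Finset.range N, ‖zk κ v g ξ ε N (k+1) x - zk κ v g ξ ε N k x‖ ^ 2)} := by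
      intro x hx
      by_contra h
      apply hx
      intro s hs t ht
      rw [hPe x t ht, hPe x s hs]
      refine (pl_holder _ s t).trans ?_
      rw [mul_comm]
      gcongr
      by_contra h2
      exact h (ENNReal.ofReal_le_ofReal (not_le.1 h2).le)
    refine (measure_mono hsub).trans ?_
    have mm : Measurable fun x => ENNReal.ofReal (N * ∑ k ∈ Finset.range N, ‖zk κ v g ξ ε N (k+1) x - zk κ v g ξ ε N k x‖ ^ 2) := by
      apply Measurable.ennreal_ofReal
      apply Continuous.measurable
      have h1 := S.cont_z
      exact (continuous_finset_sum _ fun k _ => (((h1 (k+1)).sub (h1 k)).norm.pow 2)).const_mul _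
    refine (meas_ge_le_lintegral_div mm.aemeasurable (by simpa using ha) ENNReal.ofReal_ne_top).trans ?_
    rw [ENNReal.ofReal_div_of_pos ha]
    gcongr
    exact S.ES
  · intro j hj ψ s L h0 hs hL
    have hLp : LipschitzWith L fun p : XX d => ψ p.2 := by
      have := hL.comp (LipschitzWith.prod_snd (α := ℝ) (β := Euc d)); simp only [mul_one] at this; exact this
    have hbd : ∀ p : XX d, ‖ψ p.2‖ ≤ s := fun p => by rw [Real.norm_of_nonneg (h0 _)]; exact hs _
    have hhc := hom_cont hLp.continuous hbd
    have hec := ev_cont1 (d := d) ((j:ℝ)/N)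
    rw [lintegral_map]
    · have e1 : ∀ x, ENNReal.ofReal (max (ev (P x) ((j:ℝ)/N)).1 0 * hom (fun p => ψ p.2) 0 (ev (P x) ((j:ℝ)/N)))
          = ENNReal.ofReal (ψ (Xk κ v ξ ε N j x)) * ENNReal.ofReal (rk κ v g ξ ε N j x ^ 2) := by
        intro x
        rw [hevj x j hj, hom_pos _ _ (hrp x j hj), zk_ray S hj, max_eq_left (hrp x j hj).le, ← ENNReal.ofReal_mul (h0 _)]
        congr 1
        show rk κ v g ξ ε N j x * (rk κ v g ξ ε N j x * _) = _
        ring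
      refine (lintegral_congr e1).le.trans ?_
      refine (S.dom0 hj (ψ := fun x => ENNReal.ofReal (ψ x)) hL.continuous.measurable.ennreal_ofReal).trans ?_
      rw [ENNReal.ofReal_mul (by positivity)]
      gcongr
      have hs0 : 0 ≤ s := (h0 0).trans (hs 0)
      have hM' := S.H.massR ((j:ℝ)/N)
      have iψ : Integrable ψ (κ ((j:ℝ)/N)) := by
        refine (integrable_const s).mono' hL.continuous.aestronglyMeasurable (Eventually.of_forall fun x => hbd (0, x))
      have e2 : ∀ x, ENNReal.ofReal (ψ x) * ENNReal.ofReal (Uk κ ξ ε N j x) ≤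
          ENNReal.ofReal (∫ y, ξ (x - id y) * (ψ y + L * ε) ∂(κ ((j:ℝ)/N))) + ENNReal.ofReal (s * ε) := by
        intro x
        have hi1 := conv_integrable S.hξ measurable_id (integrable_const (μ := κ ((j:ℝ)/N)) (1:ℝ)) x
        have hi2 := conv_integrable S.hξ measurable_id (iψ.add (integrable_const (L * ε))) x
        simp only [smul_eq_mul, mul_one] at hi1 hi2
        rw [← ENNReal.ofReal_mul (h0 _), ← ENNReal.ofReal_add (integral_nonneg fun y => mul_nonneg (S.hξ.nn _) (add_nonneg (h0 _) (by positivity))) (by positivity)]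
        apply ENNReal.ofReal_le_ofReal
        unfold Uk Vk conv
        rw [mul_add]
        simp only [smul_eq_mul, mul_one]
        rw [← integral_const_mul]
        refine add_le_add (integral_mono (hi1.const_mul _) hi2 fun y => ?_) (by gcongr; exact hs x)
        show ψ x * ξ (x - id y) ≤ ξ (x - id y) * (ψ y + L * ε)
        rw [mul_comm]
        by_cases hx : ξ (x - id y) = 0
        · rw [hx, zero_mul, zero_mul]
        refine mul_le_mul_of_nonneg_left ?_ (S.hξ.nn _)
        have h3 := S.hξ.supp _ hx
        have h4 := hL.dist_le_mul x y
        rw [Real.dist_eq, dist_eq_norm] at h4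
        have h5 := (le_abs_self _).trans h4
        have h6 : (L:ℝ) * ‖x - y‖ ≤ L * ε := by gcongr; exact h3.le
        linarith
      refine (lintegral_mono e2).trans ?_
      rw [lintegral_add_right _ measurable_const, lintegral_const, Measure.restrict_apply_univ, VB_eq]
      have hi3 : Integrable (fun y => ψ y + L * ε) (κ ((j:ℝ)/N)) := iψ.add (integrable_const _)
      have e3 : ∫⁻ x in Metric.ball 0 (R + 2), ENNReal.ofReal (∫ y, ξ (x - id y) * (ψ y + L * ε) ∂(κ ((j:ℝ)/N))) ≤
          ENNReal.ofReal (∫ y, (ψ y + L * ε) ∂(κ ((j:ℝ)/N))) := by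
        refine (setLIntegral_le_lintegral _ _).trans (le_of_eq ?_)
        exact tonelli_xi S.hξ measurable_id (hL.continuous.measurable.add_const _) (fun y => add_nonneg (h0 _) (by positivity)) hi3
      have hVB := VB_nonneg d R
      refine (add_le_add e3 le_rfl).trans ?_
      rw [← ENNReal.ofReal_mul (by positivity), ← ENNReal.ofReal_add (integral_nonneg fun y => add_nonneg (h0 _) (by positivity)) (by positivity)]
      apply ENNReal.ofReal_le_ofReal
      rw [integral_add iψ (integrable_const _), integral_const, smul_eq_mul]
      have h7 : (κ ((j:ℝ)/N)).real univ * (L * ε) ≤ M * (L * ε) := by gcongr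
      linarith
    · apply Measurable.ennreal_ofReal
      apply Continuous.measurable
      have : Continuous fun z : PathE d => hom (fun p => ψ p.2) 0 (ev z ((j:ℝ)/N)) := hhc.comp (continuous_const.prodMk hec)
      exact ((continuous_fst.comp hec).max continuous_const).mul this
    · exact mP
  · intro j hj W s L hs hL
    have hc2 : Continuous fun z : PathE d => ∫ τ in (0:ℝ)..(j:ℝ)/N, hom W τ (ev z τ) := by
      apply intervalIntegral.continuous_parametric_intervalIntegral_of_continuous'
      exact (hom_cont hL.continuous hs).comp (continuous_snd.prodMk ev_cont2)
    rw [lintegral_map]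
    · have hVB := VB_nonneg d R
      have h1 := S.cont_z
      set cc : ℝ := 8 * L ^ 2 + 4 * (s + L * (1 + (R + 2))) ^ 2 with hcc
      have hcc0 : 0 ≤ cc := by positivity
      have pt : ∀ᵐ x ∂(mu0 κ ξ), ENNReal.ofReal (‖ev (P x) ((j:ℝ)/N) - ev (P x) 0 - ∫ τ in (0:ℝ)..(j:ℝ)/N, hom W τ (ev (P x) τ)‖ ^ 2) ≤
          ENNReal.ofReal 2 * (∑ k ∈ Finset.range N, ENNReal.ofReal (N * ‖Dk κ v g ξ ε N k x - (rk κ v g ξ ε N k x / N) • W ((k:ℝ)/N, Xk κ v ξ ε N k x)‖ ^ 2))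
          + ENNReal.ofReal (ε * cc) * (1 + ENNReal.ofReal (N * ∑ k ∈ Finset.range N, ‖zk κ v g ξ ε N (k+1) x - zk κ v g ξ ε N k x‖ ^ 2)) := by
        filter_upwards [hae] with x hx
        have hI : ∫ τ in (0:ℝ)..(j:ℝ)/N, hom W τ (ev (P x) τ) = ∫ τ in (0:ℝ)..(j:ℝ)/N, hom W τ (pl N (fun k => zk κ v g ξ ε N k x) τ) := by
          refine intervalIntegral.integral_congr fun τ hτ => ?_
          rw [uIcc_of_le (mj j hj).1] at hτ
          show hom W τ (ev (P x) τ) = _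
          rw [hPe x τ ⟨hτ.1, hτ.2.trans (mj j hj).2⟩]
        rw [hI, hPe x _ (mj j hj), hPe x 0 m0]
        have hb := pl_int S.hN (by positivity : 0 ≤ R + 2) (hrp x) (hcp x hx) rfl hs hL hj
        have hb2 : ∑ k ∈ Finset.range N, N * ‖(zk κ v g ξ ε N (k+1) x - zk κ v g ξ ε N k x) - ((zk κ v g ξ ε N k x).1 / N) • W ((k:ℝ)/N, (zk κ v g ξ ε N k x).1⁻¹ • (zk κ v g ξ ε N k x).2)‖ ^ 2
           = ∑ k ∈ Finset.range N, N * ‖Dk κ v g ξ ε N k x - (rk κ v g ξ ε N k x / N) • W ((k:ℝ)/N, Xk κ v ξ ε N k x)‖ ^ 2 := by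
          refine Finset.sum_congr rfl fun k hk => ?_
          rw [zk_ray S (Finset.mem_range.1 hk).le]; rfl
        rw [hb2] at hb
        rw [← ENNReal.ofReal_sum_of_nonneg (fun _ _ => by positivity), ← ENNReal.ofReal_one, ← ENNReal.ofReal_add zero_le_one (by positivity),
          ← ENNReal.ofReal_mul (by norm_num), ← ENNReal.ofReal_mul (by positivity), ← ENNReal.ofReal_add (by positivity) (by positivity)]
        apply ENNReal.ofReal_le_ofReal
        refine hb.trans ?_
        refine add_le_add le_rfl ?_
        rw [← mul_assoc]
        gcongr
        exact S.hNε
      refine (lintegral_mono_ae pt).trans ?_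
      have mm1 : Measurable fun x => ENNReal.ofReal (N * ∑ k ∈ Finset.range N, ‖zk κ v g ξ ε N (k+1) x - zk κ v g ξ ε N k x‖ ^ 2) := by
        apply Measurable.ennreal_ofReal
        apply Continuous.measurable
        exact (continuous_finset_sum _ fun k _ => (((h1 (k+1)).sub (h1 k)).norm.pow 2)).const_mul _
      have mm2 : ∀ k, Measurable fun x => ENNReal.ofReal (N * ‖Dk κ v g ξ ε N k x - (rk κ v g ξ ε N k x / N) • W ((k:ℝ)/N, Xk κ v ξ ε N k x)‖ ^ 2) := by
        intro k
        apply Measurable.ennreal_ofReal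
        apply Continuous.measurable
        have a1 : Continuous (Dk κ v g ξ ε N k) := (h1 (k+1)).sub (h1 k)
        have a2 := S.cont_r k
        have a3 := S.cont_X k
        have a4 := hL.continuous
        fun_prop
      rw [lintegral_add_right _ (by fun_prop), lintegral_const_mul _ (by fun_prop), lintegral_const_mul _ (by fun_prop),
        lintegral_finset_sum _ (fun k _ => mm2 k), lintegral_add_left measurable_const, lintegral_const, one_mul, S.mu0_univ]
      calc _ ≤ ENNReal.ofReal 2 * ENNReal.ofReal (16 * (∫ p, ‖phat v g p - W p‖ ^ 2 ∂(PP κ)) + ε * (16 * (∫ p, (|g p| + L) ^ 2 ∂(PP κ))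
             + 4 * (∫ p, (|g p| + 0) ^ 2 ∂(PP κ)) + 32 * s ^ 2 * VB d R)) + ENNReal.ofReal (ε * cc) * (ENNReal.ofReal M + ENNReal.ofReal (C0f v g κ)) := by
            gcongr
            · exact S.energy hs hL
            · exact S.H.mass 0
            · exact S.ES
        _ = _ := by
          have q1 : 0 ≤ ∫ p, ‖phat v g p - W p‖ ^ 2 ∂(PP κ) := integral_nonneg fun p => by positivity
          have q2 : 0 ≤ ∫ p, (|g p| + L) ^ 2 ∂(PP κ) := integral_nonneg fun p => by positivity
          have q3 : 0 ≤ ∫ p, (|g p| + 0) ^ 2 ∂(PP κ) := integral_nonneg fun p => by positivity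
          have q4 : 0 ≤ C0f v g κ := C0f_nonneg
          rw [← ENNReal.ofReal_add hM.le q4, ← ENNReal.ofReal_mul (by norm_num), ← ENNReal.ofReal_mul (by positivity), ← ENNReal.ofReal_add (by positivity) (by positivity)]
          congr 1
          unfold Cff
          rw [← hcc]
          ring
    · apply Measurable.ennreal_ofReal
      apply Continuous.measurable
      have := ev_cont1 (d := d) ((j:ℝ)/N)
      have := ev_cont1 (d := d) 0
      fun_prop
    · exact mP
end
end

section
open ProbabilityTheory

theorem path_compact (C a : ℝ) (ha : 0 ≤ a) : IsCompact {z : PathE d | ‖ev z 0‖ ≤ C ∧ ∀ s ∈ Icc (0:ℝ) 1, ∀ t ∈ Icc (0:ℝ) 1, ‖ev z t - ev z s‖ ^ 2 ≤ a * |t - s|} := by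
  set S := {z : PathE d | ‖ev z 0‖ ≤ C ∧ ∀ s ∈ Icc (0:ℝ) 1, ∀ t ∈ Icc (0:ℝ) 1, ‖ev z t - ev z s‖ ^ 2 ≤ a * |t - s|} with hS
  have hev : ∀ (z : PathE d) (t : unitInterval), ev z (t:ℝ) = z t := by
    intro z t; unfold ev; rw [projIcc_val]
  have hH : ∀ z ∈ S, ∀ s t : unitInterval, dist (z t) (z s) ≤ Real.sqrt (a * |(t:ℝ) - s|) := by
    intro z hz s t
    have := hz.2 s s.2 t t.2
    rw [hev, hev] at this
    rw [dist_eq_norm]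
    exact Real.le_sqrt_of_sq_le this
  have hcl : IsClosed S := by
    refine IsClosed.inter ?_ ?_
    · exact isClosed_le (ev_cont1 0).norm continuous_const
    · show IsClosed {z : PathE d | ∀ s ∈ Icc (0:ℝ) 1, ∀ t ∈ Icc (0:ℝ) 1, ‖ev z t - ev z s‖ ^ 2 ≤ a * |t - s|}
      simp only [setOf_forall]
      refine isClosed_iInter fun s => isClosed_iInter fun _ => isClosed_iInter fun t => isClosed_iInter fun _ => ?_
      exact isClosed_le (((ev_cont1 t).sub (ev_cont1 s)).norm.pow 2) continuous_const
  let e := (ContinuousMap.isometryEquivBoundedOfCompact unitInterval (ℝ × Euc d)).toHomeomorph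
  have he : ∀ z : PathE d, ∀ t, e z t = z t := fun z t => rfl
  have hc : IsCompact (e '' S) := by
    refine BoundedContinuousFunction.arzela_ascoli₂ (Metric.closedBall 0 (C + Real.sqrt a)) (isCompact_closedBall _ _) _ ?_ ?_ ?_
    · exact (e.isClosed_image).2 hcl
    · rintro _ t ⟨z, hz, rfl⟩
      rw [he, mem_closedBall_zero_iff]
      have h1 := hH z hz 0 t
      have h2 : ‖z 0‖ ≤ C := by have := hz.1; rwa [← hev z 0]
      have h3 : Real.sqrt (a * |(t:ℝ) - (0:unitInterval)|) ≤ Real.sqrt a := by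
        apply Real.sqrt_le_sqrt
        have h4 : |(t:ℝ) - (0:unitInterval)| ≤ 1 := by
          have h5 := t.2.1; have h6 := t.2.2
          simp only [Set.Icc.coe_zero, sub_zero]; rw [abs_of_nonneg h5]; exact h6
        nlinarith
      rw [dist_eq_norm] at h1
      calc ‖z t‖ = ‖z 0 + (z t - z 0)‖ := by congr 1; abel
        _ ≤ ‖z 0‖ + ‖z t - z 0‖ := norm_add_le _ _
        _ ≤ _ := by linarith
    · refine Metric.equicontinuous_of_continuity_modulus (fun r => Real.sqrt (a * r)) ?_ _ ?_
      · have : Continuous fun r => Real.sqrt (a * r) := by fun_prop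
        have h := this.tendsto 0
        simpa using h
      · rintro x y ⟨_, z, hz, rfl⟩
        have := hH z hz y x
        exact this
  have := hc.image e.symm.continuous
  rwa [← image_comp, e.symm_comp_self, image_id] at this

theorem limit_le {E : Type*} [TopologicalSpace E] [MeasurableSpace E] [OpensMeasurableSpace E] {σs : ℕ → FiniteMeasure E} {σ : FiniteMeasure E} {U : Filter ℕ} [U.NeBot]
    (hU : Tendsto σs U (𝓝 σ)) {Φ : E → ℝ} (hΦ : Continuous Φ) {c : ℕ → ℝ≥0∞} {c0 : ℝ≥0∞} (hc : Tendsto c U (𝓝 c0))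
    (h : ∀ᶠ n in U, ∫⁻ z, ENNReal.ofReal (Φ z) ∂(σs n : Measure E) ≤ c n) : ∫⁻ z, ENNReal.ofReal (Φ z) ∂(σ : Measure E) ≤ c0 := by
  let f : ℕ → BoundedContinuousFunction E ℝ≥0 := fun k => BoundedContinuousFunction.mkOfBound ⟨fun z => min (k:ℝ≥0) (Φ z).toNNReal, by fun_prop⟩ k (by
    intro x y
    show dist (min (k:ℝ≥0) (Φ x).toNNReal) (min (k:ℝ≥0) (Φ y).toNNReal) ≤ k
    rw [NNReal.dist_eq, abs_le]
    have h1 : ((min (k:ℝ≥0) (Φ x).toNNReal : ℝ≥0) : ℝ) ≤ k := by exact_mod_cast min_le_left _ _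
    have h2 : ((min (k:ℝ≥0) (Φ y).toNNReal : ℝ≥0) : ℝ) ≤ k := by exact_mod_cast min_le_left _ _
    have h3 := (min (k:ℝ≥0) (Φ x).toNNReal).2
    have h4 := (min (k:ℝ≥0) (Φ y).toNNReal).2
    constructor <;> linarith)
  have hf : ∀ k z, f k z = min (k:ℝ≥0) (Φ z).toNNReal := fun k z => rfl
  have hle : ∀ k, ∫⁻ z, f k z ∂(σ : Measure E) ≤ c0 := by
    intro k
    have := (FiniteMeasure.tendsto_iff_forall_lintegral_tendsto.1 hU) (f k)
    refine le_of_tendsto_of_tendsto this hc ?_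
    filter_upwards [h] with n hn
    refine (lintegral_mono fun z => ?_).trans hn
    rw [hf, ENNReal.ofReal]
    exact ENNReal.coe_le_coe.2 (min_le_right _ _)
  have hlim : Tendsto (fun k => ∫⁻ z, f k z ∂(σ : Measure E)) atTop (𝓝 (∫⁻ z, ENNReal.ofReal (Φ z) ∂(σ : Measure E))) := by
    refine lintegral_tendsto_of_tendsto_of_monotone (fun k => ?_) (Eventually.of_forall fun z i j hij => ?_) (Eventually.of_forall fun z => ?_)
    · exact (f k).continuous.measurable.coe_nnreal_ennreal.aemeasurable
    · simp only [hf]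
      have : ((i:ℕ):ℝ≥0) ≤ j := by exact_mod_cast hij
      exact_mod_cast min_le_min_right _ this
    · obtain ⟨k0, hk0⟩ := exists_nat_ge (Φ z).toNNReal
      refine tendsto_const_nhds.congr' ?_
      filter_upwards [eventually_ge_atTop k0] with k hk
      rw [hf, min_eq_right (hk0.trans (by exact_mod_cast hk))]; rfl
  exact le_of_tendsto' hlim hle

theorem limit_closed {E : Type*} [MetricSpace E] [MeasurableSpace E] [BorelSpace E] {σs : ℕ → FiniteMeasure E} {σ : FiniteMeasure E} {U : Filter ℕ} [U.NeBot]
    (hU : Tendsto σs U (𝓝 σ)) {F : Set E} (hF : IsClosed F) (h : ∀ᶠ n in U, ∀ᵐ z ∂(σs n : Measure E), z ∈ F) : ∀ᵐ z ∂(σ : Measure E), z ∈ F := by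
  rcases F.eq_empty_or_nonempty with rfl | hne
  · have h1 : ∫⁻ z, ENNReal.ofReal ((fun _ => 1 : E → ℝ) z) ∂(σ : Measure E) ≤ 0 := by
      refine limit_le (c := fun _ => 0) hU continuous_const tendsto_const_nhds ?_
      filter_upwards [h] with n hn
      rw [lintegral_congr_ae (g := fun _ => 0)]
      · simp
      · filter_upwards [hn] with z hz; exact hz.elim
    have h2 : (σ : Measure E) univ = 0 := by simpa using h1
    rw [Measure.measure_univ_eq_zero] at h2
    rw [h2]; simp
  · have h1 : ∫⁻ z, ENNReal.ofReal (Metric.infDist z F) ∂(σ : Measure E) ≤ 0 := by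
      refine limit_le (c := fun _ => 0) hU (Metric.continuous_infDist_pt F) tendsto_const_nhds ?_
      filter_upwards [h] with n hn
      rw [lintegral_congr_ae (g := fun _ => 0)]
      · simp
      · filter_upwards [hn] with z hz; simp [Metric.infDist_zero_of_mem hz]
    have h2 := (lintegral_eq_zero_iff (Metric.continuous_infDist_pt F).measurable.ennreal_ofReal).1 (le_antisymm h1 bot_le)
    filter_upwards [h2] with z hz
    have h3 : Metric.infDist z F = 0 := le_antisymm (by simpa using hz) Metric.infDist_nonneg
    exact (hF.mem_iff_infDist_zero hne).2 h3
end

section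
open ProbabilityTheory

structure Lift0 (v : XX d → Euc d) (g : XX d → ℝ) (κ : Kernel ℝ (Euc d)) (R : ℝ) (σ : Measure (PathE d)) : Prop where
  mass : σ univ = κ 0 univ
  start : ∀ᵐ z ∂σ, (ev z 0).1 = 1
  cone : ∀ᵐ z ∂σ, ∀ t ∈ Icc (0:ℝ) 1, 0 ≤ (ev z t).1 ∧ ‖(ev z t).2‖ ≤ (R + 2) * (ev z t).1
  dom : ∀ t ∈ Icc (0:ℝ) 1, ∀ (ψ : Euc d → ℝ) (s : ℝ) (L : ℝ≥0), (∀ x, 0 ≤ ψ x) → (∀ x, ψ x ≤ s) → LipschitzWith L ψ →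
    ∫⁻ z, ENNReal.ofReal (max (ev z t).1 0 * hom (fun p => ψ p.2) 0 (ev z t)) ∂σ ≤ ENNReal.ofReal (∫ x, ψ x ∂(κ t))
  eq : ∀ t ∈ Icc (0:ℝ) 1, ∀ (W : XX d → ℝ × Euc d) (s : ℝ) (L : ℝ≥0), (∀ p, ‖W p‖ ≤ s) → LipschitzWith L W →
    ∫⁻ z, ENNReal.ofReal (‖ev z t - ev z 0 - ∫ τ in (0:ℝ)..t, hom W τ (ev z τ)‖ ^ 2) ∂σ ≤
      ENNReal.ofReal (32 * (∫ p, ‖phat v g p - W p‖ ^ 2 ∂(PP κ)))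

theorem dyadic_ext {σ : Measure (PathE d)} {Φ : PathE d → ℝ → ℝ} (hΦ : ∀ z, Continuous (Φ z)) (hΦ2 : ∀ t, Continuous fun z => Φ z t) {c : ℝ → ℝ} (hc : Continuous c)
    (h : ∀ m j : ℕ, j ≤ 2 ^ m → ∫⁻ z, ENNReal.ofReal (Φ z ((j:ℝ)/(2^m:ℕ))) ∂σ ≤ ENNReal.ofReal (c ((j:ℝ)/(2^m:ℕ)))) :
    ∀ t ∈ Icc (0:ℝ) 1, ∫⁻ z, ENNReal.ofReal (Φ z t) ∂σ ≤ ENNReal.ofReal (c t) := by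
  intro t ht
  let j : ℕ → ℕ := fun m => ⌊t * (2^m:ℕ)⌋₊
  have hj : ∀ m, j m ≤ 2 ^ m := by
    intro m
    apply Nat.floor_le_of_le
    have : (0:ℝ) ≤ (2^m:ℕ) := by positivity
    nlinarith [ht.2]
  have hlim : Tendsto (fun m => ((j m : ℕ):ℝ)/(2^m:ℕ)) atTop (𝓝 t) := by
    have h1 := (tendsto_nat_floor_mul_div_atTop (R := ℝ) ht.1).comp ((tendsto_natCast_atTop_atTop (R := ℝ)).comp (tendsto_pow_atTop_atTop_of_one_lt (r := (2:ℕ)) (by norm_num)))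
    exact h1
  have hpt : ∀ z, Tendsto (fun m => ENNReal.ofReal (Φ z (((j m : ℕ):ℝ)/(2^m:ℕ)))) atTop (𝓝 (ENNReal.ofReal (Φ z t))) := fun z =>
    (ENNReal.continuous_ofReal.tendsto _).comp (((hΦ z).tendsto t).comp hlim)
  have hr : Tendsto (fun m => ENNReal.ofReal (c (((j m : ℕ):ℝ)/(2^m:ℕ)))) atTop (𝓝 (ENNReal.ofReal (c t))) :=
    (ENNReal.continuous_ofReal.tendsto _).comp ((hc.tendsto t).comp hlim)
  calc _ = ∫⁻ z, liminf (fun m => ENNReal.ofReal (Φ z (((j m : ℕ):ℝ)/(2^m:ℕ)))) atTop ∂σ := lintegral_congr fun z => ((hpt z).liminf_eq).symm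
    _ ≤ liminf (fun m => ∫⁻ z, ENNReal.ofReal (Φ z (((j m : ℕ):ℝ)/(2^m:ℕ))) ∂σ) atTop := lintegral_liminf_le fun m => (hΦ2 _).measurable.ennreal_ofReal
    _ ≤ liminf (fun m => ENNReal.ofReal (c (((j m : ℕ):ℝ)/(2^m:ℕ)))) atTop := liminf_le_liminf (Eventually.of_forall fun m => h m _ (hj m))
    _ = _ := hr.liminf_eq

section
variable {v : XX d → Euc d} {g : XX d → ℝ} {κ : Kernel ℝ (Euc d)} {R M : ℝ}

theorem exists_Appr (H : CED v g κ R M) (n : ℕ) : ∃ K, n ≤ K ∧ ∃ σ, Appr v g κ R M (C0f v g κ) (Cff v g κ R M) K (1/((n:ℝ)+1)) σ := by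
  obtain ⟨K, hK, ξ, C, S⟩ := exists_Sch H (ε := 1/((n:ℝ)+1)) (by positivity) (by rw [div_le_one (by positivity)]; linarith [n.cast_nonneg (α := ℝ)]) n
  exact ⟨K, hK, S.appr⟩

theorem exists_Lift0 (H : CED v g κ R M) : ∃ σ : FiniteMeasure (PathE d), Lift0 v g κ R (σ : Measure (PathE d)) := by
  haveI := H.fin
  choose K hK σ0 hA using exists_Appr H
  have hfin : ∀ n, IsFiniteMeasure (σ0 n) := fun n => ⟨by rw [(hA n).mass]; exact measure_lt_top _ _⟩
  let σs : ℕ → FiniteMeasure (PathE d) := fun n => ⟨σ0 n, hfin n⟩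
  have hσ : ∀ n, (σs n : Measure (PathE d)) = σ0 n := fun n => rfl
  let KK : ℕ → Set (PathE d) := fun m => {z : PathE d | ‖ev z 0‖ ≤ R + 2 ∧ ∀ s ∈ Icc (0:ℝ) 1, ∀ t ∈ Icc (0:ℝ) 1, ‖ev z t - ev z s‖ ^ 2 ≤ ((m:ℝ)+1) * |t - s|}
  let u : ℕ → ℝ≥0 := fun m => (C0f v g κ / ((m:ℝ)+1)).toNNReal
  have hu : Tendsto u atTop (𝓝 0) := by
    have h1 : Tendsto (fun m : ℕ => C0f v g κ / ((m:ℝ)+1)) atTop (𝓝 0) :=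
      tendsto_const_nhds.div_atTop (tendsto_atTop_add_const_right _ _ tendsto_natCast_atTop_atTop)
    have := (continuous_real_toNNReal.tendsto 0).comp h1
    rw [Real.toNNReal_zero] at this
    exact this
  have hcomp := isCompact_setOfPred_finiteMeasure_mass_le_compl_isCompact_le (E := PathE d) (u := u) (K := KK) (κ 0 univ).toNNReal hu
    (fun m => path_compact _ _ (by positivity)) (Or.inl inferInstance)
  have hR := H.hR
  have hmass : ∀ n, (σs n).mass = (κ 0 univ).toNNReal := by
    intro n
    show ((σs n : Measure (PathE d)) univ).toNNReal = _
    rw [hσ, (hA n).mass]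
  have hmem : ∀ n, σs n ∈ {μ : FiniteMeasure (PathE d) | μ.mass ≤ (κ 0 univ).toNNReal ∧ ∀ n, μ (KK n)ᶜ ≤ u n} := by
    intro n
    refine ⟨(hmass n).le, fun m => ?_⟩
    rw [← ENNReal.coe_le_coe, FiniteMeasure.ennreal_coeFn_eq_coeFn_toMeasure, hσ]
    refine (measure_mono_ae ?_).trans ((hA n).hold ((m:ℝ)+1) (by positivity))
    filter_upwards [(hA n).start, (hA n).cone] with z h1 h2 hz
    intro h3
    apply hz
    refine ⟨?_, h3⟩
    rw [Prod.norm_def, h1]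
    have := (h2 0 ⟨le_rfl, zero_le_one⟩).2
    rw [h1, mul_one] at this
    simp only [norm_one]
    exact max_le (by linarith) this
  let U : Ultrafilter ℕ := Ultrafilter.of atTop
  have hUa : (U : Filter ℕ) ≤ atTop := Ultrafilter.of_le atTop
  obtain ⟨σ, -, hlim⟩ := hcomp.ultrafilter_le_nhds (U.map σs) (by
    rw [le_principal_iff]; exact Filter.mem_map.2 (univ_mem' hmem))
  have hlim : Tendsto σs U (𝓝 σ) := hlim
  have hε : Tendsto (fun n : ℕ => 1/((n:ℝ)+1)) U (𝓝 0) := tendsto_one_div_add_atTop_nhds_zero_nat.mono_left hUa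
  have hidx : ∀ m j : ℕ, j ≤ 2 ^ m → ∀ᶠ n in U, ∃ j', j' ≤ 2 ^ (K n) ∧ ((j':ℕ):ℝ)/(2^(K n):ℕ) = (j:ℝ)/(2^m:ℕ) := by
    intro m j hj
    filter_upwards [hUa (eventually_ge_atTop m)] with n hn
    obtain ⟨q, hq⟩ := Nat.exists_eq_add_of_le (hn.trans (hK n))
    refine ⟨j * 2 ^ q, ?_, ?_⟩
    · rw [hq, pow_add]; exact Nat.mul_le_mul_right _ hj
    · rw [hq, pow_add]; push_cast
      field_simp
  refine ⟨σ, ?_, ?_, ?_, ?_, ?_⟩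
  · have h1 : Tendsto (fun n => (σs n).mass) U (𝓝 σ.mass) := ((FiniteMeasure.continuous_mass).tendsto σ).comp hlim
    simp only [hmass] at h1
    have h2 := tendsto_nhds_unique h1 tendsto_const_nhds
    rw [← FiniteMeasure.ennreal_mass, h2, ENNReal.coe_toNNReal (measure_ne_top _ _)]
  · refine limit_closed (F := {z : PathE d | (ev z 0).1 = 1}) hlim (isClosed_eq (continuous_fst.comp (ev_cont1 0)) continuous_const) (Eventually.of_forall fun n => (hA n).start)
  · refine limit_closed (F := {z : PathE d | ∀ t ∈ Icc (0:ℝ) 1, 0 ≤ (ev z t).1 ∧ ‖(ev z t).2‖ ≤ (R + 2) * (ev z t).1}) hlim ?_ (Eventually.of_forall fun n => (hA n).cone)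
    simp only [setOf_forall]
    refine isClosed_iInter fun t => isClosed_iInter fun _ => ?_
    have c1 : Continuous fun z : PathE d => (ev z t).1 := continuous_fst.comp (ev_cont1 t)
    have c2 : Continuous fun z : PathE d => (ev z t).2 := continuous_snd.comp (ev_cont1 t)
    exact (isClosed_le continuous_const c1).inter (isClosed_le c2.norm (continuous_const.mul c1))
  · intro t ht ψ s L h0 hs hL
    have hLp : LipschitzWith L fun p : XX d => ψ p.2 := by
      have := hL.comp (LipschitzWith.prod_snd (α := ℝ) (β := Euc d)); simp only [mul_one] at this; exact this
    have hbd : ∀ p : XX d, ‖ψ p.2‖ ≤ s := fun p => by rw [Real.norm_of_nonneg (h0 _)]; exact hs _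
    have hj : Continuous fun q : PathE d × ℝ => max (ev q.1 q.2).1 0 * hom (fun p => ψ p.2) 0 (ev q.1 q.2) :=
      ((continuous_fst.comp ev_cont2).max continuous_const).mul ((hom_cont hLp.continuous hbd).comp (continuous_const.prodMk ev_cont2))
    refine dyadic_ext (Φ := fun z t => max (ev z t).1 0 * hom (fun p => ψ p.2) 0 (ev z t)) (c := fun t => ∫ x, ψ x ∂(κ t)) (fun z => hj.comp (continuous_const.prodMk continuous_id))
      (fun t => hj.comp (continuous_id.prodMk continuous_const)) (H.cont ψ hL.continuous) ?_ t ht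
    intro m j hjm
    refine limit_le (c := fun n => ENNReal.ofReal ((1 + 1/((n:ℝ)+1)) * ((∫ x, ψ x ∂(κ ((j:ℝ)/(2^m:ℕ)))) + 1/((n:ℝ)+1) * (L * M + s * VB d R)))) hlim (hj.comp (continuous_id.prodMk continuous_const)) ?_ ?_
    · refine (ENNReal.continuous_ofReal.tendsto _).comp ?_
      have := ((hε.const_add 1).mul ((hε.mul_const (L * M + s * VB d R)).const_add (∫ x, ψ x ∂(κ ((j:ℝ)/(2^m:ℕ))))))
      simpa only [add_zero, zero_mul, one_mul] using this
    · filter_upwards [hidx m j hjm] with n ⟨j', hj', he⟩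
      have := (hA n).dom j' hj' ψ s L h0 hs hL
      rw [he] at this
      exact this
  · intro t ht W s L hs hL
    have hhc := hom_cont hL.continuous hs
    have hi : Continuous fun q : PathE d × ℝ => ∫ τ in (0:ℝ)..q.2, hom W τ (ev q.1 τ) := by
      apply intervalIntegral.continuous_parametric_intervalIntegral_of_continuous (f := fun (q : PathE d × ℝ) τ => hom W τ (ev q.1 τ)) 
      · exact hhc.comp (continuous_snd.prodMk (ev_cont2.comp ((continuous_fst.comp continuous_fst).prodMk continuous_snd)))
      · exact continuous_snd
    have hj : Continuous fun q : PathE d × ℝ => ‖ev q.1 q.2 - ev q.1 0 - ∫ τ in (0:ℝ)..q.2, hom W τ (ev q.1 τ)‖ ^ 2 :=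
      (((ev_cont2).sub ((ev_cont1 0).comp continuous_fst)).sub hi).norm.pow 2
    refine dyadic_ext (Φ := fun z t => ‖ev z t - ev z 0 - ∫ τ in (0:ℝ)..t, hom W τ (ev z τ)‖ ^ 2) (c := fun t => 32 * (∫ p, ‖phat v g p - W p‖ ^ 2 ∂(PP κ))) (fun z => hj.comp (continuous_const.prodMk continuous_id))
      (fun t => hj.comp (continuous_id.prodMk continuous_const)) continuous_const ?_ t ht
    intro m j hjm
    refine limit_le (c := fun n => ENNReal.ofReal (32 * (∫ p, ‖phat v g p - W p‖ ^ 2 ∂(PP κ)) + 1/((n:ℝ)+1) * Cff v g κ R M s L)) hlim (hj.comp (continuous_id.prodMk continuous_const)) ?_ ?_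
    · refine (ENNReal.continuous_ofReal.tendsto _).comp ?_
      have := ((hε.mul_const (Cff v g κ R M s L)).const_add (32 * (∫ p, ‖phat v g p - W p‖ ^ 2 ∂(PP κ))))
      simpa only [add_zero, zero_mul, one_mul] using this
    · filter_upwards [hidx m j hjm] with n ⟨j', hj', he⟩
      have := (hA n).eq j' hj' W s L hs hL
      rw [he] at this
      exact this
end
end

section
open ProbabilityTheory

def rp (z : PathE d) (t : ℝ) : ℝ := max (ev z t).1 0
def gm (z : PathE d) (t : ℝ) : Euc d := (rp z t)⁻¹ • (ev z t).2

theorem rp_nn (z : PathE d) (t : ℝ) : 0 ≤ rp z t := le_max_right _ _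

theorem rp_cont2 : Continuous fun q : PathE d × ℝ => rp q.1 q.2 := (continuous_fst.comp ev_cont2).max continuous_const
theorem gm_meas2 : Measurable fun q : PathE d × ℝ => gm q.1 q.2 :=
  rp_cont2.measurable.inv.smul (continuous_snd.comp ev_cont2).measurable
theorem rp_cont (z : PathE d) : Continuous (rp z) := rp_cont2.comp (continuous_const.prodMk continuous_id)
theorem rp_cont1 (t : ℝ) : Continuous fun z : PathE d => rp z t := rp_cont2.comp (continuous_id.prodMk continuous_const)
theorem gm_meas (z : PathE d) : Measurable (gm z) := gm_meas2.comp (measurable_const.prodMk measurable_id)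
theorem gm_meas1 (t : ℝ) : Measurable fun z : PathE d => gm z t := gm_meas2.comp (measurable_id.prodMk measurable_const)

theorem hom_ev {F : Type*} [NormedAddCommGroup F] [NormedSpace ℝ F] (W : XX d → F) (z : PathE d) (t : ℝ) : hom W t (ev z t) = rp z t • W (t, gm z t) := rfl

def nu (σ : Measure (PathE d)) (t : ℝ) : Measure (Euc d) := (σ.withDensity fun z => ENNReal.ofReal (rp z t ^ 2)).map fun z => gm z t

theorem lintegral_nu (σ : Measure (PathE d)) (t : ℝ) {f : Euc d → ℝ≥0∞} (hf : Measurable f) :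
    ∫⁻ x, f x ∂(nu σ t) = ∫⁻ z, ENNReal.ofReal (rp z t ^ 2) * f (gm z t) ∂σ := by
  unfold nu
  have m1 : Measurable fun z : PathE d => ENNReal.ofReal (rp z t ^ 2) := ((rp_cont1 t).pow 2).measurable.ennreal_ofReal
  rw [lintegral_map hf (gm_meas1 t)]
  exact lintegral_withDensity_eq_lintegral_mul _ m1 (hf.comp (gm_meas1 t))

section
variable {v : XX d → Euc d} {g : XX d → ℝ} {κ : Kernel ℝ (Euc d)} {R M : ℝ} {σ : Measure (PathE d)}

theorem Lift0.nu_le (H : CED v g κ R M) (S : Lift0 v g κ R σ) {t : ℝ} (ht : t ∈ Icc (0:ℝ) 1) : nu σ t ≤ κ t := by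
  haveI := H.fin
  have key : ∀ ψ : Euc d → ℝ≥0, ∀ L, LipschitzWith L ψ → (∀ x, ψ x ≤ 1) → ∫⁻ x, ψ x ∂(nu σ t) ≤ ∫⁻ x, ψ x ∂(κ t) := by
    intro ψ L hL h1
    rw [lintegral_nu σ t hL.continuous.measurable.coe_nnreal_ennreal]
    have hL2 : LipschitzWith L fun x => (ψ x : ℝ) := by
      have := NNReal.isometry_coe.lipschitz.comp hL; simp only [one_mul] at this; exact this
    have h2 := S.dom t ht (fun x => (ψ x : ℝ)) 1 L (fun x => (ψ x).2) (fun x => by exact_mod_cast h1 x) hL2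
    rw [ofReal_integral_eq_lintegral_ofReal] at h2
    · simp only [ENNReal.ofReal_coe_nnreal] at h2
      refine le_trans (le_of_eq (lintegral_congr fun z => ?_)) h2
      rw [hom]
      show _ = ENNReal.ofReal (rp z t * (rp z t • (ψ (gm z t) : ℝ)))
      rw [smul_eq_mul, ← mul_assoc, ← sq, ENNReal.ofReal_mul (by positivity), ENNReal.ofReal_coe_nnreal]
    · refine (integrable_const (1:ℝ)).mono' hL2.continuous.aestronglyMeasurable (Eventually.of_forall fun x => ?_)
      have e : ‖((ψ x : ℝ≥0) : ℝ)‖ = (ψ x : ℝ) := NNReal.norm_eq _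
      refine e.le.trans ?_
      exact_mod_cast h1 x
    · exact Eventually.of_forall fun x => (ψ x).2
  have hfin : IsFiniteMeasure (nu σ t) := by
    constructor
    have := key (fun _ => 1) 0 (LipschitzWith.const 1) (fun _ => le_rfl)
    simp only [ENNReal.coe_one, lintegral_const, one_mul] at this
    exact this.trans_lt (measure_lt_top _ _)
  have hcl : ∀ F, IsClosed F → nu σ t F ≤ κ t F := by
    intro F hF
    have hp : ∀ n : ℕ, (0:ℝ) < 1 / ((n:ℝ)+1) := fun n => by positivity
    have l1 := tendsto_lintegral_thickenedIndicator_of_isClosed (nu σ t) hF hp tendsto_one_div_add_atTop_nhds_zero_nat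
    have l2 := tendsto_lintegral_thickenedIndicator_of_isClosed (κ t) hF hp tendsto_one_div_add_atTop_nhds_zero_nat
    exact le_of_tendsto_of_tendsto' l1 l2 fun n => key _ _ (lipschitzWith_thickenedIndicator (hp n) F) fun x => thickenedIndicator_le_one _ _ _
  refine Measure.le_iff.2 fun A hA => ?_
  rw [hA.measure_eq_iSup_isClosed_of_ne_top (measure_ne_top _ _)]
  exact iSup_le fun F => iSup_le fun hFA => iSup_le fun hF => (hcl F hF).trans (measure_mono hFA)

theorem Lift0.lint_le (H : CED v g κ R M) (S : Lift0 v g κ R σ) [SFinite σ] {f : XX d → ℝ≥0∞} (hf : Measurable f) :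
    ∫⁻ z, (∫⁻ t in Ioc (0:ℝ) 1, ENNReal.ofReal (rp z t ^ 2) * f (t, gm z t)) ∂σ ≤ ∫⁻ p, f p ∂(PP κ) := by
  haveI := H.fin
  rw [lintegral_lintegral_swap]
  · unfold PP
    rw [Measure.lintegral_compProd hf]
    refine setLIntegral_mono' measurableSet_Ioc fun t ht => ?_
    have := lintegral_nu σ t (f := fun x => f (t, x)) (hf.comp (measurable_const.prodMk measurable_id))
    rw [← this]
    exact lintegral_mono' (S.nu_le H ⟨ht.1.le, ht.2⟩) le_rfl
  · apply Measurable.aemeasurable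
    exact (rp_cont2.pow 2).measurable.ennreal_ofReal.mul (hf.comp (measurable_snd.prodMk gm_meas2))

theorem Lift0.start_law (H : CED v g κ R M) (S : Lift0 v g κ R σ) : nu σ 0 = κ 0 := by
  haveI := H.fin
  haveI : IsFiniteMeasure (nu σ 0) := ⟨((S.nu_le H ⟨le_rfl, zero_le_one⟩) univ).trans_lt (measure_lt_top _ _)⟩
  refine Measure.eq_of_le_of_measure_univ_eq (S.nu_le H ⟨le_rfl, zero_le_one⟩) ?_
  have := lintegral_nu σ 0 (f := fun _ => 1) measurable_const
  rw [lintegral_one] at this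
  rw [this, ← S.mass, ← lintegral_one]
  refine lintegral_congr_ae ?_
  filter_upwards [S.start] with z hz
  unfold rp; rw [hz]; simp
end
end

section
open ProbabilityTheory

theorem cs01 {F : Type*} [NormedAddCommGroup F] [NormedSpace ℝ F] {f : ℝ → F} (hf : MemLp f 2 (volume.restrict (Ioc (0:ℝ) 1))) {t : ℝ} (ht : t ∈ Icc (0:ℝ) 1) :
    ‖∫ s in (0:ℝ)..t, f s‖ ^ 2 ≤ ∫ s in Ioc (0:ℝ) 1, ‖f s‖ ^ 2 := by
  have i1 : Integrable f (volume.restrict (Ioc (0:ℝ) 1)) := hf.integrable (by norm_num)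
  have i2 : Integrable (fun s => ‖f s‖ ^ 2) (volume.restrict (Ioc (0:ℝ) 1)) := hf.integrable_norm_pow (by norm_num)
  set a := ∫ s in Ioc (0:ℝ) 1, ‖f s‖ with ha
  have h1 : ‖∫ s in (0:ℝ)..t, f s‖ ≤ a := by
    rw [intervalIntegral.integral_of_le ht.1]
    refine (norm_integral_le_integral_norm _).trans ?_
    exact setIntegral_mono_set i1.norm (Eventually.of_forall fun s => norm_nonneg _) (Ioc_subset_Ioc_right ht.2).eventuallyLE
  have h2 : 0 ≤ ∫ s in Ioc (0:ℝ) 1, (‖f s‖ ^ 2 - (2 * a) * ‖f s‖ + a ^ 2) := integral_nonneg fun s => by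
    show 0 ≤ ‖f s‖ ^ 2 - (2 * a) * ‖f s‖ + a ^ 2
    nlinarith [sq_nonneg (‖f s‖ - a)]
  have i3 : Integrable (fun s => (2 * a) * ‖f s‖) (volume.restrict (Ioc (0:ℝ) 1)) := i1.norm.const_mul _
  have i4 : Integrable (fun s => ‖f s‖ ^ 2 - (2 * a) * ‖f s‖) (volume.restrict (Ioc (0:ℝ) 1)) := i2.sub i3
  rw [integral_add i4 (integrable_const _), integral_sub i2 i3, integral_const_mul, ← ha, integral_const] at h2
  simp only [measureReal_restrict_apply_univ, Real.volume_real_Ioc, sub_zero, max_eq_left (zero_le_one (α := ℝ)), one_smul] at h2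
  have h3 : ‖∫ s in (0:ℝ)..t, f s‖ ^ 2 ≤ a ^ 2 := by gcongr
  nlinarith

section
variable {v : XX d → Euc d} {g : XX d → ℝ} {κ : Kernel ℝ (Euc d)} {R M : ℝ} {σ : Measure (PathE d)}

structure Good (v : XX d → Euc d) (g : XX d → ℝ) (R : ℝ) (z : PathE d) : Prop where
  start : (ev z 0).1 = 1
  cone : ∀ t ∈ Icc (0:ℝ) 1, 0 ≤ (ev z t).1 ∧ ‖(ev z t).2‖ ≤ (R + 2) * (ev z t).1
  en : MemLp (fun t => rp z t • phat v g (t, gm z t)) 2 (volume.restrict (Ioc (0:ℝ) 1))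
  eq : ∀ t ∈ Icc (0:ℝ) 1, ev z t = ev z 0 + ∫ s in (0:ℝ)..t, rp z s • phat v g (s, gm z s)

theorem memLp2_of_lintegral {F : Type*} [NormedAddCommGroup F] {α : Type*} [MeasurableSpace α] {μ : Measure α} {f : α → F} (hf : AEStronglyMeasurable f μ)
    (h : ∫⁻ x, ENNReal.ofReal (‖f x‖ ^ 2) ∂μ < ⊤) : MemLp f 2 μ := by
  rw [memLp_two_iff_integrable_sq_norm hf]
  refine ⟨hf.norm.pow 2, ?_⟩
  rw [hasFiniteIntegral_iff_norm]
  refine lt_of_le_of_lt (lintegral_mono fun x => ?_) h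
  rw [Real.norm_of_nonneg (by positivity)]

theorem approx_W (H : CED v g κ R M) {δ : ℝ} (hδ : 0 < δ) : ∃ (W : XX d → ℝ × Euc d) (s : ℝ) (L : ℝ≥0), (∀ p, ‖W p‖ ≤ s) ∧ LipschitzWith L W ∧
    ∫⁻ p, ENNReal.ofReal (‖phat v g p - W p‖ ^ 2) ∂(PP κ) ≤ ENNReal.ofReal δ := by
  haveI := H.finPP
  obtain ⟨W, hWc, hWs, hW⟩ := MemLp.exist_eLpNorm_sub_le (p := 2) (by norm_num) (by norm_num) H.phat_memLp (Real.sqrt_pos.2 hδ)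
  obtain ⟨L, hL⟩ := ContDiff.lipschitzWith_of_hasCompactSupport hWc hWs (by simp)
  obtain ⟨s, hs⟩ := hWs.continuous.bounded_above_of_compact_support hWc
  refine ⟨W, s, L, hs, hL, ?_⟩
  have h2 : eLpNorm (phat v g - W) 2 (PP κ) ^ 2 ≤ ENNReal.ofReal δ := by
    calc _ ≤ ENNReal.ofReal (Real.sqrt δ) ^ 2 := by gcongr
      _ = _ := by rw [← ENNReal.ofReal_pow (by positivity), Real.sq_sqrt hδ.le]
  have h3 := eLpNorm_nnreal_pow_eq_lintegral (f := phat v g - W) (μ := PP κ) (p := 2) (by norm_num)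
  simp only [NNReal.coe_ofNat, ENNReal.rpow_ofNat, ENNReal.coe_ofNat] at h3
  rw [h3] at h2
  refine le_trans (le_of_eq (lintegral_congr fun p => ?_)) h2
  rw [ENNReal.ofReal_pow (norm_nonneg _), ofReal_norm]; rfl

theorem meas_hp (H : CED v g κ R M) : Measurable fun q : PathE d × ℝ => rp q.1 q.2 • phat v g (q.2, gm q.1 q.2) :=
  rp_cont2.measurable.smul (H.m_phat.comp (measurable_snd.prodMk gm_meas2))

theorem Lift0.good (H : CED v g κ R M) [IsFiniteMeasure σ] (S : Lift0 v g κ R σ) : ∀ᵐ z ∂σ, Good v g R z := by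
  haveI := H.finPP
  have mhp := meas_hp H
  have mz : ∀ z : PathE d, Measurable fun t => rp z t • phat v g (t, gm z t) := fun z => mhp.comp (measurable_const.prodMk measurable_id)
  -- energy
  have hE : ∀ᵐ z ∂σ, MemLp (fun t => rp z t • phat v g (t, gm z t)) 2 (volume.restrict (Ioc (0:ℝ) 1)) := by
    have h1 := S.lint_le H (f := fun p => ENNReal.ofReal (‖phat v g p‖ ^ 2)) (H.m_phat.norm.pow_const 2).ennreal_ofReal
    have h2 : ∫⁻ p, ENNReal.ofReal (‖phat v g p‖ ^ 2) ∂(PP κ) < ⊤ := by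
      rw [← ofReal_integral_eq_lintegral_ofReal (H.phat_memLp.integrable_norm_pow (by norm_num)) (Eventually.of_forall fun p => by positivity)]
      exact ENNReal.ofReal_lt_top
    have h3 := ae_lt_top (μ := σ) (f := fun z => ∫⁻ t in Ioc (0:ℝ) 1, ENNReal.ofReal (rp z t ^ 2) * ENNReal.ofReal (‖phat v g (t, gm z t)‖ ^ 2)) ?_ (h1.trans_lt h2).ne
    · filter_upwards [h3] with z hz
      refine memLp2_of_lintegral (mz z).aestronglyMeasurable ?_
      refine lt_of_le_of_lt (lintegral_mono fun t => ?_) hz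
      rw [norm_smul, mul_pow, Real.norm_of_nonneg (rp_nn _ _), ENNReal.ofReal_mul (by positivity)]
    · refine Measurable.lintegral_prod_right' (f := fun q : PathE d × ℝ => ENNReal.ofReal (rp q.1 q.2 ^ 2) * ENNReal.ofReal (‖phat v g (q.2, gm q.1 q.2)‖ ^ 2)) ?_
      exact (rp_cont2.pow 2).measurable.ennreal_ofReal.mul ((H.m_phat.comp (measurable_snd.prodMk gm_meas2)).norm.pow_const 2).ennreal_ofReal
  choose! W s L hs hL hW using fun n : ℕ => approx_W H (δ := 1/((n:ℝ)+1)) (by positivity)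
  have key : ∀ t ∈ Icc (0:ℝ) 1, ∀ᵐ z ∂σ, ev z t = ev z 0 + ∫ s in (0:ℝ)..t, rp z s • phat v g (s, gm z s) := by
    intro t ht
    let A : ℕ → PathE d → ℝ≥0∞ := fun n z => ENNReal.ofReal (‖ev z t - ev z 0 - ∫ τ in (0:ℝ)..t, hom (W n) τ (ev z τ)‖ ^ 2)
    let B : ℕ → PathE d → ℝ≥0∞ := fun n z => ∫⁻ τ in Ioc (0:ℝ) 1, ENNReal.ofReal (rp z τ ^ 2) * ENNReal.ofReal (‖phat v g (τ, gm z τ) - W n (τ, gm z τ)‖ ^ 2)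
    have mA : ∀ n, Measurable (A n) := by
      intro n
      have hc2 : Continuous fun z : PathE d => ∫ τ in (0:ℝ)..t, hom (W n) τ (ev z τ) := by
        apply intervalIntegral.continuous_parametric_intervalIntegral_of_continuous'
        exact (hom_cont (hL n).continuous (hs n)).comp (continuous_snd.prodMk ev_cont2)
      exact ((((ev_cont1 t).sub (ev_cont1 0)).sub hc2).norm.pow 2).measurable.ennreal_ofReal
    have mB : ∀ n, Measurable (B n) := by
      intro n
      refine Measurable.lintegral_prod_right' (f := fun q : PathE d × ℝ => ENNReal.ofReal (rp q.1 q.2 ^ 2) * ENNReal.ofReal (‖phat v g (q.2, gm q.1 q.2) - W n (q.2, gm q.1 q.2)‖ ^ 2)) ?_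
      have := (hL n).continuous.measurable
      exact (rp_cont2.pow 2).measurable.ennreal_ofReal.mul (((H.m_phat.sub this).comp (measurable_snd.prodMk gm_meas2)).norm.pow_const 2).ennreal_ofReal
    have iB : ∀ n, ∫⁻ z, B n z ∂σ ≤ ENNReal.ofReal (1/((n:ℝ)+1)) := fun n =>
      (S.lint_le H (f := fun p => ENNReal.ofReal (‖phat v g p - W n p‖ ^ 2)) ((H.m_phat.sub (hL n).continuous.measurable).norm.pow_const 2).ennreal_ofReal).trans (hW n)
    have iA : ∀ n, ∫⁻ z, A n z ∂σ ≤ ENNReal.ofReal 32 * ENNReal.ofReal (1/((n:ℝ)+1)) := by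
      intro n
      refine (S.eq t ht (W n) (s n) (L n) (hs n) (hL n)).trans ?_
      rw [ENNReal.ofReal_mul (by norm_num)]
      gcongr
      have iw : MemLp (W n) 2 (PP κ) := (memLp_const (s n)).mono' (hL n).continuous.aestronglyMeasurable (Eventually.of_forall (hs n))
      have id : Integrable (fun p => ‖phat v g p - W n p‖ ^ 2) (PP κ) := (H.phat_memLp.sub iw).integrable_norm_pow (by norm_num)
      have h5 := hW n
      rwa [← ofReal_integral_eq_lintegral_ofReal id (Eventually.of_forall fun p => by positivity), ENNReal.ofReal_le_ofReal_iff (by positivity)] at h5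
    have hlim : ∫⁻ z, liminf (fun n => A n z + B n z) atTop ∂σ ≤ 0 := by
      refine (lintegral_liminf_le fun n => (mA n).add (mB n)).trans ?_
      have h6 : Tendsto (fun n : ℕ => ENNReal.ofReal (33 * (1/((n:ℝ)+1)))) atTop (𝓝 0) := by
        have := (ENNReal.continuous_ofReal.tendsto _).comp ((tendsto_one_div_add_atTop_nhds_zero_nat (𝕜 := ℝ)).const_mul 33)
        simp only [mul_zero, ENNReal.ofReal_zero] at this
        exact this
      rw [← h6.liminf_eq]
      refine liminf_le_liminf (Eventually.of_forall fun n => ?_)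
      show ∫⁻ z, (A n z + B n z) ∂σ ≤ _
      rw [lintegral_add_left (mA n)]
      refine (add_le_add (iA n) (iB n)).trans (le_of_eq ?_)
      rw [← ENNReal.ofReal_mul (by norm_num), ← ENNReal.ofReal_add (by positivity) (by positivity)]
      congr 1; ring
    have h7 := (lintegral_eq_zero_iff (Measurable.liminf fun n => (mA n).add (mB n))).1 (le_antisymm hlim bot_le)
    filter_upwards [h7, hE] with z hz hEz
    by_contra hne
    set Δ := ‖ev z t - ev z 0 - ∫ s in (0:ℝ)..t, rp z s • phat v g (s, gm z s)‖ ^ 2 with hΔ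
    have hΔ0 : 0 < Δ := by
      have : ev z t - ev z 0 - ∫ s in (0:ℝ)..t, rp z s • phat v g (s, gm z s) ≠ 0 := by
        intro h0; apply hne; rw [sub_sub, sub_eq_zero] at h0; exact h0
      have := norm_pos_iff.2 this
      positivity
    have hfr : ∃ᶠ n in atTop, A n z + B n z < ENNReal.ofReal (Δ / 2) := by
      refine frequently_lt_of_liminf_lt ?_ ?_
      · isBoundedDefault
      · have hz' : liminf (fun n => A n z + B n z) atTop = 0 := hz
        rw [hz']; simpa using hΔ0
    obtain ⟨n, hn⟩ := hfr.exists
    have mW : MemLp (fun τ => hom (W n) τ (ev z τ)) 2 (volume.restrict (Ioc (0:ℝ) 1)) := by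
      have hcz : Continuous (fun τ => hom (W n) τ (ev z τ)) := (hom_cont (hL n).continuous (hs n)).comp (continuous_id.prodMk (ev_cont z))
      obtain ⟨C, hC⟩ := isCompact_Icc.exists_bound_of_continuousOn (s := Icc (0:ℝ) 1) hcz.continuousOn
      refine (memLp_const C).mono' hcz.aestronglyMeasurable ?_
      exact (ae_restrict_iff' measurableSet_Ioc).2 (Eventually.of_forall fun τ hτ => hC τ ⟨hτ.1.le, hτ.2⟩)
    have mD : MemLp (fun τ => rp z τ • phat v g (τ, gm z τ) - hom (W n) τ (ev z τ)) 2 (volume.restrict (Ioc (0:ℝ) 1)) := hEz.sub mW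
    have h8 := cs01 mD ht
    have hB : ENNReal.ofReal (∫ s in Ioc (0:ℝ) 1, ‖rp z s • phat v g (s, gm z s) - hom (W n) s (ev z s)‖ ^ 2) = B n z := by
      rw [ofReal_integral_eq_lintegral_ofReal (mD.integrable_norm_pow (by norm_num)) (Eventually.of_forall fun p => by positivity)]
      refine lintegral_congr fun τ => ?_
      rw [hom_ev, ← smul_sub, norm_smul, mul_pow, Real.norm_of_nonneg (rp_nn _ _), ENNReal.ofReal_mul (sq_nonneg (rp z τ))]
    have ii : ∀ {f : ℝ → ℝ × Euc d}, MemLp f 2 (volume.restrict (Ioc (0:ℝ) 1)) → IntervalIntegrable f volume 0 t := by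
      intro f hf
      rw [intervalIntegrable_iff_integrableOn_Ioc_of_le ht.1]
      have h9 : IntegrableOn f (Ioc 0 1) := hf.integrable (by norm_num)
      exact h9.mono_set (Ioc_subset_Ioc_right ht.2)
    rw [intervalIntegral.integral_sub (ii hEz) (ii mW)] at h8
    have h10 : Δ ≤ 2 * ‖ev z t - ev z 0 - ∫ τ in (0:ℝ)..t, hom (W n) τ (ev z τ)‖ ^ 2 + 2 * ∫ s in Ioc (0:ℝ) 1, ‖rp z s • phat v g (s, gm z s) - hom (W n) s (ev z s)‖ ^ 2 := by
      have e : ev z t - ev z 0 - ∫ s in (0:ℝ)..t, rp z s • phat v g (s, gm z s) = (ev z t - ev z 0 - ∫ τ in (0:ℝ)..t, hom (W n) τ (ev z τ)) -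
        ((∫ s in (0:ℝ)..t, rp z s • phat v g (s, gm z s)) - ∫ τ in (0:ℝ)..t, hom (W n) τ (ev z τ)) := by abel
      have hno := norm_sub_le (ev z t - ev z 0 - ∫ τ in (0:ℝ)..t, hom (W n) τ (ev z τ)) 
        ((∫ s in (0:ℝ)..t, rp z s • phat v g (s, gm z s)) - ∫ τ in (0:ℝ)..t, hom (W n) τ (ev z τ))
      rw [← e] at hno
      have h11 := pow_le_pow_left₀ (norm_nonneg _) hno 2
      rw [← hΔ] at h11
      nlinarith [sq_nonneg (‖ev z t - ev z 0 - ∫ τ in (0:ℝ)..t, hom (W n) τ (ev z τ)‖ - ‖(∫ s in (0:ℝ)..t, rp z s • phat v g (s, gm z s)) - ∫ τ in (0:ℝ)..t, hom (W n) τ (ev z τ)‖)]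
    have nn1 : 0 ≤ ∫ s in Ioc (0:ℝ) 1, ‖rp z s • phat v g (s, gm z s) - hom (W n) s (ev z s)‖ ^ 2 := integral_nonneg fun _ => by positivity
    rw [← hB, ← ENNReal.ofReal_add (by positivity) nn1, ENNReal.ofReal_lt_ofReal_iff (by positivity)] at hn
    linarith
  have hq : ∀ᵐ z ∂σ, ∀ q : ℚ, (q:ℝ) ∈ Icc (0:ℝ) 1 → ev z q = ev z 0 + ∫ s in (0:ℝ)..q, rp z s • phat v g (s, gm z s) := by
    rw [ae_all_iff]; intro q
    by_cases hq : (q:ℝ) ∈ Icc (0:ℝ) 1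
    · filter_upwards [key q hq] with z hz _ using hz
    · exact Eventually.of_forall fun z h => (hq h).elim
  filter_upwards [hq, hE, S.start, S.cone] with z h1 h2 h3 h4
  refine ⟨h3, h4, h2, ?_⟩
  have hintg : IntegrableOn (fun s => rp z s • phat v g (s, gm z s)) (Icc (0:ℝ) 1) := by
    rw [integrableOn_Icc_iff_integrableOn_Ioc]; exact h2.integrable (by norm_num)
  have hc : ContinuousOn (fun t => ev z 0 + ∫ s in (0:ℝ)..t, rp z s • phat v g (s, gm z s)) (Icc (0:ℝ) 1) := by
    refine continuousOn_const.add ?_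
    have := intervalIntegral.continuousOn_primitive_interval (a := 0) (b := 1) (μ := volume) (f := fun s => rp z s • phat v g (s, gm z s)) (by rwa [uIcc_of_le zero_le_one])
    rwa [uIcc_of_le zero_le_one] at this
  have heq : EqOn (ev z) (fun t => ev z 0 + ∫ s in (0:ℝ)..t, rp z s • phat v g (s, gm z s)) (Ioo 0 1) := by
    have hd : Ioo (0:ℝ) 1 ⊆ closure (Ioo (0:ℝ) 1 ∩ range ((↑) : ℚ → ℝ)) := by
      have := (Rat.denseRange_cast (𝕜 := ℝ)).open_subset_closure_inter (isOpen_Ioo (a := (0:ℝ)) (b := 1))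
      exact this
    refine EqOn.of_subset_closure (s := Ioo (0:ℝ) 1 ∩ range ((↑) : ℚ → ℝ)) ?_ (ev_cont z).continuousOn (hc.mono Ioo_subset_Icc_self) (inter_subset_left) hd
    rintro _ ⟨hx, q, rfl⟩
    exact h1 q ⟨hx.1.le, hx.2.le⟩
  have hcl : EqOn (ev z) (fun t => ev z 0 + ∫ s in (0:ℝ)..t, rp z s • phat v g (s, gm z s)) (Icc 0 1) := by
    refine heq.of_subset_closure (ev_cont z).continuousOn hc Ioo_subset_Icc_self ?_
    rw [closure_Ioo (by norm_num)]
  exact fun t ht => hcl ht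
end
end

section
open ProbabilityTheory

theorem hom_lip0 {F : Type*} [NormedAddCommGroup F] [NormedSpace ℝ F] {W : XX d → F} {s : ℝ} (hs : ∀ p, ‖W p‖ ≤ s) {L : ℝ≥0} (hL : LipschitzWith L W) {C : ℝ} (hC : 0 ≤ C)
    {t t' : ℝ} {z z' : ℝ × Euc d} (hz : 0 ≤ z.1) (hz' : 0 ≤ z'.1) (hc : ‖z.2‖ ≤ C * z.1) :
    ‖hom W t z - hom W t' z'‖ ≤ L * (z'.1 * |t - t'|) + (s + L * (1 + C)) * ‖z - z'‖ := by
  have hcont := hom_cont hL.continuous hs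
  have c1 : Continuous fun e : ℝ => ‖hom W t (z.1 + e, z.2) - hom W t' (z'.1 + e, z'.2)‖ := by
    have a1 : Continuous fun e : ℝ => hom W t (z.1 + e, z.2) := hcont.comp (by fun_prop : Continuous fun e : ℝ => (t, (z.1 + e, z.2)))
    have a2 : Continuous fun e : ℝ => hom W t' (z'.1 + e, z'.2) := hcont.comp (by fun_prop : Continuous fun e : ℝ => (t', (z'.1 + e, z'.2)))
    exact (a1.sub a2).norm
  have c2 : Continuous fun e : ℝ => L * ((z'.1 + e) * |t - t'|) + (s + L * (1 + C)) * ‖z - z'‖ := by fun_prop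
  have h1 : Tendsto (fun e : ℝ => ‖hom W t (z.1 + e, z.2) - hom W t' (z'.1 + e, z'.2)‖) (𝓝[>] 0) (𝓝 ‖hom W t z - hom W t' z'‖) := by
    have := (c1.tendsto 0).mono_left (nhdsWithin_le_nhds (s := Ioi 0))
    simp only [add_zero] at this
    exact this
  have h2 : Tendsto (fun e : ℝ => L * ((z'.1 + e) * |t - t'|) + (s + L * (1 + C)) * ‖z - z'‖) (𝓝[>] 0) (𝓝 (L * (z'.1 * |t - t'|) + (s + L * (1 + C)) * ‖z - z'‖)) := by
    have := (c2.tendsto 0).mono_left (nhdsWithin_le_nhds (s := Ioi 0))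
    simp only [add_zero] at this
    exact this
  refine le_of_tendsto_of_tendsto h1 h2 ?_
  filter_upwards [self_mem_nhdsWithin] with e (he : 0 < e)
  have := hom_lip hs hL hC (t := t) (t' := t') (z := (z.1 + e, z.2)) (z' := (z'.1 + e, z'.2)) (by dsimp only; linarith) (by dsimp only; linarith)
    (by dsimp only; nlinarith)
  have e1 : ((z.1 + e, z.2) : ℝ × Euc d) - (z'.1 + e, z'.2) = z - z' := by
    ext1 <;> simp
  rw [e1] at this
  exact this

theorem ftc_dom {F f m : ℝ → ℝ} {b : ℝ} (hb : 0 ≤ b) (hm : IntervalIntegrable m volume 0 b)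
    (hF : ∀ s ∈ Icc (0:ℝ) b, ∀ t ∈ Icc (0:ℝ) b, s ≤ t → |F t - F s| ≤ ∫ u in s..t, m u)
    (hd : ∀ᵐ t : ℝ, t ∈ Ioo 0 b → HasDerivAt F (f t) t) : ∫ t in (0:ℝ)..b, f t = F b - F 0 := by
  have hG := hm.absolutelyContinuousOnInterval_intervalIntegral (c := 0) (by simp)
  have key : ∀ s ∈ Icc (0:ℝ) b, ∀ t ∈ Icc (0:ℝ) b, dist (F s) (F t) ≤ dist (∫ u in (0:ℝ)..s, m u) (∫ u in (0:ℝ)..t, m u) := by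
    have k1 : ∀ s ∈ Icc (0:ℝ) b, ∀ t ∈ Icc (0:ℝ) b, s ≤ t → dist (F s) (F t) ≤ dist (∫ u in (0:ℝ)..s, m u) (∫ u in (0:ℝ)..t, m u) := by
      intro s hs t ht hst
      have i : ∀ x ∈ Icc (0:ℝ) b, IntervalIntegrable m volume 0 x := fun x hx => hm.mono_set (by
        rw [uIcc_of_le hb, uIcc_of_le hx.1]; exact Icc_subset_Icc_right hx.2)
      rw [dist_comm, dist_comm (∫ u in (0:ℝ)..s, m u), Real.dist_eq, Real.dist_eq, intervalIntegral.integral_interval_sub_left (i t ht) (i s hs)]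
      exact (hF s hs t ht hst).trans (le_abs_self _)
    intro s hs t ht
    rcases le_total s t with h | h
    · exact k1 s hs t ht h
    · rw [dist_comm, dist_comm (∫ u in (0:ℝ)..s, m u)]; exact k1 t ht s hs h
  have hAC : AbsolutelyContinuousOnInterval F 0 b := by
    rw [absolutelyContinuousOnInterval_iff] at hG ⊢
    intro ε hε
    obtain ⟨δ, hδ, h⟩ := hG ε hε
    refine ⟨δ, hδ, fun E hE hs => lt_of_le_of_lt (Finset.sum_le_sum fun i hi => ?_) (h E hE hs)⟩
    have := hE.1 i hi
    rw [uIcc_of_le hb] at this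
    exact key _ this.1 _ this.2
  rw [← hAC.integral_deriv_eq_sub]
  apply intervalIntegral.integral_congr_ae
  have hne : ∀ᵐ t : ℝ, t ≠ b := by simp [ae_iff, measure_singleton]
  filter_upwards [hd, hne] with t h1 h2 h3
  rw [uIoc_of_le hb] at h3
  exact (h1 ⟨h3.1, lt_of_le_of_ne h3.2 h2⟩).deriv.symm

section
variable {v : XX d → Euc d} {g : XX d → ℝ} {κ : Kernel ℝ (Euc d)} {R M : ℝ} {σ : Measure (PathE d)} {z : PathE d}

theorem Good.ii (G : Good v g R z) : IntervalIntegrable (fun s => rp z s • phat v g (s, gm z s)) volume 0 1 := by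
  rw [intervalIntegrable_iff_integrableOn_Ioc_of_le zero_le_one]
  exact G.en.integrable (by norm_num)

theorem Good.rp_eq (G : Good v g R z) {t : ℝ} (ht : t ∈ Icc (0:ℝ) 1) : rp z t = (ev z t).1 := max_eq_left (G.cone t ht).1

theorem Good.gm_eq (G : Good v g R z) {t : ℝ} (ht : t ∈ Icc (0:ℝ) 1) : rp z t • gm z t = (ev z t).2 := by
  unfold gm
  by_cases h : rp z t = 0
  · have := (G.cone t ht).2
    rw [← G.rp_eq ht, h, mul_zero] at this
    rw [h, zero_smul, norm_le_zero_iff.1 this]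
  · rw [smul_smul, mul_inv_cancel₀ h, one_smul]

theorem Good.gm_le (G : Good v g R z) (hR : 0 < R) {t : ℝ} (ht : t ∈ Icc (0:ℝ) 1) : ‖gm z t‖ ≤ R + 2 := by
  unfold gm
  by_cases h : rp z t = 0
  · rw [h, inv_zero, zero_smul, norm_zero]; linarith
  · have h1 : 0 < rp z t := lt_of_le_of_ne (rp_nn _ _) (Ne.symm h)
    rw [norm_smul, norm_inv, Real.norm_of_nonneg h1.le, inv_mul_le_iff₀ h1, mul_comm]
    have := (G.cone t ht).2
    rwa [← G.rp_eq ht] at this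

theorem Good.incr (G : Good v g R z) {s t : ℝ} (hs : s ∈ Icc (0:ℝ) 1) (ht : t ∈ Icc (0:ℝ) 1) (hst : s ≤ t) :
    ‖ev z t - ev z s‖ ≤ ∫ u in s..t, ‖rp z u • phat v g (u, gm z u)‖ := by
  have i : ∀ x ∈ Icc (0:ℝ) 1, IntervalIntegrable (fun s => rp z s • phat v g (s, gm z s)) volume 0 x := fun x hx => G.ii.mono_set (by
        rw [uIcc_of_le zero_le_one, uIcc_of_le hx.1]; exact Icc_subset_Icc_right hx.2)
  rw [G.eq t ht, G.eq s hs, add_sub_add_left_eq_sub, intervalIntegral.integral_interval_sub_left (i t ht) (i s hs)]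
  exact intervalIntegral.norm_integral_le_integral_norm hst

theorem Good.dev (G : Good v g R z) : ∀ᵐ t : ℝ, t ∈ Ioo (0:ℝ) 1 → HasDerivAt (ev z) (rp z t • phat v g (t, gm z t)) t := by
  filter_upwards [G.ii.ae_hasDerivAt_integral] with t h ht
  have h1 := h (by rw [uIcc_of_le zero_le_one]; exact ⟨ht.1.le, ht.2.le⟩) 0 (by simp)
  refine (h1.const_add (ev z 0)).congr_of_eventuallyEq ?_
  filter_upwards [Ioo_mem_nhds ht.1 ht.2] with s hs
  exact G.eq s ⟨hs.1.le, hs.2.le⟩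

theorem Good.derivs (G : Good v g R z) : ∀ᵐ t : ℝ, t ∈ Ioo (0:ℝ) 1 → 0 < rp z t →
    HasDerivAt (rp z) (rp z t * (g (t, gm z t) / 2)) t ∧ HasDerivAt (gm z) (v (t, gm z t)) t := by
  filter_upwards [G.dev] with t h ht hp
  have h0 := h ht
  have hr : HasDerivAt (fun s => (ev z s).1) (rp z t * (g (t, gm z t) / 2)) t :=
    (ContinuousLinearMap.fst ℝ ℝ (Euc d)).hasFDerivAt.comp_hasDerivAt t h0
  have hy : HasDerivAt (fun s => (ev z s).2) (rp z t • (v (t, gm z t) + (g (t, gm z t) / 2) • gm z t)) t :=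
    (ContinuousLinearMap.snd ℝ ℝ (Euc d)).hasFDerivAt.comp_hasDerivAt t h0
  have hI : Ioo (0:ℝ) 1 ∈ 𝓝 t := Ioo_mem_nhds ht.1 ht.2
  have hr2 : HasDerivAt (rp z) (rp z t * (g (t, gm z t) / 2)) t := by
    refine hr.congr_of_eventuallyEq ?_
    filter_upwards [hI] with s hs
    exact G.rp_eq ⟨hs.1.le, hs.2.le⟩
  refine ⟨hr2, ?_⟩
  have hg := (hr2.inv hp.ne').smul hy
  refine (hg.congr_of_eventuallyEq (Eventually.of_forall fun s => rfl)).congr_deriv ?_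
  have e : (ev z t).2 = rp z t • gm z t := (G.gm_eq ⟨ht.1.le, ht.2.le⟩).symm
  rw [e, Pi.inv_apply, smul_smul, inv_mul_cancel₀ hp.ne', one_smul, smul_smul]
  have e2 : -(rp z t * (g (t, gm z t) / 2)) / rp z t ^ 2 * rp z t = - (g (t, gm z t) / 2) := by field_simp
  rw [e2, neg_smul]; abel

theorem rp_bdd (z : PathE d) : ∃ B, 0 ≤ B ∧ ∀ t ∈ Icc (0:ℝ) 1, rp z t ≤ B := by
  obtain ⟨B, hB⟩ := (isCompact_Icc (a := (0:ℝ)) (b := 1)).bddAbove_image (rp_cont z).continuousOn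
  refine ⟨max B 0, le_max_right _ _, fun t ht => (hB ⟨t, ht, rfl⟩).trans (le_max_left _ _)⟩

theorem Good.pathCE (G : Good v g R z) (hR : 0 < R) {b : ℝ} (hb : b ∈ Icc (0:ℝ) 1) (hpos : ∀ t ∈ Ioo 0 b, 0 < rp z t)
    {φ : XX d → ℝ} (hφ : ContDiff ℝ (⊤ : ℕ∞) φ) (hc : HasCompactSupport φ) :
    ∫ t in (0:ℝ)..b, rp z t ^ 2 * (fderiv ℝ φ (t, gm z t) ((1:ℝ), v (t, gm z t)) + φ (t, gm z t) * g (t, gm z t)) =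
      rp z b ^ 2 * φ (b, gm z b) - rp z 0 ^ 2 * φ (0, gm z 0) := by
  obtain ⟨L, hL⟩ := ContDiff.lipschitzWith_of_hasCompactSupport hc hφ (by simp)
  obtain ⟨S, hS⟩ := hφ.continuous.bounded_above_of_compact_support hc
  have hS0 : 0 ≤ S := (norm_nonneg _).trans (hS (0, 0))
  obtain ⟨B, hB0, hB⟩ := rp_bdd z
  set K := B * S + B * (L * B + (S + L * (1 + (R + 2)))) with hK
  have hii : IntervalIntegrable (fun s => rp z s • phat v g (s, gm z s)) volume 0 b := G.ii.mono_set (by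
        rw [uIcc_of_le zero_le_one, uIcc_of_le hb.1]; exact Icc_subset_Icc_right hb.2)
  have hsub : Icc 0 b ⊆ Icc (0:ℝ) 1 := Icc_subset_Icc_right hb.2
  refine ftc_dom (F := fun t => rp z t ^ 2 * φ (t, gm z t)) (m := fun u => K * (1 + ‖rp z u • phat v g (u, gm z u)‖)) hb.1 ?_ ?_ ?_
  · exact (intervalIntegrable_const.add hii.norm).const_mul K
  · intro s hs t ht hst
    have hs1 := hsub hs
    have ht1 := hsub ht
    have e : ∀ u, rp z u ^ 2 * φ (u, gm z u) = rp z u * hom φ u (ev z u) := fun u => by rw [hom_ev, smul_eq_mul]; ring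
    have hin : IntervalIntegrable (fun s => rp z s • phat v g (s, gm z s)) volume s t := hii.mono_set (by
        rw [uIcc_of_le hb.1, uIcc_of_le hst]; exact Icc_subset_Icc hs.1 ht.2)
    have hI := G.incr hs1 ht1 hst
    have hI0 : (0:ℝ) ≤ ∫ u in s..t, ‖rp z u • phat v g (u, gm z u)‖ := (norm_nonneg _).trans hI
    have h1 : |rp z t - rp z s| ≤ ‖ev z t - ev z s‖ := by
      rw [G.rp_eq hs1, G.rp_eq ht1]; exact norm_fst_le (ev z t - ev z s)
    have h2 : |hom φ t (ev z t)| ≤ B * S := (hom_bd hS t (ev z t)).trans (mul_le_mul_of_nonneg_right (hB t ht1) hS0)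
    have h3 := hom_lip0 hS hL (C := R + 2) (by linarith) (t := t) (t' := s) (G.cone t ht1).1 (G.cone s hs1).1 (G.cone t ht1).2
    rw [← G.rp_eq hs1, Real.norm_eq_abs, abs_of_nonneg (sub_nonneg.2 hst)] at h3
    rw [intervalIntegral.integral_const_mul, intervalIntegral.integral_add intervalIntegrable_const hin.norm, intervalIntegral.integral_const, smul_eq_mul, mul_one]
    show |rp z t ^ 2 * φ (t, gm z t) - rp z s ^ 2 * φ (s, gm z s)| ≤ _
    rw [e, e]
    have e2 : rp z t * hom φ t (ev z t) - rp z s * hom φ s (ev z s) = (rp z t - rp z s) * hom φ t (ev z t) + rp z s * (hom φ t (ev z t) - hom φ s (ev z s)) := by ring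
    rw [e2]
    refine (abs_add_le _ _).trans ?_
    rw [abs_mul, abs_mul, abs_of_nonneg (rp_nn z s)]
    set I := ∫ u in s..t, ‖rp z u • phat v g (u, gm z u)‖
    set E := ‖ev z t - ev z s‖
    have hts : 0 ≤ t - s := sub_nonneg.2 hst
    have b1 : |rp z t - rp z s| * |hom φ t (ev z t)| ≤ I * (B * S) := mul_le_mul (h1.trans hI) h2 (abs_nonneg _) hI0
    have b2 : rp z s * |hom φ t (ev z t) - hom φ s (ev z s)| ≤ B * (L * (B * (t - s)) + (S + L * (1 + (R + 2))) * I) := by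
      refine mul_le_mul (hB s hs1) (h3.trans ?_) (abs_nonneg _) hB0
      have := hB s hs1
      gcongr
    have p1 : 0 ≤ B * S := by positivity
    have p2 : 0 ≤ B * (L * B) := by positivity
    have p3 : 0 ≤ B * (S + L * (1 + (R + 2))) := by positivity
    have q1 := mul_nonneg p1 hts
    have q2 := mul_nonneg p2 hI0
    have q3 := mul_nonneg p3 hts
    rw [hK]
    linarith
  · filter_upwards [G.derivs] with t h ht
    obtain ⟨hr, hg⟩ := h ⟨ht.1, ht.2.trans_le hb.2⟩ (hpos t ht)
    have hφd := (hφ.differentiable (by simp) (t, gm z t)).hasFDerivAt.comp_hasDerivAt t ((hasDerivAt_id t).prodMk hg)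
    have hp := (hr.pow 2).mul hφd
    refine (hp.congr_of_eventuallyEq (Eventually.of_forall fun s => rfl)).congr_deriv ?_
    simp only [Pi.pow_apply, Function.comp_apply, id]
    push_cast
    ring
end
end

section
open ProbabilityTheory

def tset (z : PathE d) : Set ℝ := {t | t ∈ Icc (0:ℝ) 1 ∧ (rp z t = 0 ∨ t = 1)}
def tz (z : PathE d) : ℝ := sInf (tset z)
theorem tset_bdd (z : PathE d) : BddBelow (tset z) := ⟨0, fun t ht => ht.1.1⟩
theorem tz_mem' (z : PathE d) : tz z ∈ tset z := by
  refine IsClosed.csInf_mem ?_ ⟨1, ⟨zero_le_one, le_rfl⟩, Or.inr rfl⟩ (tset_bdd z)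
  have : tset z = Icc 0 1 ∩ ({t | rp z t = 0} ∪ {1}) := by
    ext t; simp [tset, or_comm]
  rw [this]
  exact isClosed_Icc.inter ((isClosed_eq (rp_cont z) continuous_const).union isClosed_singleton)
theorem tz_mem (z : PathE d) : tz z ∈ Icc (0:ℝ) 1 := (tz_mem' z).1
theorem tz_end (z : PathE d) : rp z (tz z) = 0 ∨ tz z = 1 := (tz_mem' z).2
theorem tz_pos (z : PathE d) {t : ℝ} (h0 : 0 ≤ t) (ht : t < tz z) : 0 < rp z t := by
  refine lt_of_le_of_ne (rp_nn z t) (Ne.symm fun h => ?_)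
  exact absurd (csInf_le (tset_bdd z) ⟨⟨h0, ht.le.trans (tz_mem z).2⟩, Or.inl h⟩) (not_le.2 ht)
theorem le_tz (z : PathE d) {t : ℝ} (h1 : t ≤ 1) (h : ∀ s, 0 ≤ s → s < t → 0 < rp z s) : t ≤ tz z := by
  refine le_csInf ⟨_, tz_mem' z⟩ fun s hs => ?_
  by_contra! hlt
  rcases hs.2 with h2 | h2
  · exact (h s hs.1.1 hlt).ne' h2
  · linarith
theorem tz_meas : Measurable (tz (d := d)) := by
  apply measurable_of_Ioi
  intro t
  apply IsOpen.measurableSet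
  rcases lt_or_ge t 1 with h1 | h1
  swap
  · have : tz (d := d) ⁻¹' Ioi t = ∅ := by
      ext z; simp only [mem_preimage, mem_Ioi, mem_empty_iff_false, iff_false, not_lt]; exact (tz_mem z).2.trans h1
    rw [this]; exact isOpen_empty
  rw [isOpen_iff_mem_nhds]
  intro z (hz : t < tz z)
  have hP : ∀ s ∈ Icc 0 t, ∀ᶠ q : PathE d × ℝ in 𝓝 (z, s), 0 < rp q.1 q.2 := fun s hs =>
    rp_cont2.continuousAt.eventually (lt_mem_nhds (tz_pos z hs.1 (hs.2.trans_lt hz)))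
  have := IsCompact.eventually_forall_of_forall_eventually (P := fun (z : PathE d) (s : ℝ) => 0 < rp z s) (isCompact_Icc (a := (0:ℝ)) (b := t)) hP
  filter_upwards [this] with w hw
  show t < tz w
  by_contra! h
  rcases tz_end w with h2 | h2
  · exact (hw _ ⟨(tz_mem w).1, h⟩).ne' h2
  · linarith

def st (z : PathE d) (t : ℝ) : ℝ := min t (tz z)
def rs (z : PathE d) (t : ℝ) : ℝ := rp z (st z t)
def gs (z : PathE d) (t : ℝ) : Euc d := gm z (st z t)

theorem st_mem (z : PathE d) {t : ℝ} (ht : t ∈ Icc (0:ℝ) 1) : st z t ∈ Icc (0:ℝ) 1 := ⟨le_min ht.1 (tz_mem z).1, (min_le_left _ _).trans ht.2⟩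
theorem st_meas2 : Measurable fun q : PathE d × ℝ => st q.1 q.2 := measurable_snd.min (tz_meas.comp measurable_fst)
theorem rs_meas2 : Measurable fun q : PathE d × ℝ => rs q.1 q.2 := rp_cont2.measurable.comp (measurable_fst.prodMk st_meas2)
theorem gs_meas2 : Measurable fun q : PathE d × ℝ => gs q.1 q.2 := gm_meas2.comp (measurable_fst.prodMk st_meas2)
theorem rs_meas1 (t : ℝ) : Measurable fun z : PathE d => rs z t := rs_meas2.comp (measurable_id.prodMk measurable_const)
theorem gs_meas1 (t : ℝ) : Measurable fun z : PathE d => gs z t := gs_meas2.comp (measurable_id.prodMk measurable_const)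
theorem rs_nn (z : PathE d) (t : ℝ) : 0 ≤ rs z t := rp_nn _ _
theorem st_le {z : PathE d} {t : ℝ} (h : t ≤ tz z) : st z t = t := min_eq_left h
theorem rs_gt {z : PathE d} {t : ℝ} (h : tz z < t) (h1 : t ≤ 1) : rs z t = 0 := by
  unfold rs st
  rw [min_eq_right h.le]
  exact (tz_end z).resolve_right (by linarith)
theorem gs_gt {z : PathE d} {t : ℝ} (h : tz z < t) (h1 : t ≤ 1) : gs z t = 0 := by
  have : (rp z (st z t)) = 0 := rs_gt h h1
  unfold gs gm
  rw [this, inv_zero, zero_smul]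

def nuk (σ : Measure (PathE d)) (t : ℝ) : Measure (Euc d) := (σ.withDensity fun z => ENNReal.ofReal (rs z t ^ 2)).map fun z => gs z t

theorem lintegral_nuk (σ : Measure (PathE d)) (t : ℝ) {f : Euc d → ℝ≥0∞} (hf : Measurable f) :
    ∫⁻ x, f x ∂(nuk σ t) = ∫⁻ z, ENNReal.ofReal (rs z t ^ 2) * f (gs z t) ∂σ := by
  unfold nuk
  have m1 : Measurable fun z : PathE d => ENNReal.ofReal (rs z t ^ 2) := ((rs_meas1 t).pow_const 2).ennreal_ofReal
  rw [lintegral_map hf (gs_meas1 t)]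
  exact lintegral_withDensity_eq_lintegral_mul _ m1 (hf.comp (gs_meas1 t))

theorem integral_nuk (σ : Measure (PathE d)) (t : ℝ) {f : Euc d → ℝ} (hf : Measurable f) :
    ∫ x, f x ∂(nuk σ t) = ∫ z, rs z t ^ 2 * f (gs z t) ∂σ := by
  unfold nuk
  have m1 : Measurable fun z : PathE d => ENNReal.ofReal (rs z t ^ 2) := ((rs_meas1 t).pow_const 2).ennreal_ofReal
  rw [integral_map (gs_meas1 t).aemeasurable hf.aestronglyMeasurable,
    integral_withDensity_eq_integral_toReal_smul m1 (Eventually.of_forall fun z => ENNReal.ofReal_lt_top)]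
  refine integral_congr_ae (Eventually.of_forall fun z => ?_)
  dsimp only
  rw [ENNReal.toReal_ofReal (by positivity), smul_eq_mul]

theorem kill_le (z : PathE d) {t : ℝ} (h1 : t ≤ 1) (f : Euc d → ℝ≥0∞) :
    ENNReal.ofReal (rs z t ^ 2) * f (gs z t) ≤ ENNReal.ofReal (rp z t ^ 2) * f (gm z t) := by
  rcases le_or_gt t (tz z) with h | h
  · unfold rs gs; rw [st_le h]
  · rw [rs_gt h h1]; simp

theorem nuk_le_nu (σ : Measure (PathE d)) {t : ℝ} (h1 : t ≤ 1) : nuk σ t ≤ nu σ t := by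
  refine Measure.le_iff.2 fun A hA => ?_
  rw [← lintegral_indicator_one hA, ← lintegral_indicator_one hA, lintegral_nuk σ t (measurable_one.indicator hA), lintegral_nu σ t (measurable_one.indicator hA)]
  exact lintegral_mono fun z => kill_le z h1 _

theorem nuk_zero (σ : Measure (PathE d)) : nuk σ 0 = nu σ 0 := by
  unfold nuk nu rs gs st
  have : ∀ z : PathE d, min 0 (tz z) = 0 := fun z => min_eq_left (tz_mem z).1
  simp only [this]

section
variable {v : XX d → Euc d} {g : XX d → ℝ} {κ : Kernel ℝ (Euc d)} {R M : ℝ} {σ : Measure (PathE d)} {z : PathE d}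

def Q2 (v : XX d → Euc d) (g : XX d → ℝ) (z : PathE d) : ℝ≥0∞ := ∫⁻ t in Ioc (0:ℝ) 1, ENNReal.ofReal (rp z t ^ 2) * ENNReal.ofReal (‖phat v g (t, gm z t)‖ ^ 2)

theorem Lift0.iQ2 (H : CED v g κ R M) (S : Lift0 v g κ R σ) [SFinite σ] : Integrable (fun z => (Q2 v g z).toReal) σ := by
  have mf : Measurable fun p => ENNReal.ofReal (‖phat v g p‖ ^ 2) := (H.m_phat.norm.pow_const 2).ennreal_ofReal
  apply integrable_toReal_of_lintegral_ne_top
  · apply Measurable.aemeasurable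
    unfold Q2
    have : Measurable fun q : PathE d × ℝ => ENNReal.ofReal (rp q.1 q.2 ^ 2) * ENNReal.ofReal (‖phat v g (q.2, gm q.1 q.2)‖ ^ 2) :=
      (rp_cont2.pow 2).measurable.ennreal_ofReal.mul (mf.comp (measurable_snd.prodMk gm_meas2))
    exact this.lintegral_prod_right'
  · have h := S.lint_le H mf
    refine (lt_of_le_of_lt h ?_).ne
    have := (H.phat_memLp.integrable_norm_pow (by norm_num : (2:ℕ) ≠ 0)).lintegral_lt_top
    exact this

theorem Good.rp_sq (G : Good v g R z) {t : ℝ} (ht : t ∈ Icc (0:ℝ) 1) : rp z t ^ 2 ≤ 2 + 2 * (Q2 v g z).toReal := by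
  have h1 := cs01 G.en ht
  have e : ∫ s in Ioc (0:ℝ) 1, ‖rp z s • phat v g (s, gm z s)‖ ^ 2 = (Q2 v g z).toReal := by
    have ms : AEStronglyMeasurable (fun s => ‖rp z s • phat v g (s, gm z s)‖ ^ 2) (volume.restrict (Ioc (0:ℝ) 1)) := G.en.aestronglyMeasurable.norm.pow 2
    rw [integral_eq_lintegral_of_nonneg_ae (Eventually.of_forall fun s => (sq_nonneg _ : 0 ≤ ‖rp z s • phat v g (s, gm z s)‖ ^ 2)) ms]
    unfold Q2
    congr 1
    refine lintegral_congr fun s => ?_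
    rw [← ENNReal.ofReal_mul (by positivity), norm_smul, mul_pow, Real.norm_of_nonneg (rp_nn _ _)]
  rw [e] at h1
  set I := ∫ s in (0:ℝ)..t, rp z s • phat v g (s, gm z s)
  have h2 : rp z t ≤ 1 + ‖I‖ := by
    rw [G.rp_eq ht, G.eq t ht, Prod.fst_add, G.start]
    have := (le_abs_self _).trans (norm_fst_le I)
    linarith
  have h3 := rp_nn z t
  nlinarith [sq_nonneg (1 - ‖I‖), norm_nonneg I]

theorem nuk_cont (H : CED v g κ R M) (S : Lift0 v g κ R σ) [IsFiniteMeasure σ] {φ : Euc d → ℝ} (hφ : Continuous φ) :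
    ContinuousOn (fun t => ∫ x, φ x ∂(nuk σ t)) (Icc 0 1) := by
  -- bounded truncation
  have hR := H.hR
  obtain ⟨s0, hs0⟩ := (isCompact_closedBall (0 : Euc d) (R + 2)).exists_bound_of_continuousOn hφ.continuousOn
  set s := max s0 0
  set ψ : Euc d → ℝ := fun x => max (-s) (min s (φ x)) with hψ
  have s0' : 0 ≤ s := le_max_right _ _
  have hψc : Continuous fun p : XX d => ψ p.2 := by fun_prop
  have hψb : ∀ p : XX d, ‖ψ p.2‖ ≤ s := fun p => by
    rw [Real.norm_eq_abs, abs_le]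
    exact ⟨le_max_left _ _, max_le (by linarith) (min_le_left _ _)⟩
  have hψe : ∀ x, ‖x‖ ≤ R + 2 → φ x = ψ x := fun x hx => by
    have := (hs0 x (by simpa using hx)).trans (le_max_left _ _ : s0 ≤ s)
    rw [Real.norm_eq_abs, abs_le] at this
    rw [hψ]; dsimp only
    rw [min_eq_right this.2, max_eq_right this.1]
  simp_rw [integral_nuk σ _ hφ.measurable]
  refine continuousOn_of_dominated (bound := fun z => (2 + 2 * (Q2 v g z).toReal) * s) ?_ ?_ ?_ ?_
  · intro t _
    exact (((rs_meas1 t).pow_const 2).mul (hφ.measurable.comp (gs_meas1 t))).aestronglyMeasurable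
  · intro t ht
    filter_upwards [S.good H] with z G
    have h1 := G.rp_sq (st_mem z ht)
    have h2 := G.gm_le hR (st_mem z ht)
    rw [norm_mul, Real.norm_of_nonneg (by positivity)]
    unfold rs gs
    rw [hψe _ h2]
    exact mul_le_mul h1 (hψb (0, gm z (st z t))) (norm_nonneg _) (by positivity)
  · exact (((integrable_const (2:ℝ)).add ((S.iQ2 H).const_mul 2)).mul_const s)
  · filter_upwards [S.good H] with z G
    have hc : Continuous fun t => rp z (st z t) * hom (fun p : XX d => ψ p.2) 0 (ev z (st z t)) := by
      have c1 : Continuous (st z) := continuous_id.min continuous_const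
      refine ((rp_cont z).comp c1).mul ((hom_cont hψc hψb).comp (continuous_const.prodMk ((ev_cont z).comp c1)))
    refine hc.continuousOn.congr fun t ht => ?_
    have h2 := G.gm_le hR (st_mem z ht)
    show rs z t ^ 2 * φ (gs z t) = rp z (st z t) * (rp z (st z t) • ψ (gm z (st z t)))
    unfold rs gs
    rw [hψe _ h2, smul_eq_mul]; ring

end
end

section
open ProbabilityTheory

section
variable {v : XX d → Euc d} {g : XX d → ℝ} {κ : Kernel ℝ (Euc d)} {R M : ℝ} {σ : Measure (PathE d)} {z : PathE d}

theorem Good.stoppedCE (G : Good v g R z) (hR : 0 < R) {φ : XX d → ℝ} (hφ : IsTest φ) :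
    ∫ t in Ioo (0:ℝ) 1, rs z t ^ 2 * (fderiv ℝ φ (t, gs z t) ((1:ℝ), v (t, gs z t)) + φ (t, gs z t) * g (t, gs z t)) = 0 := by
  have hτ := tz_mem z
  set Ψ : ℝ → ℝ := fun t => rp z t ^ 2 * (fderiv ℝ φ (t, gm z t) ((1:ℝ), v (t, gm z t)) + φ (t, gm z t) * g (t, gm z t)) with hΨ
  have h := G.pathCE hR hτ (fun t ht => tz_pos z ht.1.le ht.2) hφ.1 hφ.2.1
  have hz : ∀ t x, t ∉ Ioo (0:ℝ) 1 → φ (t, x) = 0 := fun t x ht => by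
    by_contra hne
    exact ht (hφ.2.2 (subset_tsupport _ hne)).1
  have e0 : φ (0, gm z 0) = 0 := hz _ _ (by simp)
  have e1 : rp z (tz z) ^ 2 * φ (tz z, gm z (tz z)) = 0 := by
    rcases tz_end z with h1 | h1
    · rw [h1]; simp
    · rw [hz (tz z) _ (by rw [h1]; simp), mul_zero]
  rw [e0, e1, mul_zero, sub_zero] at h
  refine Eq.trans ?_ h
  rw [← integral_Ioc_eq_integral_Ioo, intervalIntegral.integral_of_le hτ.1]
  have hsub : Ioc 0 (tz z) ⊆ Ioc (0:ℝ) 1 := Ioc_subset_Ioc_right hτ.2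
  rw [setIntegral_eq_of_subset_of_forall_diff_eq_zero (t := Ioc (0:ℝ) 1) (s := Ioc 0 (tz z)) measurableSet_Ioc hsub]
  · refine setIntegral_congr_fun measurableSet_Ioc fun t ht => ?_
    unfold rs gs
    rw [st_le ht.2]
  · intro t ht
    have : tz z < t := by
      by_contra! h2
      exact ht.2 ⟨ht.1.1, h2⟩
    rw [rs_gt this ht.1.2]; simp

theorem nuk_CE (H : CED v g κ R M) (S : Lift0 v g κ R σ) [IsFiniteMeasure σ] : SolvesCE (nuk σ) v g := by
  intro φ hφ
  haveI := H.finPP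
  set Φ : XX d → ℝ := fun p => fderiv ℝ φ p ((1:ℝ), v p) + φ p * g p with hΦ
  have hdc : Continuous (fderiv ℝ φ) := hφ.1.continuous_fderiv (by simp)
  have m1 : Measurable fun p : XX d => fderiv ℝ φ p ((1:ℝ), v p) := by
    have h1 : Continuous (fun q : (XX d →L[ℝ] ℝ) × XX d => q.1 q.2) := by fun_prop
    exact h1.measurable.comp (hdc.measurable.prodMk (measurable_const.prodMk H.mv))
  have mΦ : Measurable Φ := m1.add (hφ.1.continuous.measurable.mul H.mg)
  obtain ⟨K, hK⟩ := hdc.bounded_above_of_compact_support (hφ.2.1.fderiv ℝ)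
  obtain ⟨K', hK'⟩ := hφ.1.continuous.bounded_above_of_compact_support hφ.2.1
  have iΦ : Integrable Φ (PP κ) := by
    refine Integrable.add ?_ ?_
    · refine Integrable.mono' (((integrable_const (1:ℝ)).add H.iv.norm).const_mul K) m1.aestronglyMeasurable (Eventually.of_forall fun p => ?_)
      refine ((fderiv ℝ φ p).le_opNorm _).trans ?_
      refine mul_le_mul (hK p) ?_ (norm_nonneg _) ((norm_nonneg _).trans (hK p))
      rw [Prod.norm_def]
      simp only [norm_one]
      exact max_le_add_of_nonneg zero_le_one (norm_nonneg _)
    · refine Integrable.mono' (H.ig.norm.const_mul K') (hφ.1.continuous.measurable.mul H.mg).aestronglyMeasurable (Eventually.of_forall fun p => ?_)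
      rw [norm_mul]
      gcongr
      exact hK' _
  have mq : Measurable fun q : ℝ × PathE d => rs q.2 q.1 ^ 2 * Φ (q.1, gs q.2 q.1) :=
    ((rs_meas2.comp measurable_swap).pow_const 2).mul (mΦ.comp (measurable_fst.prodMk (gs_meas2.comp measurable_swap)))
  have key : ∀ t, ∫ x, (fderiv ℝ φ (t, x) (1, v (t, x)) + φ (t, x) * g (t, x)) ∂(nuk σ t) = ∫ z, rs z t ^ 2 * Φ (t, gs z t) ∂σ := fun t =>
    integral_nuk σ t (f := fun x => Φ (t, x)) (mΦ.comp (measurable_const.prodMk measurable_id))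
  simp_rw [key]
  rw [integral_integral_swap]
  · rw [integral_eq_zero_of_ae]
    filter_upwards [S.good H] with z G
    exact G.stoppedCE H.hR hφ
  · refine ⟨mq.aestronglyMeasurable, ?_⟩
    rw [hasFiniteIntegral_iff_norm]
    have e : Measurable fun q : ℝ × PathE d => ENNReal.ofReal ‖rs q.2 q.1 ^ 2 * Φ (q.1, gs q.2 q.1)‖ := mq.norm.ennreal_ofReal
    show ∫⁻ q : ℝ × PathE d, ENNReal.ofReal ‖rs q.2 q.1 ^ 2 * Φ (q.1, gs q.2 q.1)‖ ∂((volume.restrict (Ioo (0:ℝ) 1)).prod σ) < ⊤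
    rw [lintegral_prod_symm _ e.aemeasurable]
    have mf : Measurable fun p => ENNReal.ofReal ‖Φ p‖ := mΦ.norm.ennreal_ofReal
    have h1 := S.lint_le H mf
    refine lt_of_le_of_lt (le_trans (lintegral_mono fun z => ?_) h1) ?_
    · refine le_trans (setLIntegral_mono' measurableSet_Ioo fun t ht => ?_) (lintegral_mono_set Ioo_subset_Ioc_self)
      have := kill_le z ht.2.le fun x => ENNReal.ofReal ‖Φ (t, x)‖
      refine le_trans (le_of_eq ?_) this
      dsimp only
      rw [norm_mul, Real.norm_of_nonneg (by positivity), ENNReal.ofReal_mul (by positivity)]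
    · have := iΦ.hasFiniteIntegral
      rwa [hasFiniteIntegral_iff_norm] at this

theorem nuk_le (H : CED v g κ R M) (S : Lift0 v g κ R σ) {t : ℝ} (ht : t ∈ Icc (0:ℝ) 1) : nuk σ t ≤ κ t :=
  (nuk_le_nu σ ht.2).trans (S.nu_le H ht)

theorem nuk_Dvg (H : CED v g κ R M) (S : Lift0 v g κ R σ) [IsFiniteMeasure σ] {Ω : Set (Euc d)} {ρ : ℝ → Measure (Euc d)}
    (hρ : Dvg Ω v g ρ) (hκ : ∀ t ∈ Icc (0:ℝ) 1, κ t = ρ t) : Dvg Ω v g (nuk σ) := by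
  have hle : ∀ t ∈ Icc (0:ℝ) 1, nuk σ t ≤ ρ t := fun t ht => hκ t ht ▸ nuk_le H S ht
  refine ⟨⟨fun t ht => ⟨?_, ?_⟩, fun φ hφ => nuk_cont H S hφ⟩, nuk_CE H S, ?_⟩
  · exact le_antisymm ((hle t ht _).trans (hρ.1.1 t ht).1.le) (zero_le)
  · exact ne_top_of_le_ne_top (hρ.1.1 t ht).2 (hle t ht _)
  · refine lt_of_le_of_lt ?_ hρ.2.2
    exact setLIntegral_mono' measurableSet_Ioo fun t ht => lintegral_mono' (hle t ⟨ht.1.le, ht.2.le⟩) le_rfl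

theorem min_eq_nuk (H : CED v g κ R M) (S : Lift0 v g κ R σ) [IsFiniteMeasure σ]
    (hmin : ∫⁻ t in Ioo (0:ℝ) 1, κ t univ ≤ ∫⁻ t in Ioo (0:ℝ) 1, nuk σ t univ) : ∀ t ∈ Icc (0:ℝ) 1, κ t = nuk σ t := by
  haveI := H.fin
  have hfinle : ∀ t ∈ Icc (0:ℝ) 1, nuk σ t univ ≠ ⊤ := fun t ht => ne_top_of_le_ne_top (measure_ne_top (κ t) univ) (nuk_le H S ht univ)
  have hae : (fun t => nuk σ t univ) =ᵐ[volume.restrict (Ioo (0:ℝ) 1)] fun t => κ t univ := by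
    have hl : ∀ᵐ t ∂(volume.restrict (Ioo (0:ℝ) 1)), nuk σ t univ ≤ κ t univ := by
      filter_upwards [ae_restrict_mem measurableSet_Ioo] with t ht
      exact nuk_le H S ⟨ht.1.le, ht.2.le⟩ univ
    refine ae_eq_of_ae_le_of_lintegral_le hl ?_ (κ.measurable_coe MeasurableSet.univ).aemeasurable hmin
    refine ne_top_of_le_ne_top ?_ ((lintegral_mono_ae hl).trans (lintegral_mono fun t => H.mass t))
    rw [lintegral_const]
    exact ENNReal.mul_ne_top ENNReal.ofReal_ne_top (measure_ne_top _ _)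
  have c1 : ContinuousOn (fun t => (nuk σ t).real univ) (Icc 0 1) := by
    have := nuk_cont H S (φ := fun _ => (1:ℝ)) continuous_const
    simpa using this
  have c2 : ContinuousOn (fun t => (κ t).real univ) (Icc 0 1) := by
    have := (H.cont (fun _ => (1:ℝ)) continuous_const).continuousOn (s := Icc 0 1)
    simpa using this
  have heq : EqOn (fun t => (nuk σ t).real univ) (fun t => (κ t).real univ) (Icc 0 1) := by
    refine Measure.eqOn_Icc_of_ae_eq volume zero_ne_one ?_ c1 c2
    rw [restrict_Ioo_eq_restrict_Icc.symm]
    filter_upwards [hae] with t ht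
    simp only [Measure.real, ht]
  intro t ht
  have h1 : (nuk σ t) univ = κ t univ := by
    have := heq ht
    simp only [Measure.real] at this
    exact (ENNReal.toReal_eq_toReal_iff' (hfinle t ht) (measure_ne_top _ _)).1 this
  haveI : IsFiniteMeasure (nuk σ t) := ⟨(hfinle t ht).lt_top⟩
  exact (Measure.eq_of_le_of_measure_univ_eq (nuk_le H S ht) h1).symm

structure Rep (v : XX d → Euc d) (g : XX d → ℝ) (R : ℝ) (ρ : ℝ → Measure (Euc d)) (σ : Measure (PathE d)) : Prop where
  hR : 0 < R
  good : ∀ᵐ z ∂σ, Good v g R z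
  start : σ.map (fun z => gm z 0) = ρ 0
  law : ∀ t ∈ Icc (0:ℝ) 1, ρ t = nuk σ t
  int : ∀ t ∈ Icc (0:ℝ) 1, Integrable (fun z => rs z t ^ 2) σ

theorem exists_Rep {Ω : Set (Euc d)} (hΩ : IsClosureOfBoundedConvexDomain Ω) (hv : Measurable v) (hg : Measurable g)
    {ρ₀ : Measure (Euc d)} {ρ : ℝ → Measure (Euc d)} (hρ : Dvg Ω v g ρ) (h0 : ρ 0 = ρ₀)
    (hmin : ∀ ρ' : ℝ → Measure (Euc d), Dvg Ω v g ρ' → ρ' 0 = ρ₀ → TVcurve ρ ≤ TVcurve ρ') :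
    ∃ (R : ℝ) (σ : FiniteMeasure (PathE d)), Rep v g R ρ (σ : Measure (PathE d)) := by
  obtain ⟨κ, R, M, H, hκ, -⟩ := exists_CED hΩ hv hg hρ
  obtain ⟨σ, S⟩ := exists_Lift0 H
  have z01 : (0:ℝ) ∈ Icc (0:ℝ) 1 := ⟨le_rfl, zero_le_one⟩
  have hD := nuk_Dvg H S hρ hκ
  have hm := hmin _ hD (by rw [nuk_zero, S.start_law H, hκ 0 z01, h0])
  have hlaw := min_eq_nuk H S (by
    refine le_trans (le_of_eq ?_) hm
    unfold TVcurve
    exact setLIntegral_congr_fun measurableSet_Ioo fun t ht => by rw [hκ t ⟨ht.1.le, ht.2.le⟩])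
  refine ⟨R, σ, H.hR, S.good H, ?_, fun t ht => by rw [← hκ t ht, hlaw t ht], fun t ht => ?_⟩
  · rw [← hκ 0 z01, ← S.start_law H]
    unfold nu
    have : (fun z : PathE d => ENNReal.ofReal (rp z 0 ^ 2)) =ᵐ[(σ : Measure (PathE d))] 1 := by
      filter_upwards [S.good H] with z G
      rw [G.rp_eq z01, G.start]; simp
    rw [withDensity_congr_ae this, withDensity_one]
  · refine Integrable.mono' (((integrable_const (2:ℝ)).add ((S.iQ2 H).const_mul 2))) ((rs_meas1 t).pow_const 2).aestronglyMeasurable ?_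
    filter_upwards [S.good H] with z G
    rw [Real.norm_of_nonneg (by positivity)]
    exact G.rp_sq (st_mem z ht)
end
end

section
open ProbabilityTheory

section
variable {v : XX d → Euc d} {g : XX d → ℝ} {R M : ℝ} {z : PathE d}

theorem Good.ac_fst (G : Good v g R z) : AC2 (rp z) := by
  have hi := G.en.integrable (by norm_num : (1:ℝ≥0∞) ≤ 2)
  have hi2 := G.en.integrable_norm_pow (by norm_num : (2:ℕ) ≠ 0)
  refine ⟨fun t => rp z t * (g (t, gm z t) / 2), ?_, ?_, fun t ht => ?_⟩
  · rw [integrableOn_Icc_iff_integrableOn_Ioc]; exact hi.fst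
  · rw [integrableOn_Icc_iff_integrableOn_Ioc]
    refine Integrable.mono' hi2 (hi.fst.aestronglyMeasurable.norm.pow 2) (Eventually.of_forall fun t => ?_)
    rw [Real.norm_of_nonneg (by positivity)]
    have := norm_fst_le (rp z t • phat v g (t, gm z t))
    gcongr
    exact this
  · have hin : IntervalIntegrable (fun s => rp z s • phat v g (s, gm z s)) volume 0 t := G.ii.mono_set (by
        rw [uIcc_of_le zero_le_one, uIcc_of_le ht.1]; exact Icc_subset_Icc_right ht.2)
    have h := (ContinuousLinearMap.fst ℝ ℝ (Euc d)).intervalIntegral_comp_comm hin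
    rw [G.rp_eq ht, G.rp_eq ⟨le_rfl, zero_le_one⟩, G.eq t ht, Prod.fst_add]
    congr 1
    exact h.symm

theorem Good.ac_snd (G : Good v g R z) : AC2 (fun t => rp z t • gm z t) := by
  have hi := G.en.integrable (by norm_num : (1:ℝ≥0∞) ≤ 2)
  have hi2 := G.en.integrable_norm_pow (by norm_num : (2:ℕ) ≠ 0)
  refine ⟨fun t => rp z t • (v (t, gm z t) + (g (t, gm z t) / 2) • gm z t), ?_, ?_, fun t ht => ?_⟩
  · rw [integrableOn_Icc_iff_integrableOn_Ioc]; exact hi.snd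
  · rw [integrableOn_Icc_iff_integrableOn_Ioc]
    refine Integrable.mono' hi2 (hi.snd.aestronglyMeasurable.norm.pow 2) (Eventually.of_forall fun t => ?_)
    rw [Real.norm_of_nonneg (by positivity)]
    have := norm_snd_le (rp z t • phat v g (t, gm z t))
    gcongr
    exact this
  · have hin : IntervalIntegrable (fun s => rp z s • phat v g (s, gm z s)) volume 0 t := G.ii.mono_set (by
        rw [uIcc_of_le zero_le_one, uIcc_of_le ht.1]; exact Icc_subset_Icc_right ht.2)
    have h := (ContinuousLinearMap.snd ℝ ℝ (Euc d)).intervalIntegral_comp_comm hin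
    show rp z t • gm z t = rp z 0 • gm z 0 + _
    rw [G.gm_eq ht, G.gm_eq ⟨le_rfl, zero_le_one⟩, G.eq t ht, Prod.snd_add]
    congr 1
    exact h.symm

theorem Good.ac_sq (G : Good v g R z) : AC2 (fun t => rp z t ^ 2) := by
  have hi := (G.en.integrable (by norm_num : (1:ℝ≥0∞) ≤ 2)).fst
  have hi2 := G.en.integrable_norm_pow (by norm_num : (2:ℕ) ≠ 0)
  obtain ⟨B, hB0, hB⟩ := rp_bdd z
  have ms : AEStronglyMeasurable (fun t => 2 * rp z t * (rp z t * (g (t, gm z t) / 2))) (volume.restrict (Ioc (0:ℝ) 1)) :=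
    ((rp_cont z).const_smul (2:ℝ)).aestronglyMeasurable.mul hi.aestronglyMeasurable
  have hbd : ∀ t ∈ Ioc (0:ℝ) 1, ‖2 * rp z t * (rp z t * (g (t, gm z t) / 2))‖ ≤ 2 * B * ‖rp z t • phat v g (t, gm z t)‖ := fun t ht => by
    have h1 := norm_fst_le (rp z t • phat v g (t, gm z t))
    have h2 := hB t ⟨ht.1.le, ht.2⟩
    have h3 := rp_nn z t
    rw [norm_mul, Real.norm_of_nonneg (by positivity)]
    gcongr
    exact h1
  refine ⟨fun t => 2 * rp z t * (rp z t * (g (t, gm z t) / 2)), ?_, ?_, fun t ht => ?_⟩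
  · rw [integrableOn_Icc_iff_integrableOn_Ioc]
    refine Integrable.mono' ((G.en.integrable (by norm_num : (1:ℝ≥0∞) ≤ 2)).norm.const_mul (2 * B)) ms ?_
    filter_upwards [ae_restrict_mem measurableSet_Ioc] with t ht using hbd t ht
  · rw [integrableOn_Icc_iff_integrableOn_Ioc]
    refine Integrable.mono' (hi2.const_mul ((2 * B) ^ 2)) (ms.norm.pow 2) ?_
    filter_upwards [ae_restrict_mem measurableSet_Ioc] with t ht
    rw [Real.norm_of_nonneg (by positivity), ← mul_pow]
    exact pow_le_pow_left₀ (norm_nonneg _) (hbd t ht) 2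
  · have hin : IntervalIntegrable (fun s => rp z s • phat v g (s, gm z s)) volume 0 t := G.ii.mono_set (by
        rw [uIcc_of_le zero_le_one, uIcc_of_le ht.1]; exact Icc_subset_Icc_right ht.2)
    have := ftc_dom (F := fun s => (ev z s).1 ^ 2) (f := fun t => 2 * rp z t * (rp z t * (g (t, gm z t) / 2))) (m := fun u => 2 * B * ‖rp z u • phat v g (u, gm z u)‖) ht.1
      (hin.norm.const_mul (2 * B)) ?_ ?_
    · rw [this]
      dsimp only
      rw [G.rp_eq ht, G.rp_eq ⟨le_rfl, zero_le_one⟩]; ring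
    · intro a ha b hb hab
      have ha1 : a ∈ Icc (0:ℝ) 1 := ⟨ha.1, ha.2.trans ht.2⟩
      have hb1 : b ∈ Icc (0:ℝ) 1 := ⟨hb.1, hb.2.trans ht.2⟩
      rw [intervalIntegral.integral_const_mul]
      have e : (ev z b).1 ^ 2 - (ev z a).1 ^ 2 = ((ev z b).1 + (ev z a).1) * ((ev z b).1 - (ev z a).1) := by ring
      show |(ev z b).1 ^ 2 - (ev z a).1 ^ 2| ≤ _
      rw [e, abs_mul]
      have h1 := (norm_fst_le (ev z b - ev z a)).trans (G.incr ha1 hb1 hab)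
      have h2 := hB a ha1
      have h3 := hB b hb1
      have h4 := (G.cone a ha1).1
      have h5 := (G.cone b hb1).1
      rw [G.rp_eq ha1] at h2
      rw [G.rp_eq hb1] at h3
      refine mul_le_mul ?_ h1 (abs_nonneg _) (by positivity)
      rw [abs_of_nonneg (by linarith)]; linarith
    · filter_upwards [G.dev] with s h hs
      have hs1 : s ∈ Ioo (0:ℝ) 1 := ⟨hs.1, hs.2.trans_le ht.2⟩
      have hr : HasDerivAt (fun s => (ev z s).1) (rp z s * (g (s, gm z s) / 2)) s :=
        (ContinuousLinearMap.fst ℝ ℝ (Euc d)).hasFDerivAt.comp_hasDerivAt s (h hs1)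
      refine ((hr.pow 2).congr_of_eventuallyEq (Eventually.of_forall fun s => rfl)).congr_deriv ?_
      rw [G.rp_eq ⟨hs1.1.le, hs1.2.le⟩]
      push_cast; ring

def HypAt (v : XX d → Euc d) (g : XX d → ℝ) (x : Euc d) : Prop := ∀ τ ∈ Ioo (0:ℝ) 1,
      ∀ (γ₁ γ₂ : ℝ → Euc d) (h₁ h₂ : ℝ → ℝ),
        AC2 h₁ → AC2 (fun t => Real.sqrt (h₁ t)) →
          AC2 (fun t => Real.sqrt (h₁ t) • γ₁ t) →
        AC2 h₂ → AC2 (fun t => Real.sqrt (h₂ t)) →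
          AC2 (fun t => Real.sqrt (h₂ t) • γ₂ t) →
        γ₁ 0 = x → h₁ 0 = 1 → γ₂ 0 = x → h₂ 0 = 1 →
        (∀ t ∈ Ico (0:ℝ) τ, 0 < h₁ t) → (∀ t ∈ Ico (0:ℝ) τ, 0 < h₂ t) →
        (∀ᵐ t ∂(volume.restrict (Ioo (0:ℝ) τ)), HasDerivAt γ₁ (v (t, γ₁ t)) t) →
        (∀ᵐ t ∂(volume.restrict (Ioo (0:ℝ) τ)), HasDerivAt h₁ (g (t, γ₁ t) * h₁ t) t) →
        (∀ᵐ t ∂(volume.restrict (Ioo (0:ℝ) τ)), HasDerivAt γ₂ (v (t, γ₂ t)) t) →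
        (∀ᵐ t ∂(volume.restrict (Ioo (0:ℝ) τ)), HasDerivAt h₂ (g (t, γ₂ t) * h₂ t) t) →
        ∀ t ∈ Ico (0:ℝ) τ, γ₁ t = γ₂ t ∧ h₁ t = h₂ t

theorem Good.hyp_der (G : Good v g R z) {τ : ℝ} (h1 : τ ≤ 1) (hp : ∀ t ∈ Ico (0:ℝ) τ, 0 < rp z t) :
    (∀ᵐ t ∂(volume.restrict (Ioo (0:ℝ) τ)), HasDerivAt (gm z) (v (t, gm z t)) t) ∧
    (∀ᵐ t ∂(volume.restrict (Ioo (0:ℝ) τ)), HasDerivAt (fun t => rp z t ^ 2) (g (t, gm z t) * (rp z t ^ 2)) t) := by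
  constructor
  · filter_upwards [ae_restrict_of_ae G.derivs, ae_restrict_mem measurableSet_Ioo] with t h ht
    exact (h ⟨ht.1, ht.2.trans_le h1⟩ (hp t ⟨ht.1.le, ht.2⟩)).2
  · filter_upwards [ae_restrict_of_ae G.derivs, ae_restrict_mem measurableSet_Ioo] with t h ht
    have := (h ⟨ht.1, ht.2.trans_le h1⟩ (hp t ⟨ht.1.le, ht.2⟩)).1
    refine ((this.pow 2).congr_of_eventuallyEq (Eventually.of_forall fun s => rfl)).congr_deriv ?_
    push_cast; ring

theorem Good.use {x : Euc d} (HX : HypAt v g x) {R' : ℝ} {z' : PathE d} (G : Good v g R z) (G' : Good v g R' z')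
    (hx : gm z 0 = x) (hx' : gm z' 0 = x) {τ : ℝ} (hτ : τ ∈ Ioo (0:ℝ) 1) (h1 : τ ≤ tz z) (h2 : τ ≤ tz z') :
    ∀ t ∈ Ico (0:ℝ) τ, gm z t = gm z' t ∧ rp z t = rp z' t := by
  have sq : ∀ w : PathE d, (fun t => Real.sqrt (rp w t ^ 2)) = rp w := fun w => funext fun t => Real.sqrt_sq (rp_nn w t)
  have sq2 : ∀ w : PathE d, (fun t => Real.sqrt (rp w t ^ 2) • gm w t) = fun t => rp w t • gm w t := fun w => funext fun t => by rw [Real.sqrt_sq (rp_nn w t)]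
  have p1 : ∀ t ∈ Ico (0:ℝ) τ, 0 < rp z t := fun t ht => tz_pos z ht.1 (ht.2.trans_le h1)
  have p2 : ∀ t ∈ Ico (0:ℝ) τ, 0 < rp z' t := fun t ht => tz_pos z' ht.1 (ht.2.trans_le h2)
  have z01 : (0:ℝ) ∈ Icc (0:ℝ) 1 := ⟨le_rfl, zero_le_one⟩
  have := HX τ hτ (gm z) (gm z') (fun t => rp z t ^ 2) (fun t => rp z' t ^ 2) G.ac_sq (by rw [sq]; exact G.ac_fst) (by rw [sq2]; exact G.ac_snd)
    G'.ac_sq (by rw [sq]; exact G'.ac_fst) (by rw [sq2]; exact G'.ac_snd) hx (by rw [G.rp_eq z01, G.start, one_pow]) hx' (by rw [G'.rp_eq z01, G'.start, one_pow])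
    (fun t ht => pow_pos (p1 t ht) 2) (fun t ht => pow_pos (p2 t ht) 2) (G.hyp_der hτ.2.le p1).1 (G.hyp_der hτ.2.le p1).2 (G'.hyp_der hτ.2.le p2).1 (G'.hyp_der hτ.2.le p2).2
  intro t ht
  refine ⟨(this t ht).1, ?_⟩
  have e := (this t ht).2
  exact (pow_left_inj₀ (rp_nn _ _) (rp_nn _ _) (by norm_num)).1 e

theorem Good.tz_gt (G : Good v g R z) : 0 < tz z := by
  have z01 : (0:ℝ) ∈ Icc (0:ℝ) 1 := ⟨le_rfl, zero_le_one⟩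
  refine lt_of_le_of_ne (tz_mem z).1 fun h => ?_
  rcases tz_end z with h1 | h1
  · rw [← h, G.rp_eq z01, G.start] at h1; exact one_ne_zero h1
  · linarith

theorem Good.tz_not_lt {x : Euc d} (HX : HypAt v g x) {R' : ℝ} {z' : PathE d} (G : Good v g R z) (G' : Good v g R' z')
    (hx : gm z 0 = x) (hx' : gm z' 0 = x) : ¬ tz z < tz z' := by
  intro h
  have hlt : tz z < 1 := h.trans_le (tz_mem z').2
  have h1 := Good.use HX G G' hx hx' ⟨G.tz_gt, hlt⟩ le_rfl h.le
  have h2 : EqOn (rp z) (rp z') (closure (Ico 0 (tz z))) :=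
    EqOn.closure (fun t ht => (h1 t ht).2) (rp_cont z) (rp_cont z')
  rw [closure_Ico G.tz_gt.ne] at h2
  have h3 := h2 (right_mem_Icc.2 G.tz_gt.le)
  have h4 := (tz_end z).resolve_right hlt.ne
  have h5 := tz_pos z' (tz_mem z).1 h
  rw [← h3, h4] at h5
  exact lt_irrefl _ h5

theorem Good.unique {x : Euc d} (HX : HypAt v g x) {R' : ℝ} {z' : PathE d} (G : Good v g R z) (G' : Good v g R' z')
    (hx : gm z 0 = x) (hx' : gm z' 0 = x) {t : ℝ} (ht : t ∈ Ico (0:ℝ) 1) : rs z t = rs z' t ∧ gs z t = gs z' t := by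
  have hT : tz z = tz z' := le_antisymm (not_lt.1 (Good.tz_not_lt HX G' G hx' hx)) (not_lt.1 (Good.tz_not_lt HX G G' hx hx'))
  rcases lt_or_ge t (tz z) with h | h
  · unfold rs gs
    rw [st_le h.le, st_le (hT ▸ h.le)]
    have hh : t < min (tz z) ((t + 1) / 2) := lt_min h (by linarith [ht.2])
    have := Good.use HX G G' hx hx' (τ := min (tz z) ((t + 1) / 2)) ⟨ht.1.trans_lt hh, (min_le_right _ _).trans_lt (by linarith [ht.2])⟩ (min_le_left _ _)
      ((min_le_left _ _).trans hT.le) t ⟨ht.1, hh⟩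
    exact ⟨this.2, this.1⟩
  · have a1 := (tz_end z).resolve_right (h.trans_lt ht.2).ne
    have a2 := (tz_end z').resolve_right (hT ▸ (h.trans_lt ht.2).ne)
    unfold rs gs st gm
    rw [min_eq_right h, min_eq_right (hT ▸ h), a1, a2]
    simp
end

instance : StandardBorelSpace (PathE d) := by infer_instance

theorem rep_unique {v : XX d → Euc d} {g : XX d → ℝ} {A : Set (Euc d)} (Hyp : ∀ x ∈ A, HypAt v g x) {ρ₀ : Measure (Euc d)}
    (hA0 : ρ₀ Aᶜ = 0) {ρ₁ ρ₂ : ℝ → Measure (Euc d)} {R₁ R₂ : ℝ} {σ₁ σ₂ : Measure (PathE d)} [IsFiniteMeasure σ₁] [IsFiniteMeasure σ₂]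
    (h1 : Rep v g R₁ ρ₁ σ₁) (h2 : Rep v g R₂ ρ₂ σ₂) (e1 : ρ₁ 0 = ρ₀) (e2 : ρ₂ 0 = ρ₀) {t : ℝ} (ht : t ∈ Ico (0:ℝ) 1) : ρ₁ t = ρ₂ t := by
  haveI : Nonempty (PathE d) := ⟨ContinuousMap.const _ 0⟩
  have mX : Measurable fun z : PathE d => gm z 0 := gm_meas1 0
  have dis : ∀ (σ : Measure (PathE d)) (ρ : ℝ → Measure (Euc d)) (R : ℝ), IsFiniteMeasure σ → Rep v g R ρ σ → ρ 0 = ρ₀ →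
      ∃ K : Kernel (Euc d) (PathE d), IsMarkovKernel K ∧ (∀ᵐ x ∂ρ₀, ∀ᵐ z ∂(K x), Good v g R z ∧ gm z 0 = x) ∧
        ∀ f : PathE d → ℝ≥0∞, Measurable f → ∫⁻ z, f z ∂σ = ∫⁻ x, (∫⁻ z, f z ∂(K x)) ∂ρ₀ := by
    intro σ ρ R hfin hR he
    have hcp : (σ.map fun z : PathE d => gm z 0) ⊗ₘ condDistrib id (fun z : PathE d => gm z 0) σ = σ.map fun z => (gm z 0, id z) :=
      compProd_map_condDistrib aemeasurable_id
    rw [hR.start, he] at hcp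
    haveI : IsFiniteMeasure ρ₀ := by
      rw [← he, ← hR.start]; infer_instance
    have mp : Measurable fun z : PathE d => (gm z 0, id z) := mX.prodMk measurable_id
    refine ⟨condDistrib id (fun z : PathE d => gm z 0) σ, inferInstance, ?_, fun f hf => ?_⟩
    · set N := toMeasurable σ {z | ¬ Good v g R z} with hN
      have hN0 : σ N = 0 := by rw [hN, measure_toMeasurable]; exact hR.good
      have hae : ∀ᵐ q ∂(ρ₀ ⊗ₘ condDistrib id (fun z : PathE d => gm z 0) σ), q.2 ∉ N ∧ gm q.2 0 = q.1 := by
        rw [hcp, ae_map_iff mp.aemeasurable]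
        · have : ∀ᵐ z ∂σ, z ∉ N := measure_eq_zero_iff_ae_notMem.1 hN0
          filter_upwards [this] with z hz
          exact ⟨hz, rfl⟩
        · refine MeasurableSet.inter ((measurableSet_toMeasurable _ _).compl.preimage measurable_snd) ?_
          exact measurableSet_eq_fun (mX.comp measurable_snd) measurable_fst
      filter_upwards [Measure.ae_ae_of_ae_compProd hae] with x hx
      filter_upwards [hx] with z hz
      refine ⟨?_, hz.2⟩
      by_contra hG
      exact hz.1 (subset_toMeasurable _ _ hG)
    · have : ∫⁻ q : Euc d × PathE d, f q.2 ∂(ρ₀ ⊗ₘ condDistrib id (fun z : PathE d => gm z 0) σ) = ∫⁻ x, (∫⁻ z, f z ∂(condDistrib id (fun z : PathE d => gm z 0) σ x)) ∂ρ₀ :=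
        Measure.lintegral_compProd (hf.comp measurable_snd)
      rw [← this, hcp]
      exact (lintegral_map (f := fun q : Euc d × PathE d => f q.2) (hf.comp measurable_snd) mp).symm
  obtain ⟨K₁, M₁, g₁, i₁⟩ := dis σ₁ ρ₁ R₁ inferInstance h1 e1
  obtain ⟨K₂, M₂, g₂, i₂⟩ := dis σ₂ ρ₂ R₂ inferInstance h2 e2
  have htI : t ∈ Icc (0:ℝ) 1 := ⟨ht.1, ht.2.le⟩
  rw [h1.law t htI, h2.law t htI]
  ext B hB
  set f : PathE d → ℝ≥0∞ := fun z => ENNReal.ofReal (rs z t ^ 2) * B.indicator 1 (gs z t) with hf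
  have mB : Measurable (B.indicator (1 : Euc d → ℝ≥0∞)) := measurable_one.indicator hB
  have mf : Measurable f := ((rs_meas1 t).pow_const 2).ennreal_ofReal.mul (mB.comp (gs_meas1 t))
  rw [← lintegral_indicator_one hB, ← lintegral_indicator_one hB, lintegral_nuk σ₁ t mB, lintegral_nuk σ₂ t mB]
  show ∫⁻ z, f z ∂σ₁ = ∫⁻ z, f z ∂σ₂
  rw [i₁ f mf, i₂ f mf]
  have hAa : ∀ᵐ x ∂ρ₀, x ∈ A := hA0
  refine lintegral_congr_ae ?_
  filter_upwards [g₁, g₂, hAa] with x a1 a2 ax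
  obtain ⟨z₁, b1⟩ := a1.exists
  have c2 : ∀ᵐ z ∂(K₂ x), f z = f z₁ := by
    filter_upwards [a2] with z hz
    have := Good.unique (Hyp x ax) b1.1 hz.1 b1.2 hz.2 ht
    simp only [hf, this.1, this.2]
  obtain ⟨z₂, b2, b3⟩ := (a2.and c2).exists
  have c1 : ∀ᵐ z ∂(K₁ x), f z = f z₁ := by
    filter_upwards [a1] with z hz
    rw [← b3]
    have := Good.unique (Hyp x ax) b2.1 hz.1 b2.2 hz.2 ht
    simp only [hf, this.1, this.2]
  rw [lintegral_congr_ae c1, lintegral_congr_ae c2]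
  simp

theorem final_unique {Ω : Set (Euc d)} (hΩ : IsClosureOfBoundedConvexDomain Ω)
    {v : XX d → Euc d} {g : XX d → ℝ} (hv : Measurable v) (hg : Measurable g)
    {A : Set (Euc d)} (Hyp : ∀ x ∈ A, HypAt v g x) {ρ₀ : Measure (Euc d)} (hρ₀A : ρ₀ Aᶜ = 0)
    {ρ₁ ρ₂ : ℝ → Measure (Euc d)}
    (hρ₁ : Dvg Ω v g ρ₁) (hρ₁0 : ρ₁ 0 = ρ₀)
    (hρ₁min : ∀ ρ' : ℝ → Measure (Euc d), Dvg Ω v g ρ' → ρ' 0 = ρ₀ → TVcurve ρ₁ ≤ TVcurve ρ')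
    (hρ₂ : Dvg Ω v g ρ₂) (hρ₂0 : ρ₂ 0 = ρ₀)
    (hρ₂min : ∀ ρ' : ℝ → Measure (Euc d), Dvg Ω v g ρ' → ρ' 0 = ρ₀ → TVcurve ρ₂ ≤ TVcurve ρ') :
    ∀ t ∈ Icc (0:ℝ) 1, ρ₁ t = ρ₂ t := by
  obtain ⟨R₁, σ₁, h1⟩ := exists_Rep hΩ hv hg hρ₁ hρ₁0 hρ₁min
  obtain ⟨R₂, σ₂, h2⟩ := exists_Rep hΩ hv hg hρ₂ hρ₂0 hρ₂min
  have key : ∀ t ∈ Ico (0:ℝ) 1, ρ₁ t = ρ₂ t := fun t ht => rep_unique Hyp hρ₀A h1 h2 hρ₁0 hρ₂0 ht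
  intro t ht
  haveI : IsFiniteMeasure (ρ₁ t) := ⟨(hρ₁.1.1 t ht).2.lt_top⟩
  haveI : IsFiniteMeasure (ρ₂ t) := ⟨(hρ₂.1.1 t ht).2.lt_top⟩
  refine ext_of_forall_integral_eq_of_IsFiniteMeasure fun φ => ?_
  have heq : EqOn (fun t => ∫ x, φ x ∂(ρ₁ t)) (fun t => ∫ x, φ x ∂(ρ₂ t)) (Icc 0 1) := by
    refine Measure.eqOn_Icc_of_ae_eq volume zero_ne_one ?_ (hρ₁.1.2 φ φ.continuous) (hρ₂.1.2 φ φ.continuous)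
    rw [restrict_Ico_eq_restrict_Icc.symm]
    filter_upwards [ae_restrict_mem measurableSet_Ico] with s hs
    rw [key s hs]
  exact heq ht

end

/-- **Uniqueness of minimal total-variation solutions.**
If for every `x ∈ A` the characteristic system `γ' = v(t,γ)` a.e. on `{h>0}`,
`h' = g(t,γ) h` a.e., with initial value `(x,1)`, has a unique solution up to
any time `τ` with `[0,τ) ⊆ {h>0}`, then for every initial datum `ρ₀ ∈ M⁺(Ω)`
concentrated on `A` the continuity equation has at most one finite-energy
narrowly continuous solution with initial datum `ρ₀` and minimal total variation. -/
theorem uniqueness_minimal_TV (d : ℕ) (hd : 1 ≤ d) (Ω : Set (Euc d))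
    (hΩ : IsClosureOfBoundedConvexDomain Ω)
    (v : XX d → Euc d) (g : XX d → ℝ) (hv : Measurable v) (hg : Measurable g)
    (A : Set (Euc d)) (hA : MeasurableSet A) (hAΩ : A ⊆ Ω)
    (Hyp : ∀ x ∈ A, ∀ τ ∈ Ioo (0:ℝ) 1,
      ∀ (γ₁ γ₂ : ℝ → Euc d) (h₁ h₂ : ℝ → ℝ),
        AC2 h₁ → AC2 (fun t => Real.sqrt (h₁ t)) →
          AC2 (fun t => Real.sqrt (h₁ t) • γ₁ t) →
        AC2 h₂ → AC2 (fun t => Real.sqrt (h₂ t)) →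
          AC2 (fun t => Real.sqrt (h₂ t) • γ₂ t) →
        γ₁ 0 = x → h₁ 0 = 1 → γ₂ 0 = x → h₂ 0 = 1 →
        (∀ t ∈ Ico (0:ℝ) τ, 0 < h₁ t) → (∀ t ∈ Ico (0:ℝ) τ, 0 < h₂ t) →
        (∀ᵐ t ∂(volume.restrict (Ioo (0:ℝ) τ)), HasDerivAt γ₁ (v (t, γ₁ t)) t) →
        (∀ᵐ t ∂(volume.restrict (Ioo (0:ℝ) τ)), HasDerivAt h₁ (g (t, γ₁ t) * h₁ t) t) →
        (∀ᵐ t ∂(volume.restrict (Ioo (0:ℝ) τ)), HasDerivAt γ₂ (v (t, γ₂ t)) t) →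
        (∀ᵐ t ∂(volume.restrict (Ioo (0:ℝ) τ)), HasDerivAt h₂ (g (t, γ₂ t) * h₂ t) t) →
        ∀ t ∈ Ico (0:ℝ) τ, γ₁ t = γ₂ t ∧ h₁ t = h₂ t)
    (ρ₀ : Measure (Euc d)) (hρ₀fin : IsFiniteMeasure ρ₀) (hρ₀A : ρ₀ Aᶜ = 0)
    (ρ₁ ρ₂ : ℝ → Measure (Euc d))
    (hρ₁ : Dvg Ω v g ρ₁) (hρ₁0 : ρ₁ 0 = ρ₀)
    (hρ₁min : ∀ ρ' : ℝ → Measure (Euc d), Dvg Ω v g ρ' → ρ' 0 = ρ₀ →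
      TVcurve ρ₁ ≤ TVcurve ρ')
    (hρ₂ : Dvg Ω v g ρ₂) (hρ₂0 : ρ₂ 0 = ρ₀)
    (hρ₂min : ∀ ρ' : ℝ → Measure (Euc d), Dvg Ω v g ρ' → ρ' 0 = ρ₀ →
      TVcurve ρ₂ ≤ TVcurve ρ') :
    ∀ t ∈ Icc (0:ℝ) 1, ρ₁ t = ρ₂ t := by
  exact final_unique hΩ hv hg (fun x hx => Hyp x hx) hρ₀A hρ₁ hρ₁0 hρ₁min hρ₂ hρ₂0 hρ₂min

end Paper
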